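/- arXiv:0909.2796 — 3 statements merged into one kernel-verified Lean document; each statement's English description precedes it below -/
import Mathlib

section
/- Let Ω = (-L,L)^{d-1} × (-1/2,1/2), d = 2 or 3. There is a constant C > 0 such that for all 0 < h ≤ 1 and all u ∈ H¹(Ω; ℝ^d) that are periodic in the tangential directions (u|_{x_j = -L} = u|_{x_j = L} for j = 1,…,d-1), one has ‖∇_h u‖_{L²(Ω)} ≤ C ‖(1/h) ε_h(u)‖_{L²(Ω)}, where ∇_h = (∇_{x'}, (1/h)∂_{x_d}) and ε_h(u) = sym(∇_h u). -/
/- STATEMENT 7: Korn inequality in thin domains: on Ω = (-L,L)^{d-1} × (-1/2,1/2), d = 2,3,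
there is C such that for all 0 < h ≤ 1 and all tangentially periodic u ∈ H¹(Ω;ℝ^d),
‖∇_h u‖_{L²(Ω)} ≤ C ‖h⁻¹ ε_h(u)‖_{L²(Ω)}, with ∇_h = (∇_{x'}, h⁻¹∂_{x_d}),
ε_h(u) = sym ∇_h u (stated in squared form). -/

open MeasureTheory Set
noncomputable section

variable (d : ℕ) (L h : ℝ)

/-- Ω = (-L,L)^{d-1} × (-1/2,1/2), the last coordinate being the normal one. -/
def Omega : Set (Fin d → ℝ) :=
  {x | ∀ i : Fin d, (if (i : ℕ) < d - 1 then x i ∈ Ioo (-L) L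
        else x i ∈ Ioo (-(1/2) : ℝ) (1/2))}

/-- partial derivative ∂_{x_j} of a scalar function. -/
def pd (j : Fin d) (f : (Fin d → ℝ) → ℝ) (x : Fin d → ℝ) : ℝ :=
  fderiv ℝ f x (Pi.single j 1)

/-- periodicity in the tangential directions, with period 2L. -/
def TangPeriodic (f : (Fin d → ℝ) → ℝ) : Prop :=
  ∀ (x : Fin d → ℝ) (j : Fin d), (j : ℕ) < d - 1 →
    f (Function.update x j (x j + 2 * L)) = f x

/-- scaled gradient ∇_h u (i-th row, j-th column). -/
def gradh (u : (Fin d → ℝ) → Fin d → ℝ) (x : Fin d → ℝ) (i j : Fin d) : ℝ :=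
  (if (j : ℕ) < d - 1 then 1 else h⁻¹) * pd d j (fun y => u y i) x

/-- scaled symmetrized gradient ε_h(u). -/
def epsh (u : (Fin d → ℝ) → Fin d → ℝ) (x : Fin d → ℝ) (i j : Fin d) : ℝ :=
  (gradh d h u x i j + gradh d h u x j i) / 2


/-! ### Helper material: two-dimensional analysis -/

/-- iterated integral over a rectangle. -/
def boxInt (a b c e : ℝ) (φ : ℝ × ℝ → ℝ) : ℝ := ∫ t in c..e, ∫ s in a..b, φ (s, t)

lemma cont_inner (a b : ℝ) {φ : ℝ × ℝ → ℝ} (hφ : Continuous φ) :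
    Continuous (fun t : ℝ => ∫ s in a..b, φ (s, t)) := by
  apply intervalIntegral.continuous_parametric_intervalIntegral_of_continuous'
  simp only [Function.uncurry_def]
  fun_prop

lemma boxInt_add (a b c e : ℝ) {φ ψ : ℝ × ℝ → ℝ} (hφ : Continuous φ) (hψ : Continuous ψ) :
    boxInt a b c e (fun p => φ p + ψ p) = boxInt a b c e φ + boxInt a b c e ψ := by
  unfold boxInt
  rw [← intervalIntegral.integral_add ((cont_inner a b hφ).intervalIntegrable _ _)
    ((cont_inner a b hψ).intervalIntegrable _ _)]
  congr 1; ext t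
  exact intervalIntegral.integral_add (Continuous.intervalIntegrable (by fun_prop) _ _)
    (Continuous.intervalIntegrable (by fun_prop) _ _)

lemma boxInt_const_mul (a b c e k : ℝ) (φ : ℝ × ℝ → ℝ) :
    boxInt a b c e (fun p => k * φ p) = k * boxInt a b c e φ := by
  simp [boxInt]

lemma boxInt_sub (a b c e : ℝ) {φ ψ : ℝ × ℝ → ℝ} (hφ : Continuous φ) (hψ : Continuous ψ) :
    boxInt a b c e (fun p => φ p - ψ p) = boxInt a b c e φ - boxInt a b c e ψ := by
  have h := boxInt_add a b c e hφ (ψ := fun p => (-1) * ψ p) (by fun_prop)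
  rw [boxInt_const_mul] at h
  simp only [neg_mul, one_mul, ← sub_eq_add_neg] at h
  exact h

lemma boxInt_mono {a b c e : ℝ} (hab : a ≤ b) (hce : c ≤ e) {φ ψ : ℝ × ℝ → ℝ}
    (hφ : Continuous φ) (hψ : Continuous ψ)
    (h : ∀ s ∈ Icc a b, ∀ t ∈ Icc c e, φ (s, t) ≤ ψ (s, t)) :
    boxInt a b c e φ ≤ boxInt a b c e ψ := by
  unfold boxInt
  apply intervalIntegral.integral_mono_on hce ((cont_inner a b hφ).intervalIntegrable _ _)
    ((cont_inner a b hψ).intervalIntegrable _ _)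
  intro t ht
  apply intervalIntegral.integral_mono_on hab (Continuous.intervalIntegrable (by fun_prop) _ _)
    (Continuous.intervalIntegrable (by fun_prop) _ _)
  intro s hs
  exact h s hs t ht

lemma boxInt_nonneg {a b c e : ℝ} (hab : a ≤ b) (hce : c ≤ e) {φ : ℝ × ℝ → ℝ}
    (h : ∀ p, 0 ≤ φ p) : 0 ≤ boxInt a b c e φ := by
  unfold boxInt
  exact intervalIntegral.integral_nonneg hce fun t _ =>
    intervalIntegral.integral_nonneg hab fun s _ => h _

/-- a `C¹` function of two variables with its partial derivatives. -/
structure C1 (f fs ft : ℝ × ℝ → ℝ) : Prop where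
  cf : Continuous f
  cs : Continuous fs
  ct : Continuous ft
  ds : ∀ s t, HasDerivAt (fun x => f (x, t)) (fs (s, t)) s
  dt : ∀ s t, HasDerivAt (fun x => f (s, x)) (ft (s, t)) t

lemma hasDerivAt_param {F F' : ℝ × ℝ → ℝ} (cF : Continuous F) (cF' : Continuous F')
    (hd : ∀ s t, HasDerivAt (fun x => F (s, x)) (F' (s, t)) t) (a b t : ℝ) :
    HasDerivAt (fun x => ∫ s in a..b, F (s, x)) (∫ s in a..b, F' (s, t)) t := by
  have hK : IsCompact (uIcc a b ×ˢ Metric.closedBall t 1) :=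
    isCompact_uIcc.prod (isCompact_closedBall t 1)
  obtain ⟨M, hM⟩ := hK.exists_bound_of_continuousOn cF'.continuousOn
  refine (intervalIntegral.hasDerivAt_integral_of_dominated_loc_of_deriv_le
    (F := fun x s => F (s, x)) (F' := fun x s => F' (s, x)) (bound := fun _ => M)
    (Metric.closedBall_mem_nhds t one_pos) ?_ ?_ ?_ ?_ ?_ ?_).2
  · exact Filter.Eventually.of_forall fun x =>
      (Continuous.aestronglyMeasurable (by fun_prop))
  · exact Continuous.intervalIntegrable (by fun_prop) _ _
  · exact Continuous.aestronglyMeasurable (by fun_prop)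
  · exact Filter.Eventually.of_forall fun s hs x hx => hM (s, x) ⟨uIoc_subset_uIcc hs, hx⟩
  · exact intervalIntegrable_const
  · exact Filter.Eventually.of_forall fun s _ x _ => hd s x

/-- the key null-Lagrangian identity in differentiated form. -/
lemma hasDerivAt_phi {f fs ft g gs gt : ℝ × ℝ → ℝ} (hf : C1 f fs ft) (hg : C1 g gs gt)
    {a b : ℝ} (pf : ∀ t, f (b, t) = f (a, t)) (pg : ∀ t, g (b, t) = g (a, t)) (t : ℝ) :
    HasDerivAt (fun t => ∫ s in a..b, fs (s, t) * g (s, t))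
      (∫ s in a..b, (fs (s, t) * gt (s, t) - ft (s, t) * gs (s, t))) t := by
  have cf := hf.cf; have cfs := hf.cs; have cft := hf.ct
  have cg := hg.cf; have cgs := hg.cs; have cgt := hg.ct
  set Ψ : ℝ → ℝ → ℝ := fun t τ => ∫ s in a..b, fs (s, t) * g (s, τ) with hΨ
  have hΨ' : ∀ t τ, Ψ t τ = ∫ s in a..b, -(f (s, t) * gs (s, τ)) := by
    intro t τ
    have := intervalIntegral.integral_mul_deriv_eq_deriv_mul (a := a) (b := b)
      (u := fun s => g (s, τ)) (v := fun s => f (s, t)) (u' := fun s => gs (s, τ))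
      (v' := fun s => fs (s, t)) (fun x _ => hg.ds x τ) (fun x _ => hf.ds x t)
      (Continuous.intervalIntegrable (by fun_prop) _ _)
      (Continuous.intervalIntegrable (by fun_prop) _ _)
    rw [pf, pg, sub_self, zero_sub] at this
    rw [intervalIntegral.integral_neg, hΨ]
    simp only [mul_comm (fs _), mul_comm (f _)]
    exact this
  have h1 : ∀ t τ, HasDerivAt (fun t => Ψ t τ) (∫ s in a..b, -(ft (s, t) * gs (s, τ))) t := by
    intro t τ
    simp only [hΨ']
    exact hasDerivAt_param (F := fun p => -(f p * gs (p.1, τ)))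
      (F' := fun p => -(ft p * gs (p.1, τ))) (by fun_prop) (by fun_prop)
      (fun s t => ((hf.dt s t).mul_const (gs (s, τ))).fun_neg) a b t
  have h2 : ∀ t τ, HasDerivAt (fun τ => Ψ t τ) (∫ s in a..b, fs (s, t) * gt (s, τ)) τ := by
    intro t τ
    exact hasDerivAt_param (F := fun p => fs (p.1, t) * g p)
      (F' := fun p => fs (p.1, t) * gt p) (by fun_prop) (by fun_prop)
      (fun s t' => ((hg.dt s t').const_mul (fs (s, t)))) a b τ
  have c1 : Continuous fun p : ℝ × ℝ => ∫ s in a..b, -(ft (s, p.1) * gs (s, p.2)) := by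
    apply intervalIntegral.continuous_parametric_intervalIntegral_of_continuous'
    simp only [Function.uncurry_def]
    fun_prop
  have c2 : Continuous fun p : ℝ × ℝ => ∫ s in a..b, fs (s, p.1) * gt (s, p.2) := by
    apply intervalIntegral.continuous_parametric_intervalIntegral_of_continuous'
    simp only [Function.uncurry_def]
    fun_prop
  have key := hasStrictFDerivAt_uncurry_coprod (𝕜 := ℝ) (u := (t, t)) (f := Ψ)
    (f₁ := fun t τ => ContinuousLinearMap.toSpanSingleton ℝ (∫ s in a..b, -(ft (s, t) * gs (s, τ))))
    (f₂ := fun t τ => ContinuousLinearMap.toSpanSingleton ℝ (∫ s in a..b, fs (s, t) * gt (s, τ)))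
    (Filter.Eventually.of_forall fun v => (h1 v.1 v.2).hasFDerivAt)
    (Filter.Eventually.of_forall fun v => (h2 v.1 v.2).hasFDerivAt)
    (by
      apply Continuous.continuousAt
      exact (ContinuousLinearMap.toSpanSingletonCLE (𝕜 := ℝ) (E := ℝ)).continuous.comp c1)
    (by
      apply Continuous.continuousAt
      exact (ContinuousLinearMap.toSpanSingletonCLE (𝕜 := ℝ) (E := ℝ)).continuous.comp c2)
  have hdiag : HasDerivAt (fun t : ℝ => (t, t)) ((1 : ℝ), (1 : ℝ)) t :=
    (hasDerivAt_id t).prodMk (hasDerivAt_id t)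
  have := HasFDerivAt.comp_hasDerivAt (f := fun t : ℝ => (t, t)) t key.hasFDerivAt hdiag
  have e : (∫ s in a..b, (fs (s, t) * gt (s, t) - ft (s, t) * gs (s, t))) =
      (1 : ℝ) • (∫ s in a..b, -(ft (s, t) * gs (s, t)))
    + (1 : ℝ) • (∫ s in a..b, fs (s, t) * gt (s, t)) := by
    rw [one_smul, one_smul]
    rw [← intervalIntegral.integral_add (Continuous.intervalIntegrable (by fun_prop) _ _)
      (Continuous.intervalIntegrable (by fun_prop) _ _)]
    congr 1; ext s; ring
  rw [e]
  exact this

lemma boxInt_null {f fs ft g gs gt : ℝ × ℝ → ℝ} (hf : C1 f fs ft) (hg : C1 g gs gt)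
    {a b : ℝ} (pf : ∀ t, f (b, t) = f (a, t)) (pg : ∀ t, g (b, t) = g (a, t)) (c e : ℝ) :
    boxInt a b c e (fun p => fs p * gt p - ft p * gs p) =
      (∫ s in a..b, fs (s, e) * g (s, e)) - ∫ s in a..b, fs (s, c) * g (s, c) := by
  have cf := hf.cf; have cfs := hf.cs; have cft := hf.ct
  have cg := hg.cf; have cgs := hg.cs; have cgt := hg.ct
  unfold boxInt
  exact intervalIntegral.integral_eq_sub_of_hasDerivAt
    (f := fun t => ∫ s in a..b, fs (s, t) * g (s, t))
    (fun t _ => hasDerivAt_phi hf hg pf pg t)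
    ((cont_inner a b (φ := fun p => fs p * gt p - ft p * gs p) (by fun_prop)).intervalIntegrable _ _)

lemma boxInt_null_weight {f fs ft g gs gt : ℝ × ℝ → ℝ} (hf : C1 f fs ft) (hg : C1 g gs gt)
    {a b : ℝ} (pf : ∀ t, f (b, t) = f (a, t)) (pg : ∀ t, g (b, t) = g (a, t)) {c e : ℝ}
    (hce : e - c = 1) :
    (∫ s in a..b, fs (s, e) * g (s, e)) = boxInt a b c e (fun p => fs p * g p) +
      boxInt a b c e (fun p => (p.2 - c) * (fs p * gt p - ft p * gs p)) := by
  have cf := hf.cf; have cfs := hf.cs; have cft := hf.ct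
  have cg := hg.cf; have cgs := hg.cs; have cgt := hg.ct
  have c1 := cont_inner a b (φ := fun p => fs p * g p) (by fun_prop)
  have c2 := cont_inner a b (φ := fun p => fs p * gt p - ft p * gs p) (by fun_prop)
  have h := intervalIntegral.integral_eq_sub_of_hasDerivAt (a := c) (b := e)
    (f := fun t => (t - c) * ∫ s in a..b, fs (s, t) * g (s, t))
    (fun t _ => ((hasDerivAt_id t).sub_const c).mul (hasDerivAt_phi hf hg pf pg t))
    (Continuous.intervalIntegrable (by simp only [id]; fun_prop) _ _)
  simp only [id, hce, sub_self, zero_mul, one_mul, sub_zero] at h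
  rw [← h]
  unfold boxInt
  rw [← intervalIntegral.integral_add]
  · simp only [intervalIntegral.integral_const_mul]
  · exact c1.intervalIntegrable _ _
  · simp only [intervalIntegral.integral_const_mul]
    exact Continuous.intervalIntegrable (by fun_prop) _ _

lemma sq_sub_le {G G' : ℝ → ℝ} (hc : Continuous G') (hd : ∀ s, HasDerivAt G (G' s) s)
    {a b s : ℝ} (hs : s ∈ Icc a b) :
    (G s - G a) ^ 2 ≤ (b - a) * ∫ x in a..b, G' x ^ 2 := by
  obtain ⟨h1, h2⟩ := hs
  have hD : ∫ x in a..s, G' x = G s - G a :=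
    intervalIntegral.integral_eq_sub_of_hasDerivAt (fun x _ => hd x) (hc.intervalIntegrable _ _)
  have hle : ∫ x in a..s, G' x ^ 2 ≤ ∫ x in a..b, G' x ^ 2 := by
    rw [← intervalIntegral.integral_add_adjacent_intervals (b := s) (c := b)
      (Continuous.intervalIntegrable (by fun_prop) _ _)
      (Continuous.intervalIntegrable (by fun_prop) _ _)]
    have : 0 ≤ ∫ x in s..b, G' x ^ 2 :=
      intervalIntegral.integral_nonneg h2 fun _ _ => sq_nonneg _
    linarith
  rcases eq_or_lt_of_le (h1.trans h2) with h | h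
  · have : s = a := le_antisymm (h ▸ h2) h1
    subst this; simp [h]
  set l := b - a with hl
  have hlp : 0 < l := by linarith
  set D := G s - G a
  have hq : 0 ≤ ∫ x in a..s, (l * G' x - D) ^ 2 :=
    intervalIntegral.integral_nonneg h1 fun _ _ => sq_nonneg _
  have he : ∫ x in a..s, (l * G' x - D) ^ 2
      = l ^ 2 * (∫ x in a..s, G' x ^ 2) - 2 * l * D * D + (s - a) * D ^ 2 := by
    have : ∀ x, (l * G' x - D) ^ 2 = (l ^ 2 * G' x ^ 2 - 2 * l * D * G' x) + D ^ 2 := by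
      intro x; ring
    simp only [this]
    rw [intervalIntegral.integral_add, intervalIntegral.integral_sub,
      intervalIntegral.integral_const_mul, intervalIntegral.integral_const_mul, hD,
      intervalIntegral.integral_const, smul_eq_mul]
    all_goals exact Continuous.intervalIntegrable (by fun_prop) _ _
  rw [he] at hq
  have h3 : (s - a) * D ^ 2 ≤ l * D ^ 2 := by gcongr; linarith
  have h4 : l ^ 2 * (∫ x in a..s, G' x ^ 2) ≤ l ^ 2 * ∫ x in a..b, G' x ^ 2 := by gcongr
  have h5 : l * D ^ 2 ≤ l * (l * ∫ x in a..b, G' x ^ 2) := by nlinarith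
  exact le_of_mul_le_mul_left h5 hlp

lemma cross_bound {F Fs Ft G Gs Gt : ℝ × ℝ → ℝ} (hF : C1 F Fs Ft) (hG : C1 G Gs Gt)
    {a b : ℝ} (hab : a ≤ b) (pF : ∀ t, F (b, t) = F (a, t)) {c e : ℝ} (hce : c ≤ e)
    {δ : ℝ} (hδ : 0 < δ) (k : ℝ) :
    -2 * k * boxInt a b c e (fun p => Fs p * G p) ≤
      δ * boxInt a b c e (fun p => Fs p ^ 2) +
      δ⁻¹ * k ^ 2 * (b - a) ^ 2 * boxInt a b c e (fun p => Gs p ^ 2) := by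
  have cf := hF.cf; have cfs := hF.cs; have cft := hF.ct
  have cg := hG.cf; have cgs := hG.cs; have cgt := hG.ct
  have c1 := cont_inner a b (φ := fun p => Fs p * G p) (by fun_prop)
  have c2 := cont_inner a b (φ := fun p => Fs p ^ 2) (by fun_prop)
  have c3 := cont_inner a b (φ := fun p => Gs p ^ 2) (by fun_prop)
  unfold boxInt
  rw [← intervalIntegral.integral_const_mul, ← intervalIntegral.integral_const_mul,
    ← intervalIntegral.integral_const_mul, ← intervalIntegral.integral_add
      (Continuous.intervalIntegrable (by fun_prop) _ _)
      (Continuous.intervalIntegrable (by fun_prop) _ _)]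
  apply intervalIntegral.integral_mono_on hce
    (Continuous.intervalIntegrable (by fun_prop) _ _)
    (Continuous.intervalIntegrable (by fun_prop) _ _)
  intro t _
  have hz : ∫ s in a..b, Fs (s, t) = 0 := by
    rw [intervalIntegral.integral_eq_sub_of_hasDerivAt (fun x _ => hF.ds x t)
      (Continuous.intervalIntegrable (by fun_prop) _ _), pF, sub_self]
  set P := ∫ s in a..b, Gs (s, t) ^ 2 with hP
  have hsub : -2 * k * (∫ s in a..b, Fs (s, t) * G (s, t))
      = ∫ s in a..b, -2 * k * (Fs (s, t) * (G (s, t) - G (a, t))) := by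
    rw [intervalIntegral.integral_const_mul]
    simp only [mul_sub]
    rw [intervalIntegral.integral_sub (Continuous.intervalIntegrable (by fun_prop) _ _)
      (Continuous.intervalIntegrable (by fun_prop) _ _), intervalIntegral.integral_mul_const, hz]
    ring
  have hrhs : δ * (∫ s in a..b, Fs (s, t) ^ 2) + δ⁻¹ * k ^ 2 * (b - a) ^ 2 * P
      = ∫ s in a..b, (δ * Fs (s, t) ^ 2 + δ⁻¹ * k ^ 2 * ((b - a) * P)) := by
    rw [intervalIntegral.integral_add (Continuous.intervalIntegrable (by fun_prop) _ _)
      (Continuous.intervalIntegrable (by fun_prop) _ _), intervalIntegral.integral_const_mul,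
      intervalIntegral.integral_const, smul_eq_mul]
    ring
  rw [hsub, hrhs]
  apply intervalIntegral.integral_mono_on hab
    (Continuous.intervalIntegrable (by fun_prop) _ _)
    (Continuous.intervalIntegrable (by fun_prop) _ _)
  intro s hs
  have h1 := sq_sub_le (G := fun s => G (s, t)) (G' := fun s => Gs (s, t)) (by fun_prop)
    (fun s => hG.ds s t) hs
  have h2 : δ⁻¹ * k ^ 2 * (G (s, t) - G (a, t)) ^ 2 ≤ δ⁻¹ * k ^ 2 * ((b - a) * P) := by
    gcongr
  refine le_trans ?_ (add_le_add_right h2 _)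
  have h3 : 0 ≤ δ⁻¹ * (δ * Fs (s, t) + k * (G (s, t) - G (a, t))) ^ 2 := by positivity
  have h4 : δ⁻¹ * (δ * Fs (s, t) + k * (G (s, t) - G (a, t))) ^ 2 =
      δ * Fs (s, t) ^ 2 + 2 * k * (Fs (s, t) * (G (s, t) - G (a, t)))
       + δ⁻¹ * k ^ 2 * (G (s, t) - G (a, t)) ^ 2 := by
    field_simp; ring
  linarith

/-- one-sided trace estimate. -/
lemma trace_bound {F Fs Ft G Gs Gt : ℝ × ℝ → ℝ} (hF : C1 F Fs Ft) (hG : C1 G Gs Gt)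
    {a b : ℝ} (hab : a ≤ b) (pF : ∀ t, F (b, t) = F (a, t)) (pG : ∀ t, G (b, t) = G (a, t))
    {c e : ℝ} (hce : e - c = 1) {δ : ℝ} (hδ : 0 < δ) (k : ℝ) :
    -2 * k * (∫ s in a..b, Fs (s, e) * G (s, e)) ≤
      boxInt a b c e (fun p => (Fs p - k * Gt p) ^ 2) + boxInt a b c e (fun p => (k * Ft p) ^ 2)
      + boxInt a b c e (fun p => Gs p ^ 2) + δ * boxInt a b c e (fun p => Fs p ^ 2) +
      δ⁻¹ * k ^ 2 * (b - a) ^ 2 * boxInt a b c e (fun p => Gs p ^ 2) := by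
  have cf := hF.cf; have cfs := hF.cs; have cft := hF.ct
  have cg := hG.cf; have cgs := hG.cs; have cgt := hG.ct
  have h1 := cross_bound hF hG hab pF (by linarith : c ≤ e) hδ k
  rw [boxInt_null_weight hF hG pF pG hce, mul_add]
  have h2 : -2 * k * boxInt a b c e (fun p => (p.2 - c) * (Fs p * Gt p - Ft p * Gs p)) ≤
      boxInt a b c e (fun p => (Fs p - k * Gt p) ^ 2) + boxInt a b c e (fun p => (k * Ft p) ^ 2)
      + boxInt a b c e (fun p => Gs p ^ 2) := by
    rw [← boxInt_const_mul, ← boxInt_add _ _ _ _ (by fun_prop) (by fun_prop),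
      ← boxInt_add _ _ _ _ (by fun_prop) (by fun_prop)]
    apply boxInt_mono hab (by linarith) (by fun_prop) (by fun_prop)
    intro s _ t ht
    obtain ⟨h3, h4⟩ := ht
    have hw0 : 0 ≤ t - c := by linarith
    have hw1 : 0 ≤ 1 - (t - c) := by linarith
    simp only
    generalize t - c = w at *
    generalize Fs (s, t) = x
    generalize Gt (s, t) = y
    generalize Ft (s, t) = z
    generalize Gs (s, t) = v
    nlinarith [mul_nonneg hw0 (sq_nonneg x), mul_nonneg hw0 (sq_nonneg (k * y)),
      mul_nonneg hw1 (sq_nonneg (x - k * y)), mul_nonneg hw0 (sq_nonneg (k * z - v)),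
      mul_nonneg hw1 (sq_nonneg (k * z)), mul_nonneg hw1 (sq_nonneg v)]
  linarith

lemma boxInt_half {a b : ℝ} (hab : a ≤ b) {φ : ℝ × ℝ → ℝ} (hφ : Continuous φ)
    (h0 : ∀ p, 0 ≤ φ p) :
    boxInt a b (-(1/2)) (1/2) (fun p => φ (p.1, p.2 / 2 + 1 / 4)) ≤
      2 * boxInt a b (-(1/2)) (1/2) φ := by
  have c1 := cont_inner a b hφ
  unfold boxInt
  have h := intervalIntegral.integral_comp_div_add (a := -(1/2)) (b := 1/2)
    (fun t => ∫ s in a..b, φ (s, t)) (two_ne_zero : (2 : ℝ) ≠ 0) (1/4)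
  simp only at h ⊢
  rw [h, smul_eq_mul]
  norm_num
  rw [← intervalIntegral.integral_add_adjacent_intervals (a := -(1/2)) (b := 0) (c := 1/2)
    (c1.intervalIntegrable _ _) (c1.intervalIntegrable _ _)]
  have : 0 ≤ ∫ t in (-(1/2) : ℝ)..0, ∫ s in a..b, φ (s, t) :=
    intervalIntegral.integral_nonneg (by norm_num) fun t _ =>
      intervalIntegral.integral_nonneg hab fun s _ => h0 _
  linarith

lemma boxInt_comb {a b : ℝ} (hab : a ≤ b) {φ : ℝ × ℝ → ℝ} (hφ : Continuous φ) (α β : ℝ) :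
    boxInt a b (-(1/2)) (1/2) (fun p => (α * φ p + β * φ (p.1, p.2 / 2 + 1 / 4)) ^ 2) ≤
      (2 * α ^ 2 + 4 * β ^ 2) * boxInt a b (-(1/2)) (1/2) (fun p => φ p ^ 2) := by
  have h1 := boxInt_half hab (φ := fun p => φ p ^ 2) (by fun_prop) (fun p => sq_nonneg _)
  have h2 : boxInt a b (-(1/2)) (1/2) (fun p => (α * φ p + β * φ (p.1, p.2 / 2 + 1 / 4)) ^ 2) ≤
      2 * α ^ 2 * boxInt a b (-(1/2)) (1/2) (fun p => φ p ^ 2) + 2 * β ^ 2 *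
        boxInt a b (-(1/2)) (1/2) (fun p => φ (p.1, p.2 / 2 + 1 / 4) ^ 2) := by
    rw [← boxInt_const_mul, ← boxInt_const_mul, ← boxInt_add _ _ _ _ (by fun_prop) (by fun_prop)]
    apply boxInt_mono hab (by norm_num) (by fun_prop) (by fun_prop)
    intro s _ t _
    nlinarith [sq_nonneg (α * φ (s, t) - β * φ (s, t / 2 + 1 / 4))]
  have h3 := mul_le_mul_of_nonneg_left h1 (by positivity : 0 ≤ 2 * β ^ 2)
  linarith

lemma C1.comb {f fs ft : ℝ × ℝ → ℝ} (hf : C1 f fs ft) (α β : ℝ) :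
    C1 (fun p => α * f p + β * f (p.1, p.2 / 2 + 1 / 4))
      (fun p => α * fs p + β * fs (p.1, p.2 / 2 + 1 / 4))
      (fun p => α * ft p + (β / 2) * ft (p.1, p.2 / 2 + 1 / 4)) := by
  have cf := hf.cf; have cfs := hf.cs; have cft := hf.ct
  refine ⟨by fun_prop, by fun_prop, by fun_prop, ?_, ?_⟩
  · intro s t
    exact ((hf.ds s t).const_mul α).add ((hf.ds s (t / 2 + 1 / 4)).const_mul β)
  · intro s t
    have h1 : HasDerivAt (fun x : ℝ => x / 2 + 1 / 4) (1 / 2) t :=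
      ((hasDerivAt_id t).div_const 2).add_const _
    have h2 := HasDerivAt.comp (h₂ := fun x => f (s, x)) t (hf.dt s (t / 2 + 1 / 4)) h1
    have h3 := ((hf.dt s t).const_mul α).add (h2.const_mul β)
    exact h3.congr_deriv (by ring)

lemma C1.refl {f fs ft : ℝ × ℝ → ℝ} (hf : C1 f fs ft) (α : ℝ) :
    C1 (fun p => α * f (p.1, -p.2)) (fun p => α * fs (p.1, -p.2))
      (fun p => -α * ft (p.1, -p.2)) := by
  have cf := hf.cf; have cfs := hf.cs; have cft := hf.ct
  refine ⟨by fun_prop, by fun_prop, by fun_prop, ?_, ?_⟩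
  · intro s t
    exact ((hf.ds s (-t)).const_mul α)
  · intro s t
    have h2 := HasDerivAt.comp (h₂ := fun x => f (s, x)) t (hf.dt s (-t)) (hasDerivAt_neg t)
    have h3 := h2.const_mul α
    exact h3.congr_deriv (by ring)

lemma boxInt_refl (a b : ℝ) (φ : ℝ × ℝ → ℝ) :
    boxInt a b (-(1/2)) (1/2) (fun p => φ (p.1, -p.2)) = boxInt a b (-(1/2)) (1/2) φ := by
  unfold boxInt
  have h := intervalIntegral.integral_comp_neg (a := -(1/2)) (b := 1/2)
    (fun t => ∫ s in a..b, φ (s, t))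
  simp only [neg_neg] at h
  exact h

/-- trace estimate at the top, via a Nitsche-type reflection. -/
lemma top_bound {f fs ft g gs gt : ℝ × ℝ → ℝ} (hf : C1 f fs ft) (hg : C1 g gs gt)
    {a b : ℝ} (hab : a ≤ b) (pf : ∀ t, f (b, t) = f (a, t)) (pg : ∀ t, g (b, t) = g (a, t))
    (k : ℝ) :
    -2 * k * (∫ s in a..b, fs (s, 1/2) * g (s, 1/2)) ≤
      34 * boxInt a b (-(1/2)) (1/2) (fun p => (fs p + k * gt p) ^ 2)
      + 22 * boxInt a b (-(1/2)) (1/2) (fun p => (k * ft p) ^ 2)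
      + 1/4 * boxInt a b (-(1/2)) (1/2) (fun p => fs p ^ 2)
      + (82 + 11152 * k ^ 2 * (b - a) ^ 2) * boxInt a b (-(1/2)) (1/2) (fun p => gs p ^ 2) := by
  have cf := hf.cf; have cfs := hf.cs; have cft := hf.ct
  have cg := hg.cf; have cgs := hg.cs; have cgt := hg.ct
  have h := trace_bound (hf.comb 3 (-2)) (hg.comb (-3) 4) hab (fun t => by simp only [pf])
    (fun t => by simp only [pg]) (by norm_num : (1/2 : ℝ) - (-(1/2)) = 1)
    (by norm_num : (0 : ℝ) < 1/136) k
  have e1 : (∫ s in a..b, (3 * fs (s, 1/2) + -2 * fs (s, (1/2) / 2 + 1/4)) *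
      (-3 * g (s, 1/2) + 4 * g (s, (1/2) / 2 + 1/4))) = ∫ s in a..b, fs (s, 1/2) * g (s, 1/2) := by
    congr 1; ext s
    norm_num
    ring
  have b1 := boxInt_comb hab (φ := fun p => fs p + k * gt p) (by fun_prop) 3 (-2)
  have b2 := boxInt_comb hab (φ := fun p => k * ft p) (by fun_prop) 3 (-1)
  have b3 := boxInt_comb hab (φ := gs) (by fun_prop) (-3) 4
  have b4 := boxInt_comb hab (φ := fs) (by fun_prop) 3 (-2)
  have e2 : boxInt a b (-(1/2)) (1/2) (fun p => (3 * (fs p + k * gt p) + -2 *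
      (fs (p.1, p.2 / 2 + 1 / 4) + k * gt (p.1, p.2 / 2 + 1 / 4))) ^ 2) =
      boxInt a b (-(1/2)) (1/2) (fun p => (3 * fs p + -2 * fs (p.1, p.2 / 2 + 1 / 4) -
        k * (-3 * gt p + 4 / 2 * gt (p.1, p.2 / 2 + 1 / 4))) ^ 2) := by
    congr 1; ext p; ring
  have e3 : boxInt a b (-(1/2)) (1/2) (fun p => (3 * (k * ft p) + -1 *
      (k * ft (p.1, p.2 / 2 + 1 / 4))) ^ 2) =
      boxInt a b (-(1/2)) (1/2) (fun p => (k * (3 * ft p + -2 / 2 * ft (p.1, p.2 / 2 + 1 / 4))) ^ 2)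
      := by
    congr 1; ext p; ring
  simp only at h
  rw [e1, ← e2, ← e3] at h
  have b5 := mul_le_mul_of_nonneg_left b3
    (by positivity : 0 ≤ (1/136 : ℝ)⁻¹ * k ^ 2 * (b - a) ^ 2)
  refine h.trans ?_
  linarith

/-- two-dimensional scaled Korn inequality, off-diagonal part. -/
lemma korn2 {f fs ft g gs gt : ℝ × ℝ → ℝ} (hf : C1 f fs ft) (hg : C1 g gs gt)
    {a b : ℝ} (hab : a ≤ b) (pf : ∀ t, f (b, t) = f (a, t)) (pg : ∀ t, g (b, t) = g (a, t))
    (k : ℝ) (hk : 1 ≤ k) :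
    boxInt a b (-(1/2)) (1/2) (fun p => fs p ^ 2 + (k * gt p) ^ 2) ≤
      (400 + 44608 * (b - a) ^ 2) * k ^ 2 * boxInt a b (-(1/2)) (1/2)
        (fun p => gs p ^ 2 + (k * ft p) ^ 2 + (fs p + k * gt p) ^ 2) := by
  have cf := hf.cf; have cfs := hf.cs; have cft := hf.ct
  have cg := hg.cf; have cgs := hg.cs; have cgt := hg.ct
  have h1 := top_bound hf hg hab pf pg k
  have h2 := top_bound (hf.refl 1) (hg.refl (-1)) hab (fun t => by simp only [pf])
    (fun t => by simp only [pg]) k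
  have r1 := boxInt_refl a b (fun p => (fs p + k * gt p) ^ 2)
  have r2 := boxInt_refl a b (fun p => (k * ft p) ^ 2)
  have r3 := boxInt_refl a b (fun p => fs p ^ 2)
  have r4 := boxInt_refl a b (fun p => gs p ^ 2)
  simp only [one_mul, neg_mul, neg_neg, mul_neg, neg_sq, intervalIntegral.integral_neg] at h2
  rw [r1, r2, r3, r4] at h2
  have h3 := boxInt_null hf hg pf pg (-(1/2)) (1/2)
  have e1 : boxInt a b (-(1/2)) (1/2) (fun p => fs p ^ 2 + (k * gt p) ^ 2) =
      boxInt a b (-(1/2)) (1/2) (fun p => (fs p + k * gt p) ^ 2)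
      - 2 * k * boxInt a b (-(1/2)) (1/2) (fun p => fs p * gt p - ft p * gs p)
      - boxInt a b (-(1/2)) (1/2) (fun p => 2 * (k * ft p * gs p)) := by
    rw [← boxInt_const_mul, ← boxInt_sub _ _ _ _ (by fun_prop) (by fun_prop),
      ← boxInt_sub _ _ _ _ (by fun_prop) (by fun_prop)]
    congr 1; ext p; ring
  have e2 : - boxInt a b (-(1/2)) (1/2) (fun p => 2 * (k * ft p * gs p)) ≤
      boxInt a b (-(1/2)) (1/2) (fun p => (k * ft p) ^ 2) +
      boxInt a b (-(1/2)) (1/2) (fun p => gs p ^ 2) := by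
    rw [← neg_one_mul, ← boxInt_const_mul, ← boxInt_add _ _ _ _ (by fun_prop) (by fun_prop)]
    apply boxInt_mono hab (by norm_num) (by fun_prop) (by fun_prop)
    intro s _ t _
    nlinarith [sq_nonneg (k * ft (s, t) + gs (s, t))]
  have e3 : boxInt a b (-(1/2)) (1/2) (fun p => fs p ^ 2) ≤
      boxInt a b (-(1/2)) (1/2) (fun p => fs p ^ 2 + (k * gt p) ^ 2) := by
    apply boxInt_mono hab (by norm_num) (by fun_prop) (by fun_prop)
    intro s _ t _
    nlinarith [sq_nonneg (k * gt (s, t))]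
  have e4 := boxInt_add a b (-(1/2)) (1/2) (φ := fun p => gs p ^ 2 + (k * ft p) ^ 2)
    (ψ := fun p => (fs p + k * gt p) ^ 2) (by fun_prop) (by fun_prop)
  have e5 := boxInt_add a b (-(1/2)) (1/2) (φ := fun p => gs p ^ 2)
    (ψ := fun p => (k * ft p) ^ 2) (by fun_prop) (by fun_prop)
  rw [e5] at e4
  rw [e4]
  have hR := boxInt_nonneg hab (by norm_num : (-(1/2) : ℝ) ≤ 1/2)
    (φ := fun p => (fs p + k * gt p) ^ 2) (fun _ => sq_nonneg _)
  have hQ := boxInt_nonneg hab (by norm_num : (-(1/2) : ℝ) ≤ 1/2)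
    (φ := fun p => (k * ft p) ^ 2) (fun _ => sq_nonneg _)
  have hP := boxInt_nonneg hab (by norm_num : (-(1/2) : ℝ) ≤ 1/2)
    (φ := fun p => (gs p) ^ 2) (fun _ => sq_nonneg _)
  rw [h3] at e1
  generalize boxInt a b (-(1/2)) (1/2) (fun p => (fs p + k * gt p) ^ 2) = R at *
  generalize boxInt a b (-(1/2)) (1/2) (fun p => (k * ft p) ^ 2) = Q at *
  generalize boxInt a b (-(1/2)) (1/2) (fun p => gs p ^ 2) = P at *
  generalize boxInt a b (-(1/2)) (1/2) (fun p => fs p ^ 2) = A at *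
  generalize boxInt a b (-(1/2)) (1/2) (fun p => fs p ^ 2 + (k * gt p) ^ 2) = X at *
  have hk2 : 1 ≤ k ^ 2 := one_le_pow₀ hk
  have m1 : X ≤ 138 * R + 90 * Q + 330 * P + 44608 * k ^ 2 * (b - a) ^ 2 * P := by linarith
  have q1 : R ≤ k ^ 2 * R := le_mul_of_one_le_left hR hk2
  have q2 : Q ≤ k ^ 2 * Q := le_mul_of_one_le_left hQ hk2
  have q3 : P ≤ k ^ 2 * P := le_mul_of_one_le_left hP hk2
  have q4 : 0 ≤ k ^ 2 * (b - a) ^ 2 * R := by positivity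
  have q5 : 0 ≤ k ^ 2 * (b - a) ^ 2 * Q := by positivity
  nlinarith

/-- tangential (doubly periodic) Korn identity. -/
lemma korn_per {f fs ft g gs gt : ℝ × ℝ → ℝ} (hf : C1 f fs ft) (hg : C1 g gs gt)
    {a b : ℝ} (hab : a ≤ b) (pf : ∀ t, f (b, t) = f (a, t)) (pg : ∀ t, g (b, t) = g (a, t))
    (pf' : ∀ s, f (s, b) = f (s, a)) (pg' : ∀ s, g (s, b) = g (s, a)) :
    boxInt a b a b (fun p => fs p ^ 2 + gt p ^ 2) ≤
      boxInt a b a b (fun p => gs p ^ 2 + ft p ^ 2 + (fs p + gt p) ^ 2) := by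
  have cf := hf.cf; have cfs := hf.cs; have cft := hf.ct
  have cg := hg.cf; have cgs := hg.cs; have cgt := hg.ct
  have h3 := boxInt_null hf hg pf pg a b
  have pfs : ∀ s, fs (s, b) = fs (s, a) := by
    intro s
    have h1 := hf.ds s b
    simp only [pf'] at h1
    exact h1.unique (hf.ds s a)
  simp only [pfs, pg', sub_self] at h3
  have e1 : boxInt a b a b (fun p => fs p ^ 2 + gt p ^ 2) =
      boxInt a b a b (fun p => (fs p + gt p) ^ 2 - 2 * (ft p * gs p))
      - 2 * boxInt a b a b (fun p => fs p * gt p - ft p * gs p) := by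
    rw [← boxInt_const_mul, ← boxInt_sub _ _ _ _ (by fun_prop) (by fun_prop)]
    congr 1; ext p; ring
  rw [e1, h3, mul_zero, sub_zero]
  apply boxInt_mono hab hab (by fun_prop) (by fun_prop)
  intro s _ t _
  nlinarith [sq_nonneg (ft (s, t) + gs (s, t))]

lemma boxInt_swap (a b c e : ℝ) {φ : ℝ × ℝ → ℝ} (hφ : Continuous φ) :
    boxInt a b c e φ = boxInt c e a b (fun p => φ (p.2, p.1)) := by
  unfold boxInt
  apply MeasureTheory.intervalIntegral_intervalIntegral_swap
  refine IntegrableOn.mono_set (t := uIcc c e ×ˢ uIcc a b) ?_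
    (prod_mono uIoc_subset_uIcc uIoc_subset_uIcc)
  apply ContinuousOn.integrableOn_compact (isCompact_uIcc.prod isCompact_uIcc)
  apply Continuous.continuousOn
  simp only [Function.uncurry_def]
  fun_prop

lemma setInt_two {a b c e : ℝ} (hab : a ≤ b) (hce : c ≤ e) {φ : (Fin 2 → ℝ) → ℝ}
    (hφ : Continuous φ) :
    ∫ x in {x : Fin 2 → ℝ | x 0 ∈ Ioo a b ∧ x 1 ∈ Ioo c e}, φ x =
      boxInt a b c e (fun p => φ ![p.1, p.2]) := by
  have hc : Continuous (fun p : ℝ × ℝ => φ ![p.1, p.2]) := by fun_prop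
  have h := (volume_preserving_finTwoArrow ℝ).setIntegral_preimage_emb
    (MeasurableEquiv.finTwoArrow (α := ℝ)).measurableEmbedding
    (fun p : ℝ × ℝ => φ ![p.1, p.2]) (Ioo a b ×ˢ Ioo c e)
  have e1 : (MeasurableEquiv.finTwoArrow (α := ℝ)) ⁻¹' (Ioo a b ×ˢ Ioo c e) =
      {x : Fin 2 → ℝ | x 0 ∈ Ioo a b ∧ x 1 ∈ Ioo c e} := by
    ext x; simp [MeasurableEquiv.finTwoArrow]
  have e2 : ∀ x : Fin 2 → ℝ, ![(MeasurableEquiv.finTwoArrow x).1,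
      (MeasurableEquiv.finTwoArrow x).2] = x := by
    intro x; ext i; fin_cases i <;> simp [MeasurableEquiv.finTwoArrow]
  rw [e1] at h
  simp only [e2] at h
  rw [h, boxInt_swap _ _ _ _ hc, Measure.volume_eq_prod, setIntegral_prod]
  · simp only [boxInt]
    rw [intervalIntegral.integral_of_le hab, integral_Ioc_eq_integral_Ioo]
    congr 1; ext s
    rw [intervalIntegral.integral_of_le hce, integral_Ioc_eq_integral_Ioo]
  · exact (hc.continuousOn.integrableOn_compact
      (isCompact_Icc.prod isCompact_Icc)).mono_set
      (prod_mono Ioo_subset_Icc_self Ioo_subset_Icc_self)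

lemma Omega_two (L : ℝ) :
    Omega 2 L = {x : Fin 2 → ℝ | x 0 ∈ Ioo (-L) L ∧ x 1 ∈ Ioo (-(1/2) : ℝ) (1/2)} := by
  ext x; simp [Omega, Fin.forall_fin_two]

lemma setInt_three {L : ℝ} (hL : 0 < L) {φ : (Fin 3 → ℝ) → ℝ} (hφ : Continuous φ) :
    ∫ x in Omega 3 L, φ x = ∫ t in (-(1/2) : ℝ)..(1/2),
      boxInt (-L) L (-L) L (fun p => φ ![p.1, p.2, t]) := by
  have hc : Continuous (fun p : ℝ × (Fin 2 → ℝ) => φ ![p.2 0, p.2 1, p.1]) := by fun_prop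
  have h := (volume_preserving_piFinSuccAbove (fun _ : Fin 3 => ℝ) 2).setIntegral_preimage_emb
    (MeasurableEquiv.piFinSuccAbove (fun _ : Fin 3 => ℝ) 2).measurableEmbedding
    (fun p : ℝ × (Fin 2 → ℝ) => φ ![p.2 0, p.2 1, p.1])
    (Ioo (-(1/2)) (1/2) ×ˢ {x : Fin 2 → ℝ | x 0 ∈ Ioo (-L) L ∧ x 1 ∈ Ioo (-L) L})
  have e1 : (MeasurableEquiv.piFinSuccAbove (fun _ : Fin 3 => ℝ) 2) ⁻¹'
      (Ioo (-(1/2)) (1/2) ×ˢ {x : Fin 2 → ℝ | x 0 ∈ Ioo (-L) L ∧ x 1 ∈ Ioo (-L) L}) =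
      Omega 3 L := by
    ext x
    simp [MeasurableEquiv.piFinSuccAbove, Omega, Fin.forall_fin_succ]
    tauto
  have e2 : ∀ x : Fin 3 → ℝ, ![(MeasurableEquiv.piFinSuccAbove (fun _ : Fin 3 => ℝ) 2 x).2 0,
      (MeasurableEquiv.piFinSuccAbove (fun _ : Fin 3 => ℝ) 2 x).2 1,
      (MeasurableEquiv.piFinSuccAbove (fun _ : Fin 3 => ℝ) 2 x).1] = x := by
    intro x; ext i
    fin_cases i <;> rfl
  rw [e1] at h
  simp only [e2] at h
  rw [h, Measure.volume_eq_prod, setIntegral_prod]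
  · rw [intervalIntegral.integral_of_le (by norm_num), integral_Ioc_eq_integral_Ioo]
    congr 1; ext t
    rw [setInt_two (φ := fun x => φ ![x 0, x 1, t]) (by linarith) (by linarith) (by fun_prop)]
    simp
  · refine (hc.continuousOn.integrableOn_compact
      (isCompact_Icc.prod (isCompact_Icc (a := fun _ : Fin 2 => -L) (b := fun _ => L)))).mono_set
      (prod_mono Ioo_subset_Icc_self ?_)
    intro x hx
    simp only [mem_ofPred_eq, mem_Ioo] at hx
    simp only [mem_Icc, Pi.le_def, Fin.forall_fin_two]
    exact ⟨⟨hx.1.1.le, hx.2.1.le⟩, ⟨hx.1.2.le, hx.2.2.le⟩⟩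

lemma cont_box (a b c e : ℝ) {φ : ℝ → ℝ × ℝ → ℝ} (hφ : Continuous (fun q : ℝ × (ℝ × ℝ) => φ q.1 q.2)) :
    Continuous (fun y => boxInt a b c e (φ y)) := by
  unfold boxInt
  apply intervalIntegral.continuous_parametric_intervalIntegral_of_continuous'
  simp only [Function.uncurry_def]
  apply intervalIntegral.continuous_parametric_intervalIntegral_of_continuous'
  simp only [Function.uncurry_def]
  exact hφ.comp (by fun_prop : Continuous fun p : (ℝ × ℝ) × ℝ => (p.1.1, (p.2, p.1.2)))

lemma setInt_three_y {L : ℝ} (hL : 0 < L) {φ : (Fin 3 → ℝ) → ℝ} (hφ : Continuous φ) :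
    ∫ x in Omega 3 L, φ x = ∫ y in (-L)..L,
      boxInt (-L) L (-(1/2)) (1/2) (fun p => φ ![p.1, y, p.2]) := by
  rw [setInt_three hL hφ]
  have hc : Continuous (fun q : ℝ × ℝ => ∫ s in (-L)..L, φ ![s, q.1, q.2]) := by
    apply intervalIntegral.continuous_parametric_intervalIntegral_of_continuous'
    simp only [Function.uncurry_def]
    fun_prop
  exact boxInt_swap _ _ _ _ hc

lemma setInt_three_x {L : ℝ} (hL : 0 < L) {φ : (Fin 3 → ℝ) → ℝ} (hφ : Continuous φ) :
    ∫ x in Omega 3 L, φ x = ∫ x in (-L)..L,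
      boxInt (-L) L (-(1/2)) (1/2) (fun p => φ ![x, p.1, p.2]) := by
  rw [setInt_three hL hφ]
  have e : ∀ t, boxInt (-L) L (-L) L (fun p => φ ![p.1, p.2, t]) =
      boxInt (-L) L (-L) L (fun p => φ ![p.2, p.1, t]) := fun t =>
    boxInt_swap _ _ _ _ (φ := fun p => φ ![p.1, p.2, t]) (by fun_prop)
  simp only [e]
  have hc : Continuous (fun q : ℝ × ℝ => ∫ s in (-L)..L, φ ![q.1, s, q.2]) := by
    apply intervalIntegral.continuous_parametric_intervalIntegral_of_continuous'
    simp only [Function.uncurry_def]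
    fun_prop
  exact boxInt_swap _ _ _ _ hc

lemma Omega_meas (d : ℕ) (L : ℝ) : MeasurableSet (Omega d L) := by
  have : Omega d L = Set.pi univ (fun i : Fin d =>
      if (i : ℕ) < d - 1 then Ioo (-L) L else Ioo (-(1/2) : ℝ) (1/2)) := by
    ext x
    simp only [Omega, mem_ofPred_eq, Set.mem_pi, mem_univ, true_implies]
    refine forall_congr' fun i => ?_
    split_ifs <;> rfl
  rw [this]
  refine MeasurableSet.univ_pi fun i => ?_
  split_ifs <;> exact measurableSet_Ioo

lemma Omega_int (d : ℕ) (L : ℝ) {φ : (Fin d → ℝ) → ℝ} (hφ : Continuous φ) :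
    IntegrableOn φ (Omega d L) := by
  refine (hφ.continuousOn.integrableOn_compact (isCompact_Icc
    (a := fun _ : Fin d => -(|L| + 1)) (b := fun _ => |L| + 1))).mono_set ?_
  intro x hx
  have h1 := le_abs_self L
  have h2 := abs_nonneg L
  rw [mem_Icc, Pi.le_def, Pi.le_def, ← forall_and]
  intro i
  have := hx i
  split_ifs at this <;> obtain ⟨h3, h4⟩ := this <;> constructor <;> linarith

/-- slices of a `C¹` function. -/
lemma C1_slice {d : ℕ} {v : (Fin d → ℝ) → ℝ} (hv : ContDiff ℝ 1 v) {γ : ℝ × ℝ → Fin d → ℝ}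
    (hγ : Continuous γ) (i j : Fin d)
    (h1 : ∀ s t, HasDerivAt (fun x => γ (x, t)) (Pi.single i 1) s)
    (h2 : ∀ s t, HasDerivAt (fun x => γ (s, x)) (Pi.single j 1) t) :
    C1 (fun p => v (γ p)) (fun p => pd d i v (γ p)) (fun p => pd d j v (γ p)) := by
  have hc : Continuous (fderiv ℝ v) := hv.continuous_fderiv one_ne_zero
  have hd : Differentiable ℝ v := hv.differentiable one_ne_zero
  refine ⟨hv.continuous.comp hγ, ?_, ?_, ?_, ?_⟩
  · unfold pd; fun_prop
  · unfold pd; fun_prop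
  · intro s t
    exact (hd (γ (s, t))).hasFDerivAt.comp_hasDerivAt (f := fun x => γ (x, t)) s (h1 s t)
  · intro s t
    exact (hd (γ (s, t))).hasFDerivAt.comp_hasDerivAt (f := fun x => γ (s, x)) t (h2 s t)

lemma pd_cont {d : ℕ} {v : (Fin d → ℝ) → ℝ} (hv : ContDiff ℝ 1 v) (j : Fin d) :
    Continuous (pd d j v) := by
  have hc : Continuous (fderiv ℝ v) := hv.continuous_fderiv one_ne_zero
  unfold pd; fun_prop

lemma korn_two {L : ℝ} (hL : 0 < L) {k : ℝ} (hk : 1 ≤ k) {v w : (Fin 2 → ℝ) → ℝ}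
    (hv : ContDiff ℝ 1 v) (hw : ContDiff ℝ 1 w)
    (pv : TangPeriodic 2 L v) (pw : TangPeriodic 2 L w) :
    ∫ x in Omega 2 L, ((pd 2 0 w x) ^ 2 + (k * pd 2 1 v x) ^ 2) ≤
      (400 + 44608 * (L - -L) ^ 2) * k ^ 2 * ∫ x in Omega 2 L,
        ((pd 2 0 v x) ^ 2 + (k * pd 2 1 w x) ^ 2 + (pd 2 0 w x + k * pd 2 1 v x) ^ 2) := by
  have c1 := pd_cont hv 0; have c2 := pd_cont hv 1
  have c3 := pd_cont hw 0; have c4 := pd_cont hw 1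
  rw [Omega_two, setInt_two (by linarith) (by norm_num) (by fun_prop),
    setInt_two (by linarith) (by norm_num) (by fun_prop)]
  have hγ : Continuous (fun p : ℝ × ℝ => ![p.1, p.2]) := by fun_prop
  have d1 : ∀ s t : ℝ, HasDerivAt (fun x : ℝ => ![x, t]) (Pi.single (0 : Fin 2) (1 : ℝ)) s := by
    intro s t
    rw [hasDerivAt_pi]
    simp [Fin.forall_fin_succ, hasDerivAt_id', hasDerivAt_const]
  have d2 : ∀ s t : ℝ, HasDerivAt (fun x : ℝ => ![s, x]) (Pi.single (1 : Fin 2) (1 : ℝ)) t := by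
    intro s t
    rw [hasDerivAt_pi]
    simp [Fin.forall_fin_succ, hasDerivAt_id', hasDerivAt_const]
  have per : ∀ {v : (Fin 2 → ℝ) → ℝ}, TangPeriodic 2 L v → ∀ t, v ![L, t] = v ![-L, t] := by
    intro v hp t
    rw [← hp ![-L, t] 0 (by simp)]
    congr 1; ext i; fin_cases i
    · simp; ring
    · simp
  exact korn2 (C1_slice hw hγ 0 1 d1 d2) (C1_slice hv hγ 0 1 d1 d2) (by linarith)
    (per pw) (per pv) k hk

lemma three_deriv0 (s y t : ℝ) :
    HasDerivAt (fun x : ℝ => ![x, y, t]) (Pi.single (0 : Fin 3) (1 : ℝ)) s := by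
  rw [hasDerivAt_pi]
  intro i; fin_cases i <;> simp [hasDerivAt_id', hasDerivAt_const]

lemma three_deriv1 (x s t : ℝ) :
    HasDerivAt (fun y : ℝ => ![x, y, t]) (Pi.single (1 : Fin 3) (1 : ℝ)) s := by
  rw [hasDerivAt_pi]
  intro i; fin_cases i <;> simp [hasDerivAt_id', hasDerivAt_const]

lemma three_deriv2 (x y s : ℝ) :
    HasDerivAt (fun t : ℝ => ![x, y, t]) (Pi.single (2 : Fin 3) (1 : ℝ)) s := by
  rw [hasDerivAt_pi]
  intro i; fin_cases i <;> simp [hasDerivAt_id', hasDerivAt_const]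

lemma three_per0 {L : ℝ} {v : (Fin 3 → ℝ) → ℝ} (hp : TangPeriodic 3 L v) (y t : ℝ) :
    v ![L, y, t] = v ![-L, y, t] := by
  rw [← hp ![-L, y, t] 0 (by simp)]
  congr 1; ext i; fin_cases i
  · simp; ring
  · simp
  · simp

lemma three_per1 {L : ℝ} {v : (Fin 3 → ℝ) → ℝ} (hp : TangPeriodic 3 L v) (x t : ℝ) :
    v ![x, L, t] = v ![x, -L, t] := by
  rw [← hp ![x, -L, t] 1 (by simp)]
  congr 1; ext i; fin_cases i
  · simp
  · simp; ring
  · simp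

lemma korn_three_0 {L : ℝ} (hL : 0 < L) {k : ℝ} (hk : 1 ≤ k) {v w : (Fin 3 → ℝ) → ℝ}
    (hv : ContDiff ℝ 1 v) (hw : ContDiff ℝ 1 w)
    (pv : TangPeriodic 3 L v) (pw : TangPeriodic 3 L w) :
    ∫ x in Omega 3 L, ((pd 3 0 w x) ^ 2 + (k * pd 3 2 v x) ^ 2) ≤
      (400 + 44608 * (L - -L) ^ 2) * k ^ 2 * ∫ x in Omega 3 L,
        ((pd 3 0 v x) ^ 2 + (k * pd 3 2 w x) ^ 2 + (pd 3 0 w x + k * pd 3 2 v x) ^ 2) := by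
  have c1 := pd_cont hv 0; have c2 := pd_cont hv 2
  have c3 := pd_cont hw 0; have c4 := pd_cont hw 2
  rw [setInt_three_y hL (by fun_prop), setInt_three_y hL (by fun_prop),
    ← intervalIntegral.integral_const_mul]
  apply intervalIntegral.integral_mono_on (by linarith)
  · exact (cont_box _ _ _ _ (by fun_prop)).intervalIntegrable _ _
  · exact ((cont_box _ _ _ _ (by fun_prop)).const_mul _).intervalIntegrable _ _
  intro y _
  have hγ : Continuous (fun p : ℝ × ℝ => ![p.1, y, p.2]) := by fun_prop
  exact korn2 (C1_slice hw hγ 0 2 (fun s t => three_deriv0 s y t) (fun s t => three_deriv2 s y t))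
    (C1_slice hv hγ 0 2 (fun s t => three_deriv0 s y t) (fun s t => three_deriv2 s y t))
    (by linarith) (fun t => three_per0 pw y t) (fun t => three_per0 pv y t) k hk

lemma korn_three_1 {L : ℝ} (hL : 0 < L) {k : ℝ} (hk : 1 ≤ k) {v w : (Fin 3 → ℝ) → ℝ}
    (hv : ContDiff ℝ 1 v) (hw : ContDiff ℝ 1 w)
    (pv : TangPeriodic 3 L v) (pw : TangPeriodic 3 L w) :
    ∫ x in Omega 3 L, ((pd 3 1 w x) ^ 2 + (k * pd 3 2 v x) ^ 2) ≤
      (400 + 44608 * (L - -L) ^ 2) * k ^ 2 * ∫ x in Omega 3 L,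
        ((pd 3 1 v x) ^ 2 + (k * pd 3 2 w x) ^ 2 + (pd 3 1 w x + k * pd 3 2 v x) ^ 2) := by
  have c1 := pd_cont hv 1; have c2 := pd_cont hv 2
  have c3 := pd_cont hw 1; have c4 := pd_cont hw 2
  rw [setInt_three_x hL (by fun_prop), setInt_three_x hL (by fun_prop),
    ← intervalIntegral.integral_const_mul]
  apply intervalIntegral.integral_mono_on (by linarith)
  · exact (cont_box _ _ _ _ (by fun_prop)).intervalIntegrable _ _
  · exact ((cont_box _ _ _ _ (by fun_prop)).const_mul _).intervalIntegrable _ _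
  intro y _
  have hγ : Continuous (fun p : ℝ × ℝ => ![y, p.1, p.2]) := by fun_prop
  exact korn2 (C1_slice hw hγ 1 2 (fun s t => three_deriv1 y s t) (fun s t => three_deriv2 y s t))
    (C1_slice hv hγ 1 2 (fun s t => three_deriv1 y s t) (fun s t => three_deriv2 y s t))
    (by linarith) (fun t => three_per1 pw y t) (fun t => three_per1 pv y t) k hk

lemma korn_three_tan {L : ℝ} (hL : 0 < L) {v w : (Fin 3 → ℝ) → ℝ}
    (hv : ContDiff ℝ 1 v) (hw : ContDiff ℝ 1 w)
    (pv : TangPeriodic 3 L v) (pw : TangPeriodic 3 L w) :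
    ∫ x in Omega 3 L, ((pd 3 0 w x) ^ 2 + (pd 3 1 v x) ^ 2) ≤ ∫ x in Omega 3 L,
        ((pd 3 0 v x) ^ 2 + (pd 3 1 w x) ^ 2 + (pd 3 0 w x + pd 3 1 v x) ^ 2) := by
  have c1 := pd_cont hv 0; have c2 := pd_cont hv 1
  have c3 := pd_cont hw 0; have c4 := pd_cont hw 1
  rw [setInt_three hL (by fun_prop), setInt_three hL (by fun_prop)]
  apply intervalIntegral.integral_mono_on (by norm_num)
  · exact (cont_box _ _ _ _ (by fun_prop)).intervalIntegrable _ _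
  · exact (cont_box _ _ _ _ (by fun_prop)).intervalIntegrable _ _
  intro y _
  have hγ : Continuous (fun p : ℝ × ℝ => ![p.1, p.2, y]) := by fun_prop
  exact korn_per
    (C1_slice hw hγ 0 1 (fun s t => three_deriv0 s t y) (fun s t => three_deriv1 s t y))
    (C1_slice hv hγ 0 1 (fun s t => three_deriv0 s t y) (fun s t => three_deriv1 s t y))
    (by linarith) (fun t => three_per0 pw t y) (fun t => three_per0 pv t y)
    (fun t => three_per1 pw t y) (fun t => three_per1 pv t y)

lemma final_two {L : ℝ} (hL : 0 < L) {h : ℝ} (h0 : 0 < h) (h1 : h ≤ 1)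
    {u : (Fin 2 → ℝ) → Fin 2 → ℝ} (hu : ContDiff ℝ 1 u)
    (pu : ∀ i : Fin 2, TangPeriodic 2 L (fun x => u x i)) :
    (∫ x in Omega 2 L, ∑ i, ∑ j, (gradh 2 h u x i j) ^ 2)
      ≤ (2 * ((400 + 44608 * (L - -L) ^ 2) + 1)) *
        ∫ x in Omega 2 L, ∑ i, ∑ j, (h⁻¹ * epsh 2 h u x i j) ^ 2 := by
  have hk : 1 ≤ h⁻¹ := (one_le_inv₀ h0).2 h1
  have hv : ∀ i, ContDiff ℝ 1 (fun x => u x i) := fun i => contDiff_pi.1 hu i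
  set k := h⁻¹ with hkdef
  have A := korn_two hL hk (hv 0) (hv 1) (pu 0) (pu 1)
  set K : ℝ := 400 + 44608 * (L - -L) ^ 2 with hK
  have hK0 : 0 ≤ K := by positivity
  have hk2 : 1 ≤ k ^ 2 := one_le_pow₀ hk
  have c00 := pd_cont (hv 0) 0; have c01 := pd_cont (hv 0) 1
  have c10 := pd_cont (hv 1) 0; have c11 := pd_cont (hv 1) 1
  set D00 := pd 2 0 (fun y => u y 0) with d00
  set D01 := pd 2 1 (fun y => u y 0) with d01
  set D10 := pd 2 0 (fun y => u y 1) with d10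
  set D11 := pd 2 1 (fun y => u y 1) with d11
  have gl : ∀ x, ∑ i, ∑ j, (gradh 2 h u x i j) ^ 2 =
      (D10 x ^ 2 + (k * D01 x) ^ 2) + (D00 x ^ 2 + (k * D11 x) ^ 2) := by
    intro x
    simp [Fin.sum_univ_two, gradh, ← hkdef, ← d00, ← d01, ← d10, ← d11]
    ring
  have gr : ∀ x, ∑ i, ∑ j, (k * epsh 2 h u x i j) ^ 2 =
      k ^ 2 * (D00 x ^ 2 + (k * D11 x) ^ 2 + (D10 x + k * D01 x) ^ 2 / 2) := by
    intro x
    simp [Fin.sum_univ_two, epsh, gradh, ← hkdef, ← d00, ← d01, ← d10, ← d11]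
    ring
  simp only [gl, gr]
  rw [integral_add (Omega_int _ _ (by fun_prop)) (Omega_int _ _ (by fun_prop))]
  have B : ∫ x in Omega 2 L, (D00 x ^ 2 + (k * D11 x) ^ 2) ≤ ∫ x in Omega 2 L,
      (D00 x ^ 2 + (k * D11 x) ^ 2 + (D10 x + k * D01 x) ^ 2) := by
    apply setIntegral_mono (Omega_int _ _ (by fun_prop)) (Omega_int _ _ (by fun_prop))
    intro x
    nlinarith [sq_nonneg (D10 x + k * D01 x)]
  have E : k ^ 2 * ∫ x in Omega 2 L,
      (D00 x ^ 2 + (k * D11 x) ^ 2 + (D10 x + k * D01 x) ^ 2) ≤ 2 * ∫ x in Omega 2 L,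
      k ^ 2 * (D00 x ^ 2 + (k * D11 x) ^ 2 + (D10 x + k * D01 x) ^ 2 / 2) := by
    rw [← integral_const_mul, ← integral_const_mul]
    apply setIntegral_mono (Omega_int _ _ (by fun_prop)) (Omega_int _ _ (by fun_prop))
    intro x
    nlinarith [sq_nonneg (k * D00 x), sq_nonneg (k * (k * D11 x))]
  have S0 : 0 ≤ ∫ x in Omega 2 L,
      (D00 x ^ 2 + (k * D11 x) ^ 2 + (D10 x + k * D01 x) ^ 2) :=
    integral_nonneg fun x => by positivity
  generalize (∫ x in Omega 2 L,
      (D00 x ^ 2 + (k * D11 x) ^ 2 + (D10 x + k * D01 x) ^ 2)) = S at *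
  have q1 : S ≤ k ^ 2 * S := le_mul_of_one_le_left S0 hk2
  have q2 := mul_le_mul_of_nonneg_left E (by linarith : 0 ≤ K + 1)
  linarith

lemma final_three {L : ℝ} (hL : 0 < L) {h : ℝ} (h0 : 0 < h) (h1 : h ≤ 1)
    {u : (Fin 3 → ℝ) → Fin 3 → ℝ} (hu : ContDiff ℝ 1 u)
    (pu : ∀ i : Fin 3, TangPeriodic 3 L (fun x => u x i)) :
    (∫ x in Omega 3 L, ∑ i, ∑ j, (gradh 3 h u x i j) ^ 2)
      ≤ (2 * (2 * (400 + 44608 * (L - -L) ^ 2) + 2)) *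
        ∫ x in Omega 3 L, ∑ i, ∑ j, (h⁻¹ * epsh 3 h u x i j) ^ 2 := by
  have hk : 1 ≤ h⁻¹ := (one_le_inv₀ h0).2 h1
  have hv : ∀ i, ContDiff ℝ 1 (fun x => u x i) := fun i => contDiff_pi.1 hu i
  set k := h⁻¹ with hkdef
  have A0 := korn_three_0 hL hk (hv 0) (hv 2) (pu 0) (pu 2)
  have A1 := korn_three_1 hL hk (hv 1) (hv 2) (pu 1) (pu 2)
  have A2 := korn_three_tan hL (hv 0) (hv 1) (pu 0) (pu 1)
  set K : ℝ := 400 + 44608 * (L - -L) ^ 2 with hK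
  have hK0 : 0 ≤ K := by positivity
  have hk2 : 1 ≤ k ^ 2 := one_le_pow₀ hk
  have c00 := pd_cont (hv 0) 0; have c01 := pd_cont (hv 0) 1; have c02 := pd_cont (hv 0) 2
  have c10 := pd_cont (hv 1) 0; have c11 := pd_cont (hv 1) 1; have c12 := pd_cont (hv 1) 2
  have c20 := pd_cont (hv 2) 0; have c21 := pd_cont (hv 2) 1; have c22 := pd_cont (hv 2) 2
  set D00 := pd 3 0 (fun y => u y 0) with d00
  set D01 := pd 3 1 (fun y => u y 0) with d01
  set D02 := pd 3 2 (fun y => u y 0) with d02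
  set D10 := pd 3 0 (fun y => u y 1) with d10
  set D11 := pd 3 1 (fun y => u y 1) with d11
  set D12 := pd 3 2 (fun y => u y 1) with d12
  set D20 := pd 3 0 (fun y => u y 2) with d20
  set D21 := pd 3 1 (fun y => u y 2) with d21
  set D22 := pd 3 2 (fun y => u y 2) with d22
  have gl : ∀ x, ∑ i, ∑ j, (gradh 3 h u x i j) ^ 2 =
      (((D20 x ^ 2 + (k * D02 x) ^ 2) + (D21 x ^ 2 + (k * D12 x) ^ 2))
        + (D10 x ^ 2 + D01 x ^ 2)) + (D00 x ^ 2 + D11 x ^ 2 + (k * D22 x) ^ 2) := by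
    intro x
    simp [Fin.sum_univ_three, gradh, ← hkdef, ← d00, ← d01, ← d02, ← d10, ← d11, ← d12,
      ← d20, ← d21, ← d22]
    ring
  have gr : ∀ x, ∑ i, ∑ j, (k * epsh 3 h u x i j) ^ 2 =
      k ^ 2 * (D00 x ^ 2 + D11 x ^ 2 + (k * D22 x) ^ 2 + ((D10 x + D01 x) ^ 2 +
        (D20 x + k * D02 x) ^ 2 + (D21 x + k * D12 x) ^ 2) / 2) := by
    intro x
    simp [Fin.sum_univ_three, epsh, gradh, ← hkdef, ← d00, ← d01, ← d02, ← d10, ← d11, ← d12,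
      ← d20, ← d21, ← d22]
    ring
  simp only [gl, gr]
  rw [integral_add (Omega_int _ _ (by fun_prop)) (Omega_int _ _ (by fun_prop)),
    integral_add (Omega_int _ _ (by fun_prop)) (Omega_int _ _ (by fun_prop)),
    integral_add (Omega_int _ _ (by fun_prop)) (Omega_int _ _ (by fun_prop))]
  set ψ : (Fin 3 → ℝ) → ℝ := fun x => D00 x ^ 2 + D11 x ^ 2 + (k * D22 x) ^ 2 +
    ((D10 x + D01 x) ^ 2 + (D20 x + k * D02 x) ^ 2 + (D21 x + k * D12 x) ^ 2) with hψ
  have cψ : Continuous ψ := by rw [hψ]; fun_prop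
  have B0 : ∫ x in Omega 3 L, (D00 x ^ 2 + (k * D22 x) ^ 2 + (D20 x + k * D02 x) ^ 2) ≤
      ∫ x in Omega 3 L, ψ x := by
    apply setIntegral_mono (Omega_int _ _ (by fun_prop)) (Omega_int _ _ (by fun_prop))
    intro x
    simp only [hψ]
    linarith [sq_nonneg (D11 x), sq_nonneg (D10 x + D01 x), sq_nonneg (D21 x + k * D12 x)]
  have B1 : ∫ x in Omega 3 L, (D11 x ^ 2 + (k * D22 x) ^ 2 + (D21 x + k * D12 x) ^ 2) ≤
      ∫ x in Omega 3 L, ψ x := by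
    apply setIntegral_mono (Omega_int _ _ (by fun_prop)) (Omega_int _ _ (by fun_prop))
    intro x
    simp only [hψ]
    linarith [sq_nonneg (D00 x), sq_nonneg (D10 x + D01 x), sq_nonneg (D20 x + k * D02 x)]
  have B2 : ∫ x in Omega 3 L, (D00 x ^ 2 + D11 x ^ 2 + (D10 x + D01 x) ^ 2) ≤
      ∫ x in Omega 3 L, ψ x := by
    apply setIntegral_mono (Omega_int _ _ (by fun_prop)) (Omega_int _ _ (by fun_prop))
    intro x
    simp only [hψ]
    linarith [sq_nonneg (k * D22 x), sq_nonneg (D21 x + k * D12 x), sq_nonneg (D20 x + k * D02 x)]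
  have B3 : ∫ x in Omega 3 L, (D00 x ^ 2 + D11 x ^ 2 + (k * D22 x) ^ 2) ≤
      ∫ x in Omega 3 L, ψ x := by
    apply setIntegral_mono (Omega_int _ _ (by fun_prop)) (Omega_int _ _ (by fun_prop))
    intro x
    simp only [hψ]
    linarith [sq_nonneg (D10 x + D01 x), sq_nonneg (D21 x + k * D12 x),
      sq_nonneg (D20 x + k * D02 x)]
  have E : k ^ 2 * ∫ x in Omega 3 L, ψ x ≤ 2 * ∫ x in Omega 3 L,
      k ^ 2 * (D00 x ^ 2 + D11 x ^ 2 + (k * D22 x) ^ 2 + ((D10 x + D01 x) ^ 2 +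
        (D20 x + k * D02 x) ^ 2 + (D21 x + k * D12 x) ^ 2) / 2) := by
    rw [← integral_const_mul, ← integral_const_mul]
    apply setIntegral_mono (Omega_int _ _ (by fun_prop)) (Omega_int _ _ (by fun_prop))
    intro x
    simp only [hψ]
    have := mul_nonneg (sq_nonneg k)
      (by positivity : 0 ≤ D00 x ^ 2 + D11 x ^ 2 + (k * D22 x) ^ 2)
    linarith
  have S0 : 0 ≤ ∫ x in Omega 3 L, ψ x :=
    integral_nonneg fun x => by simp only [hψ]; positivity
  generalize (∫ x in Omega 3 L, ψ x) = S at *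
  have q1 : S ≤ k ^ 2 * S := le_mul_of_one_le_left S0 hk2
  have q2 := mul_le_mul_of_nonneg_left E (by linarith : 0 ≤ 2 * K + 2)
  have q3 := mul_le_mul_of_nonneg_left B0 (by positivity : 0 ≤ K * k ^ 2)
  have q4 := mul_le_mul_of_nonneg_left B1 (by positivity : 0 ≤ K * k ^ 2)
  linarith

theorem stmt7 (hd : d = 2 ∨ d = 3) (hL : 0 < L) :
    ∃ C > (0 : ℝ), ∀ h : ℝ, 0 < h → h ≤ 1 →
      ∀ u : (Fin d → ℝ) → Fin d → ℝ, ContDiff ℝ 1 u →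
        (∀ i : Fin d, TangPeriodic d L (fun x => u x i)) →
        (∫ x in Omega d L, ∑ i, ∑ j, (gradh d h u x i j) ^ 2)
          ≤ C * ∫ x in Omega d L, ∑ i, ∑ j, (h⁻¹ * epsh d h u x i j) ^ 2 := by
  rcases hd with rfl | rfl
  · exact ⟨2 * ((400 + 44608 * (L - -L) ^ 2) + 1), by positivity,
      fun h h0 h1 u hu pu => final_two hL h0 h1 hu pu⟩
  · exact ⟨2 * (2 * (400 + 44608 * (L - -L) ^ 2) + 2), by positivity,
      fun h h0 h1 u hu pu => final_three hL h0 h1 hu pu⟩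
end
end

section
/- Let Ω_h = (-L,L) × (-h/2, h/2) ⊂ ℝ². There exists C > 0 (independent of h) such that for every u ∈ H¹(Ω_h; ℝ²) there exists a constant skew-symmetric matrix A₀ ∈ ℝ^{2×2} with ∫_{Ω_h} |∇u - A₀|² dx ≤ (C/h²) ∫_{Ω_h} |ε(u)|² dx, where ε(u) = sym ∇u. -/
/- STATEMENT 8: Korn inequality modulo one rigid rotation on the thin rectangle
Ω_h = (-L,L) × (-h/2,h/2) ⊂ ℝ²: there is C (independent of h) such that for every
u ∈ H¹(Ω_h;ℝ²) there is a constant skew-symmetric A₀ with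
∫_{Ω_h} |∇u - A₀|² ≤ (C/h²) ∫_{Ω_h} |sym ∇u|². -/

open MeasureTheory Set Matrix
noncomputable section

/-- the thin rectangle Ω_h = (-L,L) × (-h/2, h/2). -/
def OmegaThin (L h : ℝ) : Set (Fin 2 → ℝ) :=
  {x | x 0 ∈ Ioo (-L) L ∧ x 1 ∈ Ioo (-(h / 2)) (h / 2)}

/-- the gradient matrix (∇u)ᵢⱼ = ∂ⱼuᵢ. -/
def gradM (u : (Fin 2 → ℝ) → Fin 2 → ℝ) (x : Fin 2 → ℝ) (i j : Fin 2) : ℝ :=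
  fderiv ℝ (fun y => u y i) x (Pi.single j 1)


namespace KornThin

def d1 (f : ℝ × ℝ → ℝ) (z : ℝ × ℝ) : ℝ := fderiv ℝ f z (1, 0)
def d2 (f : ℝ × ℝ → ℝ) (z : ℝ × ℝ) : ℝ := fderiv ℝ f z (0, 1)

/-- iterated integral over a box -/
def II (F : ℝ × ℝ → ℝ) (a b c d : ℝ) : ℝ := ∫ x in a..b, ∫ y in c..d, F (x, y)

lemma cont_d1 {f : ℝ × ℝ → ℝ} (hf : ContDiff ℝ 1 f) : Continuous (d1 f) := by
  unfold d1
  exact (hf.continuous_fderiv (by norm_num)).clm_apply continuous_const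

lemma cont_d2 {f : ℝ × ℝ → ℝ} (hf : ContDiff ℝ 1 f) : Continuous (d2 f) := by
  unfold d2
  exact (hf.continuous_fderiv (by norm_num)).clm_apply continuous_const

lemma hasDeriv_d1 {f : ℝ × ℝ → ℝ} (hf : ContDiff ℝ 1 f) (x y : ℝ) :
    HasDerivAt (fun s => f (s, y)) (d1 f (x, y)) x := by
  have h := (hf.differentiable (by norm_num) (x, y)).hasFDerivAt
  have h2 : HasDerivAt (fun s : ℝ => (s, y)) ((1 : ℝ), (0 : ℝ)) x :=
    (hasDerivAt_id x).prodMk (hasDerivAt_const x y)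
  exact h.comp_hasDerivAt x h2

lemma hasDeriv_d2 {f : ℝ × ℝ → ℝ} (hf : ContDiff ℝ 1 f) (x y : ℝ) :
    HasDerivAt (fun s => f (x, s)) (d2 f (x, y)) y := by
  have h := (hf.differentiable (by norm_num) (x, y)).hasFDerivAt
  have h2 : HasDerivAt (fun s : ℝ => (x, s)) ((0 : ℝ), (1 : ℝ)) y :=
    (hasDerivAt_const y x).prodMk (hasDerivAt_id y)
  exact h.comp_hasDerivAt y h2

lemma d1_eq {f : ℝ × ℝ → ℝ} (hf : ContDiff ℝ 1 f) {x y c : ℝ}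
    (h : HasDerivAt (fun s => f (s, y)) c x) : d1 f (x, y) = c :=
  (hasDeriv_d1 hf x y).unique h

lemma d2_eq {f : ℝ × ℝ → ℝ} (hf : ContDiff ℝ 1 f) {x y c : ℝ}
    (h : HasDerivAt (fun s => f (x, s)) c y) : d2 f (x, y) = c :=
  (hasDeriv_d2 hf x y).unique h

lemma cont_inner {F : ℝ × ℝ → ℝ} (hF : Continuous F) (c d : ℝ) :
    Continuous (fun x => ∫ y in c..d, F (x, y)) := by
  apply intervalIntegral.continuous_parametric_intervalIntegral_of_continuous' (f := fun x y => F (x, y))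
  exact hF

lemma ii1 {F : ℝ × ℝ → ℝ} (hF : Continuous F) (x c d : ℝ) :
    IntervalIntegrable (fun y => F (x, y)) volume c d :=
  Continuous.intervalIntegrable (by fun_prop) _ _

lemma ii2 {F : ℝ × ℝ → ℝ} (hF : Continuous F) (a b c d : ℝ) :
    IntervalIntegrable (fun x => ∫ y in c..d, F (x, y)) volume a b :=
  (cont_inner hF c d).intervalIntegrable _ _

lemma II_add {F G : ℝ × ℝ → ℝ} (hF : Continuous F) (hG : Continuous G) (a b c d : ℝ) :
    II (fun z => F z + G z) a b c d = II F a b c d + II G a b c d := by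
  unfold II
  rw [← intervalIntegral.integral_add (ii2 hF a b c d) (ii2 hG a b c d)]
  congr 1; ext x
  exact intervalIntegral.integral_add (ii1 hF x c d) (ii1 hG x c d)

lemma II_sub {F G : ℝ × ℝ → ℝ} (hF : Continuous F) (hG : Continuous G) (a b c d : ℝ) :
    II (fun z => F z - G z) a b c d = II F a b c d - II G a b c d := by
  unfold II
  rw [← intervalIntegral.integral_sub (ii2 hF a b c d) (ii2 hG a b c d)]
  congr 1; ext x
  exact intervalIntegral.integral_sub (ii1 hF x c d) (ii1 hG x c d)

lemma II_mul (k : ℝ) (F : ℝ × ℝ → ℝ) (a b c d : ℝ) :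
    II (fun z => k * F z) a b c d = k * II F a b c d := by
  unfold II
  simp only [intervalIntegral.integral_const_mul]

lemma II_const (k : ℝ) (a b c d : ℝ) :
    II (fun _ => k) a b c d = (b - a) * ((d - c) * k) := by
  unfold II
  simp; ring

lemma II_mono {F G : ℝ × ℝ → ℝ} (hF : Continuous F) (hG : Continuous G) {a b c d : ℝ}
    (hab : a ≤ b) (hcd : c ≤ d)
    (h : ∀ x ∈ Icc a b, ∀ y ∈ Icc c d, F (x, y) ≤ G (x, y)) :
    II F a b c d ≤ II G a b c d := by
  unfold II
  apply intervalIntegral.integral_mono_on hab (ii2 hF a b c d) (ii2 hG a b c d)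
  intro x hx
  apply intervalIntegral.integral_mono_on hcd (ii1 hF x c d) (ii1 hG x c d)
  intro y hy
  exact h x hx y hy

lemma II_nonneg {F : ℝ × ℝ → ℝ} {a b c d : ℝ}
    (hab : a ≤ b) (hcd : c ≤ d)
    (h : ∀ z, 0 ≤ F z) : 0 ≤ II F a b c d := by
  unfold II
  apply intervalIntegral.integral_nonneg hab
  intro x _
  apply intervalIntegral.integral_nonneg hcd
  intro y _
  exact h _

lemma II_congr {F G : ℝ × ℝ → ℝ} (h : ∀ z, F z = G z) (a b c d : ℝ) :
    II F a b c d = II G a b c d := by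
  rw [show F = G from funext h]

lemma II_swap {F : ℝ × ℝ → ℝ} (hF : Continuous F) (a b c d : ℝ) :
    II F a b c d = II (fun z => F (z.2, z.1)) c d a b := by
  unfold II
  apply intervalIntegral_intervalIntegral_swap (F := fun x y => F (x, y))
  have : ContinuousOn F (uIcc a b ×ˢ uIcc c d) := hF.continuousOn
  have h := this.integrableOn_compact (μ := volume) (isCompact_uIcc.prod isCompact_uIcc)
  exact h.mono_set (prod_mono uIoc_subset_uIcc uIoc_subset_uIcc)

lemma II_adj1 {F : ℝ × ℝ → ℝ} (hF : Continuous F) (a b e c d : ℝ) :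
    II F a b c d + II F b e c d = II F a e c d := by
  unfold II
  exact intervalIntegral.integral_add_adjacent_intervals (ii2 hF _ _ _ _) (ii2 hF _ _ _ _)

lemma II_adj2 {F : ℝ × ℝ → ℝ} (hF : Continuous F) (a b c d e : ℝ) :
    II F a b c d + II F a b d e = II F a b c e := by
  have hF' : Continuous (fun z : ℝ × ℝ => F (z.2, z.1)) := by fun_prop
  rw [II_swap hF a b c d, II_swap hF a b d e, II_swap hF a b c e, II_adj1 hF']

lemma II_mono_set {F : ℝ × ℝ → ℝ} (hF : Continuous F) (h0 : ∀ z, 0 ≤ F z) {b c d e : ℝ}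
    (h1 : 0 ≤ b) (h2 : b ≤ d) (h3 : 0 ≤ c) (h4 : c ≤ e) :
    II F 0 b 0 c ≤ II F 0 d 0 e := by
  have e1 := II_adj1 hF 0 b d 0 c
  have e2 := II_adj2 hF 0 d 0 c e
  have n1 := II_nonneg h2 h3 h0
  have n2 := II_nonneg (h1.trans h2) h4 h0
  linarith

/-- change of variables -/
lemma II_affine (F : ℝ × ℝ → ℝ) {p q : ℝ} (hp : p ≠ 0) (hq : q ≠ 0) (r s a b c d : ℝ) :
    II (fun z => F (p * z.1 + r, q * z.2 + s)) a b c d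
      = p⁻¹ * (q⁻¹ * II F (p * a + r) (p * b + r) (q * c + s) (q * d + s)) := by
  unfold II
  simp only
  have h1 : ∀ x, ∫ y in c..d, F (p * x + r, q * y + s)
      = q⁻¹ * ∫ y in (q * c + s)..(q * d + s), F (p * x + r, y) := by
    intro x
    rw [intervalIntegral.integral_comp_mul_add (fun y => F (p * x + r, y)) hq s, smul_eq_mul]
  simp only [h1]
  rw [intervalIntegral.integral_comp_mul_add
    (fun x => q⁻¹ * ∫ y in (q * c + s)..(q * d + s), F (x, y)) hp r, smul_eq_mul,
    intervalIntegral.integral_const_mul]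

lemma cs {f : ℝ → ℝ} (hf : Continuous f) {a b : ℝ} (hab : a ≤ b) :
    (∫ x in a..b, f x) ^ 2 ≤ (b - a) * ∫ x in a..b, f x ^ 2 := by
  rcases hab.eq_or_lt with rfl | h
  · simp
  set m := (∫ x in a..b, f x) with hm
  have hba : 0 < b - a := by linarith
  have h1 : 0 ≤ ∫ x in a..b, ((b - a) * f x - m) ^ 2 :=
    intervalIntegral.integral_nonneg hab fun x _ => sq_nonneg _
  have h2 : (∫ x in a..b, ((b - a) * f x - m) ^ 2)
      = (b - a) ^ 2 * (∫ x in a..b, f x ^ 2) - (b - a) * m ^ 2 := by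
    have : ∀ x, ((b - a) * f x - m) ^ 2
        = (b - a) ^ 2 * f x ^ 2 - (2 * (b - a) * m) * f x + m ^ 2 := by intro x; ring
    simp only [this]
    rw [intervalIntegral.integral_add, intervalIntegral.integral_sub,
      intervalIntegral.integral_const_mul, intervalIntegral.integral_const_mul,
      intervalIntegral.integral_const, ← hm, smul_eq_mul]
    · ring
    all_goals exact Continuous.intervalIntegrable (by fun_prop) _ _
  rw [h2] at h1
  nlinarith

lemma II_cs {F : ℝ × ℝ → ℝ} (hF : Continuous F) :
    (II F 0 1 0 1) ^ 2 ≤ II (fun z => F z ^ 2) 0 1 0 1 := by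
  unfold II
  refine (cs (cont_inner hF 0 1) zero_le_one).trans ?_
  rw [sub_zero, one_mul]
  have hF2 : Continuous (fun z => F z ^ 2) := by fun_prop
  apply intervalIntegral.integral_mono_on zero_le_one _ (ii2 hF2 0 1 0 1)
  · intro x _
    have := cs (f := fun y => F (x, y)) (by fun_prop) (zero_le_one' ℝ)
    simpa using this
  · exact ((cont_inner hF 0 1).pow 2).intervalIntegrable _ _

lemma sq_diff {f f' : ℝ → ℝ} (hf : ∀ x, HasDerivAt f (f' x) x) (hc : Continuous f')
    {x s : ℝ} (hx : x ∈ Icc (0:ℝ) 1) (hs : s ∈ Icc (0:ℝ) 1) :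
    (f x - f s) ^ 2 ≤ ∫ t in (0:ℝ)..1, f' t ^ 2 := by
  wlog h : s ≤ x generalizing x s
  · have := this hs hx (le_of_not_ge h)
    nlinarith
  rw [← intervalIntegral.integral_eq_sub_of_hasDerivAt (fun t _ => hf t)
    (hc.intervalIntegrable _ _)]
  have hc2 : Continuous (fun t => f' t ^ 2) := by fun_prop
  have h0 : 0 ≤ ∫ t in s..x, f' t ^ 2 :=
    intervalIntegral.integral_nonneg h fun t _ => sq_nonneg _
  calc _ ≤ (x - s) * ∫ t in s..x, f' t ^ 2 := cs hc h
    _ ≤ 1 * ∫ t in s..x, f' t ^ 2 := by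
      apply mul_le_mul_of_nonneg_right _ h0
      linarith [hx.2, hs.1]
    _ = ∫ t in s..x, f' t ^ 2 := one_mul _
    _ ≤ _ := by
      apply intervalIntegral.integral_mono_interval hs.1 h hx.2
      · exact Filter.Eventually.of_forall fun t => sq_nonneg _
      · exact hc2.intervalIntegrable _ _

lemma lip_bound {f : ℝ × ℝ → ℝ} (hf : ContDiff ℝ 1 f) (y : ℝ) :
    ∃ M : ℝ, 0 ≤ M ∧ ∀ x ∈ Icc (0:ℝ) 1, ∀ y' ∈ Icc (y - 1) (y + 1),
      |f (x, y') - f (x, y)| ≤ M * |y' - y| := by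
  have hK : IsCompact (Icc (0:ℝ) 1 ×ˢ Icc (y - 1) (y + 1)) := isCompact_Icc.prod isCompact_Icc
  obtain ⟨M, hM⟩ := hK.exists_bound_of_continuousOn (cont_d2 hf).continuousOn
  refine ⟨max M 0, le_max_right _ _, fun x hx y' hy' => ?_⟩
  have := (convex_Icc (y - 1) (y + 1)).norm_image_sub_le_of_norm_hasDerivWithin_le
    (f := fun s => f (x, s)) (f' := fun s => d2 f (x, s)) (C := max M 0)
    (fun s _ => (hasDeriv_d2 hf x s).hasDerivWithinAt)
    (fun s hs => (hM (x, s) ⟨hx, hs⟩).trans (le_max_left _ _))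
    (show y ∈ Icc (y - 1) (y + 1) from ⟨by linarith, by linarith⟩) hy'
  simpa [Real.norm_eq_abs] using this

open Filter Topology in
lemma tendsto_slope_int {f k : ℝ × ℝ → ℝ} (hf : ContDiff ℝ 1 f) (hk : Continuous k) (y : ℝ) :
    Tendsto (fun y' => ∫ x in (0:ℝ)..1, slope (fun s => f (x, s)) y y' * k (x, y'))
      (𝓝[≠] y) (𝓝 (∫ x in (0:ℝ)..1, d2 f (x, y) * k (x, y))) := by
  obtain ⟨M, hM0, hM⟩ := lip_bound hf y
  have hK : IsCompact (Icc (0:ℝ) 1 ×ˢ Icc (y - 1) (y + 1)) := isCompact_Icc.prod isCompact_Icc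
  obtain ⟨N, hN⟩ := hK.exists_bound_of_continuousOn hk.continuousOn
  apply intervalIntegral.tendsto_integral_filter_of_dominated_convergence (fun _ => M * N)
  · refine Eventually.of_forall fun y' => ?_
    apply Continuous.aestronglyMeasurable
    have := hf.continuous
    simp only [slope_def_field]
    fun_prop
  · have : Icc (y - 1) (y + 1) ∈ 𝓝[≠] y :=
      mem_nhdsWithin_of_mem_nhds (Icc_mem_nhds (by linarith) (by linarith))
    filter_upwards [this, self_mem_nhdsWithin] with y' hy' hne
    refine Eventually.of_forall fun x hx => ?_
    have hx' : x ∈ Icc (0:ℝ) 1 := by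
      rw [uIoc_of_le zero_le_one] at hx; exact ⟨hx.1.le, hx.2⟩
    rw [norm_mul]
    have hpos : 0 < |y' - y| := abs_pos.2 (sub_ne_zero.2 hne)
    apply mul_le_mul _ (hN (x, y') ⟨hx', hy'⟩) (norm_nonneg _) hM0
    rw [slope_def_field, Real.norm_eq_abs, abs_div, div_le_iff₀ hpos]
    exact hM x hx' y' hy'
  · exact intervalIntegrable_const
  · refine Eventually.of_forall fun x _ => ?_
    apply Tendsto.mul
    · exact hasDerivAt_iff_tendsto_slope.1 (hasDeriv_d2 hf x y)
    · have : Continuous (fun y' => k (x, y')) := by fun_prop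
      exact (this.tendsto y).mono_left nhdsWithin_le_nhds

open Filter Topology in
lemma deriv_Phi {f g : ℝ × ℝ → ℝ} (hf : ContDiff ℝ 1 f) (hg : ContDiff ℝ 1 g)
    (h1 : ∀ y, f (1, y) = 0) (y : ℝ) :
    HasDerivAt (fun y => ∫ x in (0:ℝ)..1, f (x, y) * d1 g (x, y))
      ((∫ x in (0:ℝ)..1, (d2 f (x, y) * d1 g (x, y) - d1 f (x, y) * d2 g (x, y)))
        - f (0, y) * d2 g (0, y)) y := by
  have cf := hf.continuous
  have cg := hg.continuous
  have c1f := cont_d1 hf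
  have c1g := cont_d1 hg
  have c2f := cont_d2 hf
  have c2g := cont_d2 hg
  rw [hasDerivAt_iff_tendsto_slope]
  have t1 := tendsto_slope_int hf c1g y
  have t2 := tendsto_slope_int hg (k := fun z => d1 f (z.1, y)) (by fun_prop) y
  have t3 := (hasDerivAt_iff_tendsto_slope.1 (hasDeriv_d2 hg 0 y)).const_mul (f (0, y))
  have t := (t1.sub t2).sub t3
  have e : (∫ x in (0:ℝ)..1, (d2 f (x, y) * d1 g (x, y) - d1 f (x, y) * d2 g (x, y)))
      = (∫ x in (0:ℝ)..1, d2 f (x, y) * d1 g (x, y))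
        - ∫ x in (0:ℝ)..1, d2 g (x, y) * d1 f (x, y) := by
    rw [← intervalIntegral.integral_sub]
    · congr 1; ext x; ring
    all_goals exact Continuous.intervalIntegrable (by fun_prop) _ _
  rw [e]
  refine t.congr' ?_
  filter_upwards [self_mem_nhdsWithin] with y' hne
  have hne' : y' - y ≠ 0 := sub_ne_zero.2 hne
  simp only [slope_def_field]
  have ibp := intervalIntegral.integral_mul_deriv_eq_deriv_mul_of_hasDerivAt
    (u := fun x => f (x, y)) (u' := fun x => d1 f (x, y))
    (v := fun x => g (x, y') - g (x, y)) (v' := fun x => d1 g (x, y') - d1 g (x, y))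
    (a := 0) (b := 1) (by fun_prop) (by fun_prop)
    (fun x _ => hasDeriv_d1 hf x y)
    (fun x _ => (hasDeriv_d1 hg x y').sub (hasDeriv_d1 hg x y))
    (Continuous.intervalIntegrable (by fun_prop) _ _)
    (Continuous.intervalIntegrable (by fun_prop) _ _)
  simp only [h1, zero_mul, zero_sub] at ibp
  have e1 : (∫ x in (0:ℝ)..1, f (x, y') * d1 g (x, y')) - (∫ x in (0:ℝ)..1, f (x, y) * d1 g (x, y))
      = (∫ x in (0:ℝ)..1, (f (x, y') - f (x, y)) * d1 g (x, y'))
        + ∫ x in (0:ℝ)..1, f (x, y) * (d1 g (x, y') - d1 g (x, y)) := by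
    rw [← intervalIntegral.integral_sub, ← intervalIntegral.integral_add]
    · congr 1; ext x; ring
    all_goals exact Continuous.intervalIntegrable (by fun_prop) _ _
  rw [e1, ibp]
  have e2 : ∀ x, (f (x, y') - f (x, y)) / (y' - y) * d1 g (x, y')
      = (y' - y)⁻¹ * ((f (x, y') - f (x, y)) * d1 g (x, y')) := by intro x; ring
  have e3 : ∀ x, (g (x, y') - g (x, y)) / (y' - y) * d1 f (x, y)
      = (y' - y)⁻¹ * (d1 f (x, y) * (g (x, y') - g (x, y))) := by intro x; ring
  simp only [e2, e3, intervalIntegral.integral_const_mul]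
  field_simp
  ring

lemma green {f g : ℝ × ℝ → ℝ} (hf : ContDiff ℝ 1 f) (hg : ContDiff ℝ 1 g)
    (h1 : ∀ y, f (1, y) = 0) (h2 : ∀ x, f (x, 1) = 0) :
    II (fun z => d1 f z * d2 g z - d2 f z * d1 g z) 0 1 0 1
      = (∫ x in (0:ℝ)..1, f (x, 0) * d1 g (x, 0)) - ∫ y in (0:ℝ)..1, f (0, y) * d2 g (0, y) := by
  have cf := hf.continuous
  have cg := hg.continuous
  have c1f := cont_d1 hf
  have c1g := cont_d1 hg
  have c2f := cont_d2 hf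
  have c2g := cont_d2 hg
  have cc : Continuous fun y => ∫ x in (0:ℝ)..1,
      (d2 f (x, y) * d1 g (x, y) - d1 f (x, y) * d2 g (x, y)) :=
    cont_inner (F := fun z => d2 f (z.2, z.1) * d1 g (z.2, z.1) - d1 f (z.2, z.1) * d2 g (z.2, z.1))
      (by fun_prop) 0 1
  have ftc := intervalIntegral.integral_eq_sub_of_hasDerivAt (a := 0) (b := 1)
    (fun y _ => deriv_Phi hf hg h1 y)
    (Continuous.intervalIntegrable (by fun_prop) _ _)
  rw [intervalIntegral.integral_sub (cc.intervalIntegrable _ _)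
    (Continuous.intervalIntegrable (by fun_prop) _ _)] at ftc
  simp only [h2, zero_mul, intervalIntegral.integral_zero, zero_sub] at ftc
  rw [II_swap (by fun_prop)]
  have : II (fun z : ℝ × ℝ => d1 f (z.2, z.1) * d2 g (z.2, z.1) - d2 f (z.2, z.1) * d1 g (z.2, z.1)) 0 1 0 1
     = -∫ y in (0:ℝ)..1, ∫ x in (0:ℝ)..1,
      (d2 f (x, y) * d1 g (x, y) - d1 f (x, y) * d2 g (x, y)) := by
    unfold II
    rw [← intervalIntegral.integral_neg]
    congr 1; ext y
    rw [← intervalIntegral.integral_neg]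
    congr 1; ext x
    ring
  rw [this]
  linarith

def EE (v1 v2 : ℝ × ℝ → ℝ) (z : ℝ × ℝ) : ℝ :=
  (d1 v1 z) ^ 2 + (d2 v2 z) ^ 2 + (d2 v1 z + d1 v2 z) ^ 2

lemma cont_EE {v1 v2 : ℝ × ℝ → ℝ} (h1 : ContDiff ℝ 1 v1) (h2 : ContDiff ℝ 1 v2) :
    Continuous (EE v1 v2) := by
  have := cont_d1 h1
  have := cont_d2 h1
  have := cont_d1 h2
  have := cont_d2 h2
  unfold EE
  fun_prop

lemma EE_nonneg (v1 v2 : ℝ × ℝ → ℝ) (z : ℝ × ℝ) : 0 ≤ EE v1 v2 z := by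
  unfold EE; positivity

lemma affine_contDiff {f : ℝ × ℝ → ℝ} (hf : ContDiff ℝ 1 f) (p q r s : ℝ) :
    ContDiff ℝ 1 (fun z : ℝ × ℝ => f (p * z.1 + r, q * z.2 + s)) := by
  fun_prop

lemma d1_affine {f : ℝ × ℝ → ℝ} (hf : ContDiff ℝ 1 f) (p q r s : ℝ) (z : ℝ × ℝ) :
    d1 (fun z : ℝ × ℝ => f (p * z.1 + r, q * z.2 + s)) z
      = p * d1 f (p * z.1 + r, q * z.2 + s) := by
  obtain ⟨x, y⟩ := z
  apply d1_eq (affine_contDiff hf p q r s)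
  have h1 : HasDerivAt (fun t : ℝ => p * t + r) p x := by
    simpa using ((hasDerivAt_id x).const_mul p).add_const r
  have := (hasDeriv_d1 hf (p * x + r) (q * y + s)).comp x h1
  simpa [mul_comm, Function.comp_def] using this

lemma d2_affine {f : ℝ × ℝ → ℝ} (hf : ContDiff ℝ 1 f) (p q r s : ℝ) (z : ℝ × ℝ) :
    d2 (fun z : ℝ × ℝ => f (p * z.1 + r, q * z.2 + s)) z
      = q * d2 f (p * z.1 + r, q * z.2 + s) := by
  obtain ⟨x, y⟩ := z
  apply d2_eq (affine_contDiff hf p q r s)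
  have h1 : HasDerivAt (fun t : ℝ => q * t + s) q y := by
    simpa using ((hasDerivAt_id y).const_mul q).add_const s
  have := (hasDeriv_d2 hf (p * x + r) (q * y + s)).comp y h1
  simpa [mul_comm, Function.comp_def] using this

lemma II_abs_le {F G : ℝ × ℝ → ℝ} (hF : Continuous F) (hG : Continuous G)
    (h : ∀ z, |F z| ≤ G z) : |II F 0 1 0 1| ≤ II G 0 1 0 1 := by
  rw [abs_le]
  constructor
  · have : II (fun z => (-1) * G z) 0 1 0 1 ≤ II F 0 1 0 1 :=
      II_mono (by fun_prop) hF zero_le_one zero_le_one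
        (fun x _ y _ => by have := (abs_le.1 (h (x, y))).1; linarith)
    rw [II_mul] at this
    linarith
  · exact II_mono hF hG zero_le_one zero_le_one
        (fun x _ y _ => (abs_le.1 (h (x, y))).2)

lemma II_scale1 {F : ℝ × ℝ → ℝ} (hF : Continuous F) (h0 : ∀ x y, 1 ≤ x → F (x, y) = 0)
    {a : ℝ} (ha : 1 ≤ a) :
    II (fun z => F (a * z.1, z.2)) 0 1 0 1 = a⁻¹ * II F 0 1 0 1 := by
  have h := II_affine F (p := a) (q := 1) (by linarith) one_ne_zero 0 0 0 1 0 1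
  simp only [add_zero, one_mul, mul_zero, mul_one, inv_one] at h
  rw [h, ← II_adj1 hF 0 1 a 0 1]
  have : II F 1 a 0 1 = 0 := by
    unfold II
    rw [intervalIntegral.integral_congr (g := fun _ => 0)]
    · simp
    · intro x hx
      rw [uIcc_of_le ha] at hx
      simp [h0 x _ hx.1]
  rw [this, add_zero]

lemma II_scale2 {F : ℝ × ℝ → ℝ} (hF : Continuous F) (h0 : ∀ x y, 1 ≤ y → F (x, y) = 0)
    {a : ℝ} (ha : 1 ≤ a) :
    II (fun z => F (z.1, a * z.2)) 0 1 0 1 = a⁻¹ * II F 0 1 0 1 := by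
  rw [II_swap (by fun_prop), II_swap hF]
  exact II_scale1 (F := fun z => F (z.2, z.1)) (by fun_prop) (fun x y h => h0 y x h) ha

lemma fderiv_zero1 {f : ℝ × ℝ → ℝ} (h : ∀ x y, 3 / 4 ≤ x → f (x, y) = 0) (x y : ℝ) (hx : 1 ≤ x) :
    fderiv ℝ f (x, y) = 0 := by
  have : f =ᶠ[nhds (x, y)] fun _ => 0 := by
    have ho : IsOpen {z : ℝ × ℝ | 3 / 4 < z.1} := isOpen_lt continuous_const continuous_fst
    filter_upwards [ho.mem_nhds (show 3 / 4 < x by linarith)] with z hz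
    exact h z.1 z.2 (le_of_lt hz)
  rw [this.fderiv_eq]
  simp

lemma fderiv_zero2 {f : ℝ × ℝ → ℝ} (h : ∀ x y, 3 / 4 ≤ y → f (x, y) = 0) (x y : ℝ) (hx : 1 ≤ y) :
    fderiv ℝ f (x, y) = 0 := by
  have : f =ᶠ[nhds (x, y)] fun _ => 0 := by
    have ho : IsOpen {z : ℝ × ℝ | 3 / 4 < z.2} := isOpen_lt continuous_const continuous_snd
    filter_upwards [ho.mem_nhds (show 3 / 4 < y by linarith)] with z hz
    exact h z.1 z.2 (le_of_lt hz)
  rw [this.fderiv_eq]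
  simp

section quad
variable {w1 w2 : ℝ × ℝ → ℝ}

/-- the bilinear form -/
def JJ (w1 w2 : ℝ × ℝ → ℝ) (a d : ℝ) : ℝ :=
  II (fun z => (a * d1 w1 (a * z.1, z.2)) * (d * d2 w2 (z.1, d * z.2))
    - d2 w1 (a * z.1, z.2) * d1 w2 (z.1, d * z.2)) 0 1 0 1

lemma JJ_green (hw1 : ContDiff ℝ 1 w1) (hw2 : ContDiff ℝ 1 w2)
    (a1 : ∀ x y, 3 / 4 ≤ x → w1 (x, y) = 0) (a2 : ∀ x y, 3 / 4 ≤ y → w1 (x, y) = 0)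
    {a d : ℝ} (ha : 1 ≤ a) :
    JJ w1 w2 a d = (∫ x in (0:ℝ)..1, w1 (a * x, 0) * d1 w2 (x, 0))
      - ∫ y in (0:ℝ)..1, w1 (0, y) * (d * d2 w2 (0, d * y)) := by
  have h := green (affine_contDiff hw1 a 1 0 0) (affine_contDiff hw2 1 d 0 0)
    (fun y => a1 _ _ (by linarith)) (fun x => a2 _ _ (by linarith))
  simp only [d1_affine hw1, d1_affine hw2, d2_affine hw1, d2_affine hw2] at h
  simp only [add_zero, one_mul, mul_zero] at h
  exact h

lemma JJ_bound (hw1 : ContDiff ℝ 1 w1) (hw2 : ContDiff ℝ 1 w2)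
    (a1 : ∀ x y, 3 / 4 ≤ x → w1 (x, y) = 0)
    (b1 : ∀ x y, 3 / 4 ≤ x → w2 (x, y) = 0) (b2 : ∀ x y, 3 / 4 ≤ y → w2 (x, y) = 0)
    {a d σ : ℝ} (ha : 1 ≤ a) (hd : 1 ≤ d) (hσ : 0 < σ) :
    |JJ w1 w2 a d| ≤ (a * d / 2) * (a⁻¹ * II (fun z => d1 w1 z ^ 2) 0 1 0 1)
      + (a * d / 2) * (d⁻¹ * II (fun z => d2 w2 z ^ 2) 0 1 0 1)
      + (σ / 2) * (a⁻¹ * II (fun z => d1 w2 z ^ 2) 0 1 0 1)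
      + (σ⁻¹ / 2) * (d⁻¹ * II (fun z => d1 w2 z ^ 2) 0 1 0 1)
      + 8 * (a⁻¹ * II (fun z => (d2 w1 z + d1 w2 z) ^ 2) 0 1 0 1)
      + (1 / 32) * (d⁻¹ * II (fun z => d1 w2 z ^ 2) 0 1 0 1) := by
  have c11 := cont_d1 hw1
  have c21 := cont_d2 hw1
  have c12 := cont_d1 hw2
  have c22 := cont_d2 hw2
  have z1 := fderiv_zero1 a1
  have z3 := fderiv_zero1 b1
  have z4 := fderiv_zero2 b2
  rw [← II_scale1 (F := fun z => d1 w1 z ^ 2) (by fun_prop)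
      (fun x y h => by simp [d1, z1 x y h]) ha,
    ← II_scale2 (F := fun z => d2 w2 z ^ 2) (by fun_prop)
      (fun x y h => by simp [d2, z4 x y h]) hd,
    ← II_scale1 (F := fun z => d1 w2 z ^ 2) (by fun_prop)
      (fun x y h => by simp [d1, z3 x y h]) ha,
    ← II_scale2 (F := fun z => d1 w2 z ^ 2) (by fun_prop)
      (fun x y h => by simp [d1, z4 x y h]) hd,
    ← II_scale1 (F := fun z => (d2 w1 z + d1 w2 z) ^ 2) (by fun_prop)
      (fun x y h => by simp [d1, d2, z1 x y h, z3 x y h]) ha]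
  simp only [← II_mul]
  rw [← II_add (by fun_prop) (by fun_prop), ← II_add (by fun_prop) (by fun_prop),
    ← II_add (by fun_prop) (by fun_prop), ← II_add (by fun_prop) (by fun_prop),
    ← II_add (by fun_prop) (by fun_prop)]
  apply II_abs_le (by fun_prop) (by fun_prop)
  intro z
  set e1 := d1 w1 (a * z.1, z.2)
  set e2 := d2 w2 (z.1, d * z.2)
  set q := d2 w1 (a * z.1, z.2)
  set p' := d1 w2 (a * z.1, z.2)
  set p := d1 w2 (z.1, d * z.2)
  have k1 : |(a * e1) * (d * e2)| ≤ a * d / 2 * e1 ^ 2 + a * d / 2 * e2 ^ 2 := by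
    have had : 0 ≤ a * d := by nlinarith
    rw [abs_le]; constructor <;> nlinarith [mul_nonneg had (sq_nonneg (e1 + e2)), mul_nonneg had (sq_nonneg (e1 - e2))]
  have k2 : |p' * p| ≤ σ / 2 * p' ^ 2 + σ⁻¹ / 2 * p ^ 2 := by
    have hs : σ * σ⁻¹ = 1 := mul_inv_cancel₀ hσ.ne'
    have hi : 0 < σ⁻¹ := inv_pos.2 hσ
    have e1 : σ / 2 * p' ^ 2 + σ⁻¹ / 2 * p ^ 2 - p' * p = σ⁻¹ / 2 * (σ * p' - p) ^ 2 := by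
      field_simp; ring
    have e2 : σ / 2 * p' ^ 2 + σ⁻¹ / 2 * p ^ 2 + p' * p = σ⁻¹ / 2 * (σ * p' + p) ^ 2 := by
      field_simp; ring
    have n1 : 0 ≤ σ⁻¹ / 2 * (σ * p' - p) ^ 2 := by positivity
    have n2 : 0 ≤ σ⁻¹ / 2 * (σ * p' + p) ^ 2 := by positivity
    rw [abs_le]; constructor <;> linarith
  have k3 : |(q + p') * p| ≤ 8 * (q + p') ^ 2 + 1 / 32 * p ^ 2 := by
    rw [abs_le]; constructor <;> nlinarith [sq_nonneg (16 * (q + p') + p), sq_nonneg (16 * (q + p') - p)]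
  have : (a * e1) * (d * e2) - q * p = (a * e1) * (d * e2) + p' * p - (q + p') * p := by ring
  rw [this]
  rw [abs_le] at *
  constructor <;> linarith

lemma quad (hw1 : ContDiff ℝ 1 w1) (hw2 : ContDiff ℝ 1 w2)
    (a1 : ∀ x y, 3 / 4 ≤ x → w1 (x, y) = 0) (a2 : ∀ x y, 3 / 4 ≤ y → w1 (x, y) = 0)
    (b1 : ∀ x y, 3 / 4 ≤ x → w2 (x, y) = 0) (b2 : ∀ x y, 3 / 4 ≤ y → w2 (x, y) = 0) :
    II (fun z => d1 w2 z ^ 2) 0 1 0 1 ≤ 50 * II (EE w1 w2) 0 1 0 1 := by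
  have c11 := cont_d1 hw1
  have c21 := cont_d2 hw1
  have c12 := cont_d1 hw2
  have c22 := cont_d2 hw2
  have g11 := JJ_green hw1 hw2 a1 a2 (a := 1) (d := 1) le_rfl
  have g12 := JJ_green hw1 hw2 a1 a2 (a := 1) (d := 16) le_rfl
  have g21 := JJ_green hw1 hw2 a1 a2 (a := 16) (d := 1) (by norm_num)
  have g22 := JJ_green hw1 hw2 a1 a2 (a := 16) (d := 16) (by norm_num)
  have b12 := JJ_bound hw1 hw2 a1 b1 b2 (a := 1) (d := 16) (σ := 1 / 4) (by norm_num) (by norm_num)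
    (by norm_num)
  have b21 := JJ_bound hw1 hw2 a1 b1 b2 (a := 16) (d := 1) (σ := 4) (by norm_num) (by norm_num)
    (by norm_num)
  have b22 := JJ_bound hw1 hw2 a1 b1 b2 (a := 16) (d := 16) (σ := 1) (by norm_num) (by norm_num)
    (by norm_num)
  have hE : II (EE w1 w2) 0 1 0 1 = II (fun z => d1 w1 z ^ 2) 0 1 0 1
      + II (fun z => d2 w2 z ^ 2) 0 1 0 1 + II (fun z => (d2 w1 z + d1 w2 z) ^ 2) 0 1 0 1 := by
    rw [← II_add (by fun_prop) (by fun_prop), ← II_add (by fun_prop) (by fun_prop)]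
    rfl
  have hJ : (31 / 32) * II (fun z => d1 w2 z ^ 2) 0 1 0 1 ≤
      JJ w1 w2 1 1 + (1 / 2) * II (fun z => d1 w1 z ^ 2) 0 1 0 1
      + (1 / 2) * II (fun z => d2 w2 z ^ 2) 0 1 0 1
      + 8 * II (fun z => (d2 w1 z + d1 w2 z) ^ 2) 0 1 0 1 := by
    unfold JJ
    simp only [← II_mul]
    rw [← II_add (by fun_prop) (by fun_prop), ← II_add (by fun_prop) (by fun_prop),
      ← II_add (by fun_prop) (by fun_prop)]
    apply II_mono (by fun_prop) (by fun_prop) zero_le_one zero_le_one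
    intro x _ y _
    simp only [one_mul]
    nlinarith [sq_nonneg (16 * (d2 w1 (x, y) + d1 w2 (x, y)) - d1 w2 (x, y)),
      sq_nonneg (d1 w1 (x, y) + d2 w2 (x, y))]
  have n1 : 0 ≤ II (fun z => d1 w1 z ^ 2) 0 1 0 1 :=
    II_nonneg zero_le_one zero_le_one fun z => sq_nonneg _
  have n2 : 0 ≤ II (fun z => d2 w2 z ^ 2) 0 1 0 1 :=
    II_nonneg zero_le_one zero_le_one fun z => sq_nonneg _
  have n3 : 0 ≤ II (fun z => (d2 w1 z + d1 w2 z) ^ 2) 0 1 0 1 :=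
    II_nonneg zero_le_one zero_le_one fun z => sq_nonneg _
  have n4 : 0 ≤ II (fun z => d1 w2 z ^ 2) 0 1 0 1 :=
    II_nonneg zero_le_one zero_le_one fun z => sq_nonneg _
  rw [abs_le] at b12 b21 b22
  obtain ⟨-, b12⟩ := b12
  obtain ⟨-, b21⟩ := b21
  obtain ⟨b22, -⟩ := b22
  rw [hE]
  norm_num at b12 b21 b22
  linarith

end quad

lemma d1_mul {f g : ℝ × ℝ → ℝ} (hf : ContDiff ℝ 1 f) (hg : ContDiff ℝ 1 g) (z : ℝ × ℝ) :
    d1 (fun z => f z * g z) z = d1 f z * g z + f z * d1 g z := by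
  obtain ⟨x, y⟩ := z
  exact d1_eq (hf.mul hg) ((hasDeriv_d1 hf x y).mul (hasDeriv_d1 hg x y))

lemma d2_mul {f g : ℝ × ℝ → ℝ} (hf : ContDiff ℝ 1 f) (hg : ContDiff ℝ 1 g) (z : ℝ × ℝ) :
    d2 (fun z => f z * g z) z = d2 f z * g z + f z * d2 g z := by
  obtain ⟨x, y⟩ := z
  exact d2_eq (hf.mul hg) ((hasDeriv_d2 hf x y).mul (hasDeriv_d2 hg x y))

/-- cutoff -/
def eta (z : ℝ × ℝ) : ℝ := Real.smoothTransition (3 - 4 * z.1) * Real.smoothTransition (3 - 4 * z.2)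

lemma eta_contDiff : ContDiff ℝ 1 eta := by
  unfold eta
  have h : ContDiff ℝ 1 Real.smoothTransition := Real.smoothTransition.contDiff
  exact (h.comp (by fun_prop : ContDiff ℝ 1 fun z : ℝ × ℝ => 3 - 4 * z.1)).mul
    (h.comp (by fun_prop : ContDiff ℝ 1 fun z : ℝ × ℝ => 3 - 4 * z.2))

lemma eta_sq (z : ℝ × ℝ) : eta z ^ 2 ≤ 1 := by
  unfold eta
  have h1 := Real.smoothTransition.nonneg (3 - 4 * z.1)
  have h2 := Real.smoothTransition.nonneg (3 - 4 * z.2)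
  have h3 := Real.smoothTransition.le_one (3 - 4 * z.1)
  have h4 := Real.smoothTransition.le_one (3 - 4 * z.2)
  have : Real.smoothTransition (3 - 4 * z.1) * Real.smoothTransition (3 - 4 * z.2) ≤ 1 := by
    nlinarith
  have h5 := mul_nonneg h1 h2
  nlinarith

lemma eta_zero1 {x y : ℝ} (hx : 3 / 4 ≤ x) : eta (x, y) = 0 := by
  unfold eta
  rw [Real.smoothTransition.zero_of_nonpos (by linarith), zero_mul]

lemma eta_zero2 {x y : ℝ} (hx : 3 / 4 ≤ y) : eta (x, y) = 0 := by
  unfold eta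
  rw [Real.smoothTransition.zero_of_nonpos (x := 3 - 4 * y) (by linarith), mul_zero]

lemma eta_deriv {x y : ℝ} (hx : x ≤ 1 / 2) (hy : y ≤ 1 / 2) : d1 eta (x, y) = 0 := by
  have h0 : ∀ x < 1 / 2, ∀ y ≤ 1 / 2, d1 eta (x, y) = 0 := by
    intro x hx y hy
    apply d1_eq eta_contDiff
    have : (fun s => eta (s, y)) =ᶠ[nhds x] fun _ => 1 := by
      filter_upwards [Iio_mem_nhds hx] with s hs
      unfold eta
      have hs' : s < 1 / 2 := hs
      rw [Real.smoothTransition.one_of_one_le (by linarith),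
        Real.smoothTransition.one_of_one_le (by linarith), one_mul]
    exact (hasDerivAt_const x (1:ℝ)).congr_of_eventuallyEq this
  have hc : Continuous fun s => d1 eta (s, y) := by
    have := cont_d1 eta_contDiff
    fun_prop
  have hcl : IsClosed {s : ℝ | d1 eta (s, y) = 0} := isClosed_eq hc continuous_const
  have : closure (Iio (1 / 2 : ℝ)) ⊆ {s : ℝ | d1 eta (s, y) = 0} :=
    hcl.closure_subset_iff.2 fun s hs => h0 s hs y hy
  rw [closure_Iio] at this
  exact this hx

lemma corner : ∃ C : ℝ, 0 < C ∧ ∀ v1 v2 : ℝ × ℝ → ℝ, ContDiff ℝ 1 v1 → ContDiff ℝ 1 v2 →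
    II (fun z => d1 v2 z ^ 2) 0 (1 / 2) 0 (1 / 2)
      ≤ C * II (fun z => EE v1 v2 z + (v1 z ^ 2 + v2 z ^ 2)) 0 1 0 1 := by
  have hη := eta_contDiff
  have cη := hη.continuous
  have cη1 := cont_d1 hη
  have cη2 := cont_d2 hη
  have hK : IsCompact (Icc (0:ℝ) 1 ×ˢ Icc (0:ℝ) 1) := isCompact_Icc.prod isCompact_Icc
  obtain ⟨M, hM⟩ := hK.exists_bound_of_continuousOn
    (show ContinuousOn (fun z => d1 eta z ^ 2 + d2 eta z ^ 2) _ from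
      Continuous.continuousOn (by fun_prop))
  have hM0 : 0 ≤ M := (norm_nonneg _).trans (hM (0, 0) (by simp))
  refine ⟨50 * (3 + 8 * M), by positivity, fun v1 v2 h1 h2 => ?_⟩
  have c1 := h1.continuous
  have c2 := h2.continuous
  have c11 := cont_d1 h1
  have c21 := cont_d2 h1
  have c12 := cont_d1 h2
  have c22 := cont_d2 h2
  have hw1 : ContDiff ℝ 1 (fun z => eta z * v1 z) := hη.mul h1
  have hw2 : ContDiff ℝ 1 (fun z => eta z * v2 z) := hη.mul h2
  have cw := cont_d1 hw2
  have hq := quad hw1 hw2 (fun x y h => by simp [eta_zero1 h]) (fun x y h => by simp [eta_zero2 h])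
    (fun x y h => by simp [eta_zero1 h]) (fun x y h => by simp [eta_zero2 h])
  have s1 : II (fun z => d1 v2 z ^ 2) 0 (1 / 2) 0 (1 / 2)
      ≤ II (fun z => d1 (fun z => eta z * v2 z) z ^ 2) 0 (1 / 2) 0 (1 / 2) := by
    apply II_mono (by fun_prop) (by fun_prop) (by norm_num) (by norm_num)
    intro x hx y hy
    rw [d1_mul hη h2, eta_deriv hx.2 hy.2]
    have : eta (x, y) = 1 := by
      unfold eta
      have := hx.2
      have := hy.2
      rw [Real.smoothTransition.one_of_one_le (by linarith),
        Real.smoothTransition.one_of_one_le (by linarith), one_mul]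
    rw [this]
    simp
  have s2 := II_mono_set (F := fun z => d1 (fun z => eta z * v2 z) z ^ 2) (by fun_prop)
    (fun z => sq_nonneg _) (b := 1 / 2) (c := 1 / 2) (d := 1) (e := 1)
    (by norm_num) (by norm_num) (by norm_num) (by norm_num)
  have s3 : II (EE (fun z => eta z * v1 z) (fun z => eta z * v2 z)) 0 1 0 1
      ≤ (3 + 8 * M) * II (fun z => EE v1 v2 z + (v1 z ^ 2 + v2 z ^ 2)) 0 1 0 1 := by
    have cE := cont_EE h1 h2
    rw [← II_mul]
    apply II_mono (cont_EE hw1 hw2) (by fun_prop) zero_le_one zero_le_one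
    intro x hx y hy
    have hm := hM (x, y) ⟨hx, hy⟩
    rw [Real.norm_eq_abs] at hm
    have hm := (le_abs_self _).trans hm
    have he := eta_sq (x, y)
    simp only [EE, d1_mul hη h1, d1_mul hη h2, d2_mul hη h1, d2_mul hη h2]
    generalize d1 eta (x, y) = p at *
    generalize d2 eta (x, y) = q at *
    generalize eta (x, y) = t at *
    generalize v1 (x, y) = a at *
    generalize v2 (x, y) = b at *
    generalize d1 v1 (x, y) = A at *
    generalize d2 v2 (x, y) = B at *
    generalize d2 v1 (x, y) = D at *
    generalize d1 v2 (x, y) = E at *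
    have hp : p ^ 2 ≤ M := by nlinarith [sq_nonneg q]
    have hq : q ^ 2 ≤ M := by nlinarith [sq_nonneg p]
    have i1 : (p * a + t * A) ^ 2 ≤ 2 * M * a ^ 2 + 2 * A ^ 2 := by
      have := mul_le_mul_of_nonneg_right hp (sq_nonneg a)
      have := mul_le_mul_of_nonneg_right he (sq_nonneg A)
      nlinarith [sq_nonneg (p * a - t * A)]
    have i2 : (q * b + t * B) ^ 2 ≤ 2 * M * b ^ 2 + 2 * B ^ 2 := by
      have := mul_le_mul_of_nonneg_right hq (sq_nonneg b)
      have := mul_le_mul_of_nonneg_right he (sq_nonneg B)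
      nlinarith [sq_nonneg (q * b - t * B)]
    have i3 : (q * a + t * D + (p * b + t * E)) ^ 2
        ≤ 3 * M * a ^ 2 + 3 * M * b ^ 2 + 3 * (D + E) ^ 2 := by
      have j1 := mul_le_mul_of_nonneg_right hq (sq_nonneg a)
      have j2 := mul_le_mul_of_nonneg_right hp (sq_nonneg b)
      have j3 := mul_le_mul_of_nonneg_right he (sq_nonneg (D + E))
      nlinarith [sq_nonneg (q * a - t * (D + E)), sq_nonneg (q * a - p * b),
        sq_nonneg (p * b - t * (D + E))]
    have n1 : 0 ≤ M * a ^ 2 := by positivity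
    have n2 : 0 ≤ M * b ^ 2 := by positivity
    have n3 : 0 ≤ M * (A ^ 2 + B ^ 2 + (D + E) ^ 2) := by positivity
    nlinarith [sq_nonneg A, sq_nonneg B, sq_nonneg a, sq_nonneg b, sq_nonneg (D + E)]
  calc _ ≤ _ := s1
    _ ≤ _ := s2
    _ ≤ _ := hq
    _ ≤ 50 * ((3 + 8 * M) * II (fun z => EE v1 v2 z + (v1 z ^ 2 + v2 z ^ 2)) 0 1 0 1) := by
      linarith
    _ = _ := by ring

lemma II_symm1 (F : ℝ × ℝ → ℝ) (a b c d : ℝ) : II F b a c d = - II F a b c d := by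
  unfold II
  exact intervalIntegral.integral_symm _ _

lemma II_symm2 (F : ℝ × ℝ → ℝ) (a b c d : ℝ) : II F a b d c = - II F a b c d := by
  unfold II
  rw [← intervalIntegral.integral_neg]
  congr 1; ext x
  exact intervalIntegral.integral_symm _ _

lemma d1_neg (f : ℝ × ℝ → ℝ) (z : ℝ × ℝ) : d1 (fun z => - f z) z = - d1 f z := by
  unfold d1
  rw [fderiv_fun_neg]; rfl

lemma d2_neg (f : ℝ × ℝ → ℝ) (z : ℝ × ℝ) : d2 (fun z => - f z) z = - d2 f z := by
  unfold d2
  rw [fderiv_fun_neg]; rfl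

lemma half1 {C : ℝ} (h : ∀ v1 v2 : ℝ × ℝ → ℝ, ContDiff ℝ 1 v1 → ContDiff ℝ 1 v2 →
    II (fun z => d1 v2 z ^ 2) 0 (1 / 2) 0 (1 / 2)
      ≤ C * II (fun z => EE v1 v2 z + (v1 z ^ 2 + v2 z ^ 2)) 0 1 0 1)
    (v1 v2 : ℝ × ℝ → ℝ) (h1 : ContDiff ℝ 1 v1) (h2 : ContDiff ℝ 1 v2) :
    II (fun z => d1 v2 z ^ 2) 0 1 0 (1 / 2)
      ≤ (2 * C) * II (fun z => EE v1 v2 z + (v1 z ^ 2 + v2 z ^ 2)) 0 1 0 1 := by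
  have c12 := cont_d1 h2
  have h1' : ContDiff ℝ 1 (fun z => - v1 z) := h1.neg
  have k1 := h v1 v2 h1 h2
  have k2 := h _ _ (affine_contDiff h1' (-1) 1 1 0) (affine_contDiff h2 (-1) 1 1 0)
  have e1 : ∀ z, d1 (fun z : ℝ × ℝ => v2 (-1 * z.1 + 1, 1 * z.2 + 0)) z ^ 2
      = (fun z => d1 v2 z ^ 2) (-1 * z.1 + 1, 1 * z.2 + 0) := by
    intro z; rw [d1_affine h2]; ring
  have e2 : ∀ z, EE (fun z : ℝ × ℝ => - v1 (-1 * z.1 + 1, 1 * z.2 + 0))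
        (fun z : ℝ × ℝ => v2 (-1 * z.1 + 1, 1 * z.2 + 0)) z
        + ((- v1 (-1 * z.1 + 1, 1 * z.2 + 0)) ^ 2 + v2 (-1 * z.1 + 1, 1 * z.2 + 0) ^ 2)
      = (fun z => EE v1 v2 z + (v1 z ^ 2 + v2 z ^ 2)) (-1 * z.1 + 1, 1 * z.2 + 0) := by
    intro z
    unfold EE
    rw [d1_affine h2, d2_affine h2, d1_affine h1', d2_affine h1', d1_neg, d2_neg]
    ring
  rw [II_congr e1, II_congr e2, II_affine (fun z => d1 v2 z ^ 2) (p := -1) (q := 1) (by norm_num) (by norm_num),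
    II_affine (fun z => EE v1 v2 z + (v1 z ^ 2 + v2 z ^ 2)) (p := -1) (q := 1) (by norm_num) (by norm_num)] at k2
  norm_num at k2
  rw [II_symm1 _ (1 / 2) 1, II_symm1 _ 0 1] at k2
  have := II_adj1 (F := fun z => d1 v2 z ^ 2) (by fun_prop) 0 (1 / 2) 1 0 (1 / 2)
  linarith

lemma half2 {C : ℝ} (h : ∀ v1 v2 : ℝ × ℝ → ℝ, ContDiff ℝ 1 v1 → ContDiff ℝ 1 v2 →
    II (fun z => d1 v2 z ^ 2) 0 1 0 (1 / 2)
      ≤ C * II (fun z => EE v1 v2 z + (v1 z ^ 2 + v2 z ^ 2)) 0 1 0 1)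
    (v1 v2 : ℝ × ℝ → ℝ) (h1 : ContDiff ℝ 1 v1) (h2 : ContDiff ℝ 1 v2) :
    II (fun z => d1 v2 z ^ 2) 0 1 0 1
      ≤ (2 * C) * II (fun z => EE v1 v2 z + (v1 z ^ 2 + v2 z ^ 2)) 0 1 0 1 := by
  have c12 := cont_d1 h2
  have h2' : ContDiff ℝ 1 (fun z => - v2 z) := h2.neg
  have k1 := h v1 v2 h1 h2
  have k2 := h _ _ (affine_contDiff h1 1 (-1) 0 1) (affine_contDiff h2' 1 (-1) 0 1)
  have e1 : ∀ z, d1 (fun z : ℝ × ℝ => - v2 (1 * z.1 + 0, -1 * z.2 + 1)) z ^ 2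
      = (fun z => d1 v2 z ^ 2) (1 * z.1 + 0, -1 * z.2 + 1) := by
    intro z; rw [d1_affine h2', d1_neg]; ring
  have e2 : ∀ z, EE (fun z : ℝ × ℝ => v1 (1 * z.1 + 0, -1 * z.2 + 1))
        (fun z : ℝ × ℝ => - v2 (1 * z.1 + 0, -1 * z.2 + 1)) z
        + (v1 (1 * z.1 + 0, -1 * z.2 + 1) ^ 2 + (- v2 (1 * z.1 + 0, -1 * z.2 + 1)) ^ 2)
      = (fun z => EE v1 v2 z + (v1 z ^ 2 + v2 z ^ 2)) (1 * z.1 + 0, -1 * z.2 + 1) := by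
    intro z
    unfold EE
    rw [d1_affine h2', d2_affine h2', d1_affine h1, d2_affine h1, d1_neg, d2_neg]
    ring
  rw [II_congr e1, II_congr e2, II_affine (fun z => d1 v2 z ^ 2) (p := 1) (q := -1) (by norm_num) (by norm_num),
    II_affine (fun z => EE v1 v2 z + (v1 z ^ 2 + v2 z ^ 2)) (p := 1) (q := -1) (by norm_num) (by norm_num)] at k2
  norm_num at k2
  rw [II_symm2 _ 0 1 (1 / 2) 1, II_symm2 _ 0 1 0 1] at k2
  have := II_adj2 (F := fun z => d1 v2 z ^ 2) (by fun_prop) 0 1 0 (1 / 2) 1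
  linarith

lemma korn_lower : ∃ C : ℝ, 0 < C ∧ ∀ v1 v2 : ℝ × ℝ → ℝ, ContDiff ℝ 1 v1 → ContDiff ℝ 1 v2 →
    II (fun z => d1 v2 z ^ 2) 0 1 0 1
      ≤ C * II (fun z => EE v1 v2 z + (v1 z ^ 2 + v2 z ^ 2)) 0 1 0 1 := by
  obtain ⟨C, hC, h⟩ := corner
  exact ⟨2 * (2 * C), by positivity, half2 (half1 h)⟩

open Filter Topology in
lemma deriv_A {f : ℝ × ℝ → ℝ} (hf : ContDiff ℝ 1 f) {k : ℝ → ℝ} (hk : Continuous k) (y : ℝ) :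
    HasDerivAt (fun y => ∫ x in (0:ℝ)..1, k x * f (x, y))
      (∫ x in (0:ℝ)..1, k x * d2 f (x, y)) y := by
  have cf := hf.continuous
  rw [hasDerivAt_iff_tendsto_slope]
  have t := tendsto_slope_int hf (k := fun z => k z.1) (by fun_prop) y
  simp only [mul_comm (k _)]
  refine t.congr fun y' => ?_
  simp only [slope_def_field]
  rw [← intervalIntegral.integral_sub, ← intervalIntegral.integral_div]
  · congr 1; ext x; ring
  all_goals exact Continuous.intervalIntegrable (by fun_prop) _ _

lemma ibp_psi {f : ℝ × ℝ → ℝ} (hf : ContDiff ℝ 1 f) (t : ℝ) :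
    ∫ s in (0:ℝ)..1, (6 * s * (1 - s)) * d1 f (s, t)
      = - ∫ s in (0:ℝ)..1, (6 - 12 * s) * f (s, t) := by
  have cf := hf.continuous
  have c1f := cont_d1 hf
  have := intervalIntegral.integral_mul_deriv_eq_deriv_mul_of_hasDerivAt
    (u := fun s : ℝ => 6 * s * (1 - s)) (u' := fun s => 6 - 12 * s)
    (v := fun s => f (s, t)) (v' := fun s => d1 f (s, t))
    (a := 0) (b := 1) (by fun_prop) (by fun_prop)
    (fun x _ => by
      have h := (((hasDerivAt_id x).const_mul 6).fun_mul ((hasDerivAt_id x).const_sub 1))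
      refine h.congr_deriv ?_
      change 6 * 1 * (1 - x) + 6 * x * -1 = 6 - 12 * x
      ring)
    (fun x _ => hasDeriv_d1 hf x t)
    (Continuous.intervalIntegrable (by fun_prop) _ _)
    (Continuous.intervalIntegrable (by fun_prop) _ _)
  rw [this]
  norm_num

lemma int_psi : ∫ s in (0:ℝ)..1, (6 * s * (1 - s)) = 1 := by
  have : ∀ s : ℝ, 6 * s * (1 - s) = 6 * s - 6 * s ^ 2 := by intro s; ring
  simp only [this]
  rw [intervalIntegral.integral_sub, intervalIntegral.integral_const_mul,
    intervalIntegral.integral_const_mul, integral_pow, integral_id]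
  · norm_num
  all_goals exact Continuous.intervalIntegrable (by fun_prop) _ _

lemma psi_sq {s : ℝ} (hs : s ∈ Icc (0:ℝ) 1) : (6 * s * (1 - s)) ^ 2 ≤ 9 / 4 := by
  have h0 : 0 ≤ 6 * s * (1 - s) := by nlinarith [hs.1, hs.2, mul_nonneg hs.1 (sub_nonneg.2 hs.2)]
  have h1 : 6 * s * (1 - s) ≤ 3 / 2 := by nlinarith [sq_nonneg (2 * s - 1)]
  nlinarith

lemma psi'_sq {s : ℝ} (hs : s ∈ Icc (0:ℝ) 1) : (6 - 12 * s) ^ 2 ≤ 36 := by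
  nlinarith [hs.1, hs.2, mul_nonneg hs.1 (sub_nonneg.2 hs.2)]

lemma kp_half {u1 u2 : ℝ × ℝ → ℝ} (h1 : ContDiff ℝ 1 u1) (h2 : ContDiff ℝ 1 u2) :
    ∃ c : ℝ, II (fun z => (u1 z - c - II (fun z => (6 - 12 * z.1) * u2 z) 0 1 0 1 * z.2) ^ 2) 0 1 0 1
      ≤ 144 * II (EE u1 u2) 0 1 0 1 := by
  have c1 := h1.continuous
  have c2 := h2.continuous
  have c11 := cont_d1 h1
  have c21 := cont_d2 h1
  have c12 := cont_d1 h2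
  have c22 := cont_d2 h2
  set k := II (fun z => (6 - 12 * z.1) * u2 z) 0 1 0 1 with hk
  set E1 := II (fun z => d1 u1 z ^ 2) 0 1 0 1 with hE1
  set E2 := II (fun z => d2 u2 z ^ 2) 0 1 0 1 with hE2
  set G := II (fun z => (d2 u1 z + d1 u2 z) ^ 2) 0 1 0 1 with hG
  have hE : II (EE u1 u2) 0 1 0 1 = E1 + E2 + G := by
    rw [hE1, hE2, hG, ← II_add (by fun_prop) (by fun_prop), ← II_add (by fun_prop) (by fun_prop)]
    rfl
  have nE1 : 0 ≤ E1 := II_nonneg zero_le_one zero_le_one fun z => sq_nonneg _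
  have nE2 : 0 ≤ E2 := II_nonneg zero_le_one zero_le_one fun z => sq_nonneg _
  have nG : 0 ≤ G := II_nonneg zero_le_one zero_le_one fun z => sq_nonneg _
  let A : ℝ → ℝ := fun y => ∫ s in (0:ℝ)..1, (6 * s * (1 - s)) * u1 (s, y)
  let P : ℝ → ℝ := fun y => ∫ s in (0:ℝ)..1, d1 u1 (s, y) ^ 2
  let Q : ℝ → ℝ := fun x => ∫ t in (0:ℝ)..1, d2 u2 (x, t) ^ 2
  let Γ : ℝ → ℝ := fun t => ∫ s in (0:ℝ)..1, (d2 u1 (s, t) + d1 u2 (s, t)) ^ 2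
  let M : ℝ → ℝ := fun t => (∫ s in (0:ℝ)..1, (6 * s * (1 - s)) * d2 u1 (s, t)) - k
  have cP : Continuous P := cont_inner (F := fun z => d1 u1 (z.2, z.1) ^ 2) (by fun_prop) 0 1
  have cQ : Continuous Q := cont_inner (F := fun z => d2 u2 (z.1, z.2) ^ 2) (by fun_prop) 0 1
  have cΓ : Continuous Γ := cont_inner
    (F := fun z => (d2 u1 (z.2, z.1) + d1 u2 (z.2, z.1)) ^ 2) (by fun_prop) 0 1
  have cM0 : Continuous (fun t => ∫ s in (0:ℝ)..1, (6 * s * (1 - s)) * d2 u1 (s, t)) :=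
    cont_inner (F := fun z => (6 * z.2 * (1 - z.2)) * d2 u1 (z.2, z.1)) (by fun_prop) 0 1
  have cM : Continuous M := cM0.sub continuous_const
  have iP : ∫ y in (0:ℝ)..1, P y = E1 := by
    rw [hE1, II_swap (by fun_prop)]; rfl
  have iQ : ∫ y in (0:ℝ)..1, Q y = E2 := rfl
  have iΓ : ∫ y in (0:ℝ)..1, Γ y = G := by
    rw [hG, II_swap (by fun_prop)]; rfl
  -- bound on M
  have bM : ∀ t ∈ Icc (0:ℝ) 1, M t ^ 2 ≤ 9 / 2 * Γ t + 72 * E2 := by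
    intro t ht
    have m1 : M t = (∫ s in (0:ℝ)..1, (6 * s * (1 - s)) * (d2 u1 (s, t) + d1 u2 (s, t)))
        + II (fun z => (6 - 12 * z.1) * (u2 (z.1, t) - u2 z)) 0 1 0 1 := by
      have a1 : II (fun z => (6 - 12 * z.1) * (u2 (z.1, t) - u2 z)) 0 1 0 1
          = (∫ s in (0:ℝ)..1, (6 - 12 * s) * u2 (s, t)) - k := by
        have : II (fun z => (6 - 12 * z.1) * u2 (z.1, t)) 0 1 0 1
            = ∫ s in (0:ℝ)..1, (6 - 12 * s) * u2 (s, t) := by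
          unfold II; simp
        rw [hk, ← this, ← II_sub (by fun_prop) (by fun_prop)]
        apply II_congr; intro z; ring
      have a2 : (∫ s in (0:ℝ)..1, (6 * s * (1 - s)) * (d2 u1 (s, t) + d1 u2 (s, t)))
          = (∫ s in (0:ℝ)..1, (6 * s * (1 - s)) * d2 u1 (s, t))
            - ∫ s in (0:ℝ)..1, (6 - 12 * s) * u2 (s, t) := by
        rw [sub_eq_add_neg, ← ibp_psi h2 t, ← intervalIntegral.integral_add]
        · congr 1; ext s; ring
        all_goals exact Continuous.intervalIntegrable (by fun_prop) _ _
      rw [a1, a2]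
      simp only [M]
      ring
    have m2 : (∫ s in (0:ℝ)..1, (6 * s * (1 - s)) * (d2 u1 (s, t) + d1 u2 (s, t))) ^ 2
        ≤ 9 / 4 * Γ t := by
      refine (cs (by fun_prop) zero_le_one).trans ?_
      rw [sub_zero, one_mul, ← intervalIntegral.integral_const_mul]
      apply intervalIntegral.integral_mono_on zero_le_one
        (Continuous.intervalIntegrable (by fun_prop) _ _)
        (Continuous.intervalIntegrable (by fun_prop) _ _)
      intro s hs
      rw [mul_pow]
      exact mul_le_mul_of_nonneg_right (psi_sq hs) (sq_nonneg _)
    have m3 : (II (fun z => (6 - 12 * z.1) * (u2 (z.1, t) - u2 z)) 0 1 0 1) ^ 2 ≤ 36 * E2 := by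
      refine (II_cs (by fun_prop)).trans ?_
      have : II (fun z => 36 * Q z.1) 0 1 0 1 = 36 * E2 := by
        rw [II_mul, ← iQ]; congr 1; unfold II; simp
      rw [← this]
      apply II_mono (by fun_prop) (by fun_prop) zero_le_one zero_le_one
      intro x hx y hy
      rw [mul_pow]
      apply mul_le_mul (psi'_sq hx) _ (sq_nonneg _) (by norm_num)
      exact sq_diff (f := fun s => u2 (x, s)) (fun s => hasDeriv_d2 h2 x s) (by fun_prop) ht hy
    rw [m1]
    nlinarith [sq_nonneg ((∫ s in (0:ℝ)..1, (6 * s * (1 - s)) * (d2 u1 (s, t) + d1 u2 (s, t)))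
        - II (fun z => (6 - 12 * z.1) * (u2 (z.1, t) - u2 z)) 0 1 0 1)]
  have iM : ∫ t in (0:ℝ)..1, M t ^ 2 ≤ 9 / 2 * G + 72 * E2 := by
    have : ∫ t in (0:ℝ)..1, (9 / 2 * Γ t + 72 * E2) = 9 / 2 * G + 72 * E2 := by
      rw [intervalIntegral.integral_add, intervalIntegral.integral_const_mul, iΓ]
      · simp
      all_goals exact Continuous.intervalIntegrable (by fun_prop) _ _
    rw [← this]
    exact intervalIntegral.integral_mono_on zero_le_one
        (Continuous.intervalIntegrable (by fun_prop) _ _)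
        (Continuous.intervalIntegrable (by fun_prop) _ _) bM
  have bA : ∀ y ∈ Icc (0:ℝ) 1, (A y - A 0 - k * y) ^ 2 ≤ 9 / 2 * G + 72 * E2 := by
    intro y hy
    have hd : ∀ t, HasDerivAt (fun y => A y - k * y) (M t) t := by
      intro t
      have := (deriv_A h1 (k := fun s => 6 * s * (1 - s)) (by fun_prop) t).fun_sub
        ((hasDerivAt_id t).const_mul k)
      simpa [M, A] using this
    have := sq_diff hd cM hy (s := 0) (by simp)
    have e : A y - k * y - (A 0 - k * 0) = A y - A 0 - k * y := by ring
    rw [e] at this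
    exact this.trans iM
  have bU : ∀ x ∈ Icc (0:ℝ) 1, ∀ y, (u1 (x, y) - A y) ^ 2 ≤ 9 / 4 * P y := by
    intro x hx y
    have e : u1 (x, y) - A y = ∫ s in (0:ℝ)..1, (6 * s * (1 - s)) * (u1 (x, y) - u1 (s, y)) := by
      have : ∀ s, (6 * s * (1 - s)) * (u1 (x, y) - u1 (s, y))
        = (6 * s * (1 - s)) * u1 (x, y) - (6 * s * (1 - s)) * u1 (s, y) := by intro s; ring
      simp only [this]
      rw [intervalIntegral.integral_sub, intervalIntegral.integral_mul_const, int_psi, one_mul]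
      all_goals exact Continuous.intervalIntegrable (by fun_prop) _ _
    rw [e]
    refine (cs (by fun_prop) zero_le_one).trans ?_
    rw [sub_zero, one_mul]
    have : ∫ s in (0:ℝ)..1, 9 / 4 * P y = 9 / 4 * P y := by simp
    rw [← this]
    apply intervalIntegral.integral_mono_on zero_le_one
      (Continuous.intervalIntegrable (by fun_prop) _ _)
      (Continuous.intervalIntegrable (by fun_prop) _ _)
    intro s hs
    rw [mul_pow]
    apply mul_le_mul (psi_sq hs) _ (sq_nonneg _) (by norm_num)
    exact sq_diff (f := fun s => u1 (s, y)) (fun s => hasDeriv_d1 h1 s y) (by fun_prop) hx hs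
  refine ⟨A 0, ?_⟩
  have : II (fun z => 9 / 2 * P z.2 + 2 * (9 / 2 * G + 72 * E2)) 0 1 0 1
      = 9 / 2 * E1 + 2 * (9 / 2 * G + 72 * E2) := by
    rw [II_add (by fun_prop) (by fun_prop), II_mul, II_const, ← iP]
    unfold II
    simp
  refine (II_mono (by fun_prop) (by fun_prop) zero_le_one zero_le_one ?_).trans
    (this.le.trans ?_)
  · intro x hx y hy
    have p1 := bU x hx y
    have p2 := bA y hy
    simp only
    nlinarith [sq_nonneg ((u1 (x, y) - A y) - (A y - A 0 - k * y))]
  · rw [hE]; linarith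

lemma d1_swap {f : ℝ × ℝ → ℝ} (hf : ContDiff ℝ 1 f) (z : ℝ × ℝ) :
    d1 (fun z : ℝ × ℝ => f (z.2, z.1)) z = d2 f (z.2, z.1) := by
  obtain ⟨x, y⟩ := z
  exact d1_eq (by fun_prop) (hasDeriv_d2 hf y x)

lemma d2_swap {f : ℝ × ℝ → ℝ} (hf : ContDiff ℝ 1 f) (z : ℝ × ℝ) :
    d2 (fun z : ℝ × ℝ => f (z.2, z.1)) z = d1 f (z.2, z.1) := by
  obtain ⟨x, y⟩ := z
  exact d2_eq (by fun_prop) (hasDeriv_d1 hf y x)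

lemma kp {u1 u2 : ℝ × ℝ → ℝ} (h1 : ContDiff ℝ 1 u1) (h2 : ContDiff ℝ 1 u2) :
    ∃ c c' k : ℝ, II (fun z => (u1 z - c - k * z.2) ^ 2 + (u2 z - c' + k * z.1) ^ 2) 0 1 0 1
      ≤ 12000 * II (EE u1 u2) 0 1 0 1 := by
  have c1 := h1.continuous
  have c2 := h2.continuous
  have cE := cont_EE h1 h2
  obtain ⟨c, hc⟩ := kp_half h1 h2
  have h1s : ContDiff ℝ 1 (fun z : ℝ × ℝ => u1 (z.2, z.1)) := by fun_prop
  have h2s : ContDiff ℝ 1 (fun z : ℝ × ℝ => u2 (z.2, z.1)) := by fun_prop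
  obtain ⟨c', hc'⟩ := kp_half h2s h1s
  have eE : II (EE (fun z : ℝ × ℝ => u2 (z.2, z.1)) (fun z : ℝ × ℝ => u1 (z.2, z.1))) 0 1 0 1
      = II (EE u1 u2) 0 1 0 1 := by
    rw [II_swap cE]
    apply II_congr
    intro z
    unfold EE
    rw [d1_swap h2, d2_swap h2, d1_swap h1, d2_swap h1]
    ring
  rw [eE] at hc'
  set k := II (fun z => (6 - 12 * z.1) * u2 z) 0 1 0 1 with hk
  set k' := II (fun z : ℝ × ℝ => (6 - 12 * z.1) * u1 (z.2, z.1)) 0 1 0 1 with hk'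
  rw [II_swap (by fun_prop)] at hc'
  simp only at hc'
  set E := II (EE u1 u2) 0 1 0 1 with hE
  have ekk : k' + k = II (fun z => (6 - 12 * z.2) * (u1 z - c - k * z.2)) 0 1 0 1 := by
    have a1 : k' = II (fun z => (6 - 12 * z.2) * u1 z) 0 1 0 1 := by
      rw [II_swap (by fun_prop)]
    have a2 : II (fun z : ℝ × ℝ => (6 - 12 * z.2) * (c + k * z.2)) 0 1 0 1 = -k := by
      unfold II
      have : ∀ y : ℝ, (6 - 12 * y) * (c + k * y) = (6 * c) + (6 * k - 12 * c) * y - (12 * k) * y ^ 2 := by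
        intro y; ring
      simp only [this]
      rw [intervalIntegral.integral_const, intervalIntegral.integral_sub,
        intervalIntegral.integral_add, intervalIntegral.integral_const]
      · rw [intervalIntegral.integral_const_mul (6 * k - 12 * c) (fun y : ℝ => y),
          intervalIntegral.integral_const_mul (12 * k) (fun y : ℝ => y ^ 2), integral_pow, integral_id]
        norm_num; ring
      all_goals exact Continuous.intervalIntegrable (by fun_prop) _ _
    have : II (fun z => (6 - 12 * z.2) * (u1 z - c - k * z.2)) 0 1 0 1
        = k' - II (fun z : ℝ × ℝ => (6 - 12 * z.2) * (c + k * z.2)) 0 1 0 1 := by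
      rw [a1, ← II_sub (by fun_prop) (by fun_prop)]
      apply II_congr; intro z; ring
    rw [this, a2]; ring
  have hkk : (k' + k) ^ 2 ≤ 36 * (144 * E) := by
    rw [ekk]
    refine (II_cs (by fun_prop)).trans ?_
    refine le_trans ?_ (mul_le_mul_of_nonneg_left hc (by norm_num))
    rw [← II_mul]
    apply II_mono (by fun_prop) (by fun_prop) zero_le_one zero_le_one
    intro x _ y hy
    simp only
    rw [mul_pow]
    exact mul_le_mul_of_nonneg_right (psi'_sq hy) (sq_nonneg _)
  refine ⟨c, c', k, ?_⟩
  have nE : 0 ≤ E := II_nonneg zero_le_one zero_le_one (EE_nonneg _ _)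
  have : II (fun z => (u1 z - c - k * z.2) ^ 2 + (u2 z - c' + k * z.1) ^ 2) 0 1 0 1
      ≤ II (fun z => (u1 z - c - k * z.2) ^ 2) 0 1 0 1
        + 2 * II (fun z => (u2 z - c' - k' * z.1) ^ 2) 0 1 0 1 + 2 * (k' + k) ^ 2 := by
    have e : (2 * (k' + k) ^ 2) = II (fun _ => 2 * (k' + k) ^ 2) 0 1 0 1 := by
      rw [II_const]; ring
    rw [e, ← II_mul, ← II_add (by fun_prop) (by fun_prop), ← II_add (by fun_prop) (by fun_prop)]
    apply II_mono (by fun_prop) (by fun_prop) zero_le_one zero_le_one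
    intro x hx y _
    simp only
    have hx2 : x ^ 2 ≤ 1 := by nlinarith [hx.1, hx.2]
    have := mul_le_mul_of_nonneg_left hx2 (sq_nonneg (k' + k))
    nlinarith [sq_nonneg ((u2 (x, y) - c' - k' * x) - (k' + k) * x)]
  linarith

lemma korn_square : ∃ C : ℝ, 0 < C ∧ ∀ u1 u2 : ℝ × ℝ → ℝ, ContDiff ℝ 1 u1 → ContDiff ℝ 1 u2 →
    ∃ b : ℝ, II (fun z => (d1 u2 z - b) ^ 2) 0 1 0 1 ≤ C * II (EE u1 u2) 0 1 0 1 := by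
  obtain ⟨C, hC, h⟩ := korn_lower
  refine ⟨C * 12001, by positivity, fun u1 u2 h1 h2 => ?_⟩
  obtain ⟨c, c', k, hk⟩ := kp h1 h2
  have c1 := h1.continuous
  have c2 := h2.continuous
  have cE := cont_EE h1 h2
  have h1' : ContDiff ℝ 1 (fun z => u1 z - c - k * z.2) := by fun_prop
  have h2' : ContDiff ℝ 1 (fun z => u2 z - c' + k * z.1) := by fun_prop
  have e11 : ∀ z, d1 (fun z => u1 z - c - k * z.2) z = d1 u1 z := by
    rintro ⟨x, y⟩
    exact d1_eq h1' (((hasDeriv_d1 h1 x y).sub_const c).sub_const (k * y))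
  have e22 : ∀ z, d2 (fun z => u2 z - c' + k * z.1) z = d2 u2 z := by
    rintro ⟨x, y⟩
    exact d2_eq h2' (((hasDeriv_d2 h2 x y).sub_const c').add_const (k * x))
  have e21 : ∀ z, d2 (fun z => u1 z - c - k * z.2) z = d2 u1 z - k := by
    rintro ⟨x, y⟩
    apply d2_eq h1'
    have := ((hasDeriv_d2 h1 x y).sub_const c).fun_sub ((hasDerivAt_id y).const_mul k)
    simpa using this
  have e12 : ∀ z, d1 (fun z => u2 z - c' + k * z.1) z = d1 u2 z + k := by
    rintro ⟨x, y⟩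
    apply d1_eq h2'
    have := ((hasDeriv_d1 h2 x y).sub_const c').fun_add ((hasDerivAt_id x).const_mul k)
    simpa using this
  have eE : ∀ z, EE (fun z => u1 z - c - k * z.2) (fun z => u2 z - c' + k * z.1) z = EE u1 u2 z := by
    intro z
    unfold EE
    rw [e11, e22, e21, e12]; ring
  have := h _ _ h1' h2'
  simp only [eE, e12] at this
  rw [II_add cE (by fun_prop)] at this
  refine ⟨-k, ?_⟩
  simp only [sub_neg_eq_add]
  refine this.trans ?_
  rw [mul_assoc]
  apply mul_le_mul_of_nonneg_left _ hC.le
  linarith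

lemma d1_cmul {f : ℝ × ℝ → ℝ} (hf : ContDiff ℝ 1 f) (k : ℝ) (z : ℝ × ℝ) :
    d1 (fun z => k * f z) z = k * d1 f z := by
  obtain ⟨x, y⟩ := z
  exact d1_eq (by fun_prop) ((hasDeriv_d1 hf x y).const_mul k)

lemma d2_cmul {f : ℝ × ℝ → ℝ} (hf : ContDiff ℝ 1 f) (k : ℝ) (z : ℝ × ℝ) :
    d2 (fun z => k * f z) z = k * d2 f z := by
  obtain ⟨x, y⟩ := z
  exact d2_eq (by fun_prop) ((hasDeriv_d2 hf x y).const_mul k)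

lemma korn_rect : ∃ C : ℝ, 0 < C ∧ ∀ u1 u2 : ℝ × ℝ → ℝ, ContDiff ℝ 1 u1 → ContDiff ℝ 1 u2 →
    ∀ a b c h : ℝ, 0 < h → h ≤ b → b ≤ 2 * h →
    ∃ β : ℝ, II (fun z => (d1 u2 z - β) ^ 2) a (a + b) c (c + h)
      ≤ C * II (EE u1 u2) a (a + b) c (c + h) := by
  obtain ⟨C, hC, hk⟩ := korn_square
  refine ⟨C * 4, by positivity, fun u1 u2 h1 h2 a b c h hh hhb hbh => ?_⟩
  have hb : 0 < b := by linarith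
  have h1' : ContDiff ℝ 1 (fun z => b * u1 z) := by fun_prop
  have h2' : ContDiff ℝ 1 (fun z => h * u2 z) := by fun_prop
  have w1 := affine_contDiff h1' b h a c
  have w2 := affine_contDiff h2' b h a c
  have c12 := cont_d1 h2
  have cE := cont_EE h1 h2
  have cE' := cont_EE w1 w2
  obtain ⟨β, hβ⟩ := hk _ _ w1 w2
  refine ⟨β / (b * h), ?_⟩
  have e1 : ∀ z : ℝ × ℝ, (d1 (fun z : ℝ × ℝ => h * u2 (b * z.1 + a, h * z.2 + c)) z - β) ^ 2
      = (fun z => (b * h) ^ 2 * (d1 u2 z - β / (b * h)) ^ 2) (b * z.1 + a, h * z.2 + c) := by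
    intro z
    rw [d1_affine h2', d1_cmul h2]
    field_simp
  have e2 : ∀ z : ℝ × ℝ, EE (fun z : ℝ × ℝ => b * u1 (b * z.1 + a, h * z.2 + c))
        (fun z : ℝ × ℝ => h * u2 (b * z.1 + a, h * z.2 + c)) z
      ≤ (fun z => ((b * h) ^ 2 * 4) * EE u1 u2 z) (b * z.1 + a, h * z.2 + c) := by
    intro z
    unfold EE
    rw [d1_affine h2', d1_cmul h2, d2_affine h2', d2_cmul h2, d1_affine h1', d1_cmul h1,
      d2_affine h1', d2_cmul h1]
    simp only
    generalize d1 u1 _ = p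
    generalize d2 u2 _ = q
    generalize d2 u1 _ = r
    generalize d1 u2 _ = s
    have k1 : b ^ 2 * b ^ 2 ≤ b ^ 2 * (4 * h ^ 2) :=
      mul_le_mul_of_nonneg_left (by nlinarith) (by positivity)
    have k2 : h ^ 2 * h ^ 2 ≤ h ^ 2 * (4 * b ^ 2) :=
      mul_le_mul_of_nonneg_left (by nlinarith) (by positivity)
    have k3 := mul_le_mul_of_nonneg_right k1 (sq_nonneg p)
    have k4 := mul_le_mul_of_nonneg_right k2 (sq_nonneg q)
    have k5 : 0 ≤ (b * h) ^ 2 * (r + s) ^ 2 := by positivity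
    nlinarith
  have e3 := II_mono (F := EE (fun z : ℝ × ℝ => b * u1 (b * z.1 + a, h * z.2 + c))
        (fun z : ℝ × ℝ => h * u2 (b * z.1 + a, h * z.2 + c)))
      (G := fun z : ℝ × ℝ => (fun z => ((b * h) ^ 2 * 4) * EE u1 u2 z) (b * z.1 + a, h * z.2 + c))
      cE' (by fun_prop) zero_le_one zero_le_one (fun x _ y _ => e2 (x, y))
  rw [II_congr e1] at hβ
  have e4 := hβ.trans (mul_le_mul_of_nonneg_left e3 hC.le)
  rw [II_affine (fun z => (b * h) ^ 2 * (d1 u2 z - β / (b * h)) ^ 2) hb.ne' hh.ne',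
    II_affine (fun z => ((b * h) ^ 2 * 4) * EE u1 u2 z) hb.ne' hh.ne', II_mul, II_mul] at e4
  have q1 : b * 0 + a = a := by ring
  have q2 : b * 1 + a = a + b := by ring
  have q3 : h * 0 + c = c := by ring
  have q4 : h * 1 + c = c + h := by ring
  rw [q1, q2, q3, q4] at e4
  have hbh' : 0 < b * h := by positivity
  generalize II _ a (a + b) c (c + h) = X at *
  generalize II _ a (a + b) c (c + h) = Y at *
  have e5 : b⁻¹ * (h⁻¹ * ((b * h) ^ 2 * X)) = (b * h) * X := by field_simp
  have e6 : C * (b⁻¹ * (h⁻¹ * ((b * h) ^ 2 * 4 * Y))) = (b * h) * (C * 4 * Y) := by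
    field_simp
  rw [e5, e6] at e4
  exact le_of_mul_le_mul_left e4 hbh'

lemma sq_sum_bound (δ : ℕ → ℝ) (b : ℕ → ℝ) (m T : ℝ) (hm : 0 ≤ m) (n : ℕ)
    (hδ : ∀ k, k + 1 < n → m * (b (k + 1) - b k) ^ 2 ≤ δ k) (h0 : ∀ k, 0 ≤ δ k)
    (hT : ∑ k ∈ Finset.range (n - 1), δ k ≤ T) (k : ℕ) (hk : k < n) :
    m * (b k - b 0) ^ 2 ≤ n * T := by
  have e : b k - b 0 = ∑ j ∈ Finset.range k, (b (j + 1) - b j) := by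
    rw [Finset.sum_range_sub]
  have c := sq_sum_le_card_mul_sum_sq (s := Finset.range k) (f := fun j => b (j + 1) - b j)
  rw [Finset.card_range] at c
  rw [e]
  have h1 : m * ∑ j ∈ Finset.range k, (b (j + 1) - b j) ^ 2 ≤ T := by
    rw [Finset.mul_sum]
    refine le_trans (Finset.sum_le_sum (fun j hj => hδ j ?_)) (le_trans ?_ hT)
    · have := Finset.mem_range.1 hj; omega
    · apply Finset.sum_le_sum_of_subset_of_nonneg
      · intro j hj
        have := Finset.mem_range.1 hj
        exact Finset.mem_range.2 (by omega)
      · intro j _ _; exact h0 j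
  have hT0 : 0 ≤ T := le_trans (Finset.sum_nonneg fun j _ => h0 j) hT
  calc m * (∑ j ∈ Finset.range k, (b (j + 1) - b j)) ^ 2
      ≤ m * (k * ∑ j ∈ Finset.range k, (b (j + 1) - b j) ^ 2) := mul_le_mul_of_nonneg_left c hm
    _ = k * (m * ∑ j ∈ Finset.range k, (b (j + 1) - b j) ^ 2) := by ring
    _ ≤ k * T := mul_le_mul_of_nonneg_left h1 (Nat.cast_nonneg k)
    _ ≤ n * T := mul_le_mul_of_nonneg_right (by exact_mod_cast hk.le) hT0

/-- abstract telescoping estimate: cells `0,…,n+1`, double cells `0,…,n`. -/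
lemma telescope (V : ℕ → ℝ → ℝ) (E : ℕ → ℝ) (b : ℕ → ℝ) (m C : ℝ) (n : ℕ)
    (hm : 0 ≤ m) (hC : 0 ≤ C) (hE : ∀ k, 0 ≤ E k) (hV0 : ∀ k β, 0 ≤ V k β)
    (hV : ∀ k β γ, V k γ ≤ 2 * V k β + 2 * (m * (β - γ) ^ 2))
    (hm' : ∀ k β γ, m * (β - γ) ^ 2 ≤ 2 * V k β + 2 * V k γ)
    (hb : ∀ k ≤ n, V k (b k) + V (k + 1) (b k) ≤ C * (E k + E (k + 1))) :
    ∑ k ∈ Finset.range (n + 2), V k (b 0)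
      ≤ 40 * C * (n + 2) ^ 2 * ∑ k ∈ Finset.range (n + 2), E k := by
  set S := ∑ k ∈ Finset.range (n + 2), E k with hS
  have hS0 : 0 ≤ S := Finset.sum_nonneg fun j _ => hE j
  have le1 : ∀ k < n + 2, E k ≤ S := fun k hk =>
    Finset.single_le_sum (f := E) (fun j _ => hE j) (Finset.mem_range.2 hk)
  have sh : ∀ i j, i + j ≤ n + 2 → ∑ k ∈ Finset.range j, E (k + i) ≤ S := by
    intro i j hij
    rw [Finset.range_eq_Ico, Finset.sum_Ico_add' E 0 j i]
    apply Finset.sum_le_sum_of_subset_of_nonneg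
    · intro k hk
      have := Finset.mem_Ico.1 hk
      exact Finset.mem_range.2 (by omega)
    · intro k _ _; exact hE k
  have hδ : ∀ k, k + 1 < n + 1 →
      m * (b (k + 1) - b k) ^ 2 ≤ 2 * C * (E k + 2 * E (k + 1) + E (k + 2)) := by
    intro k hk
    have a1 := hb k (by omega)
    have a2 := hb (k + 1) (by omega)
    have a3 := hm' (k + 1) (b (k + 1)) (b k)
    have a4 := hV0 k (b k)
    have a5 := hV0 (k + 1 + 1) (b (k + 1))
    have e : k + 1 + 1 = k + 2 := rfl
    rw [e] at *
    nlinarith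
  have key := sq_sum_bound (fun k => 2 * C * (E k + 2 * E (k + 1) + E (k + 2))) b m
    (8 * C * S) hm (n + 1) hδ
    (fun k => by have := hE k; have := hE (k + 1); have := hE (k + 2); positivity)
    (by
      have s0 := sh 0 n (by omega)
      have s1 := sh 1 n (by omega)
      have s2 := sh 2 n (by omega)
      rw [← Finset.mul_sum]
      simp only [Finset.sum_add_distrib, ← Finset.mul_sum, Nat.add_sub_cancel]
      have : 8 * C * S = 2 * C * (S + 2 * S + S) := by ring
      rw [this]
      apply mul_le_mul_of_nonneg_left _ (by positivity)
      simp only [add_zero] at s0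
      linarith)
  have hn : (0 : ℝ) ≤ n := Nat.cast_nonneg n
  have each : ∀ k ∈ Finset.range (n + 2), V k (b 0) ≤ 40 * C * (n + 2) * S := by
    intro k hk
    have hk := Finset.mem_range.1 hk
    obtain ⟨j, hj, h1⟩ : ∃ j < n + 1, V k (b j) ≤ C * (S + S) := by
      by_cases hkn : k ≤ n
      · refine ⟨k, by omega, ?_⟩
        have a1 := hb k hkn
        have a2 := hV0 (k + 1) (b k)
        have := mul_le_mul_of_nonneg_left (add_le_add (le1 k (by omega)) (le1 (k + 1) (by omega))) hC
        linarith
      · obtain rfl : k = n + 1 := by omega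
        refine ⟨n, by omega, ?_⟩
        have a1 := hb n le_rfl
        have a2 := hV0 n (b n)
        have := mul_le_mul_of_nonneg_left (add_le_add (le1 n (by omega)) (le1 (n + 1) (by omega))) hC
        linarith
    have h2 := key j hj
    have h3 := hV k (b j) (b 0)
    push_cast at h2
    have hCS : 0 ≤ C * S := by positivity
    have := mul_nonneg hn hCS
    nlinarith
  refine (Finset.sum_le_card_nsmul _ _ _ each).trans ?_
  rw [Finset.card_range, nsmul_eq_mul]
  push_cast
  apply le_of_eq; ring
lemma II_cells {F : ℝ × ℝ → ℝ} (hF : Continuous F) (x : ℕ → ℝ) (c d : ℝ) (n : ℕ) :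
    ∑ k ∈ Finset.range n, II F (x k) (x (k + 1)) c d = II F (x 0) (x n) c d := by
  induction n with
  | zero => simp [II]
  | succ k ih => rw [Finset.sum_range_succ, ih, II_adj1 hF]

lemma korn_strip : ∃ C : ℝ, 0 < C ∧ ∀ L h : ℝ, 0 < h → h ≤ L →
    ∀ u1 u2 : ℝ × ℝ → ℝ, ContDiff ℝ 1 u1 → ContDiff ℝ 1 u2 →
    ∃ β : ℝ, II (fun z => (d1 u2 z - β) ^ 2) (-L) L (-(h / 2)) (h / 2)
      ≤ C * (L / h) ^ 2 * II (EE u1 u2) (-L) L (-(h / 2)) (h / 2) := by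
  obtain ⟨C, hC, hk⟩ := korn_rect
  refine ⟨360 * C, by positivity, fun L h hh hL u1 u2 h1 h2 => ?_⟩
  have c12 := cont_d1 h2
  have cE := cont_EE h1 h2
  have hL0 : 0 < L := by linarith
  have hLh : 1 ≤ L / h := (one_le_div hh).2 hL
  have hN1 : 2 * (L / h) ≤ ⌈2 * (L / h)⌉₊ := Nat.le_ceil _
  have hN2 : (⌈2 * (L / h)⌉₊ : ℝ) < 2 * (L / h) + 1 := Nat.ceil_lt_add_one (by positivity)
  have hN3 : 2 ≤ ⌈2 * (L / h)⌉₊ := by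
    have : (2 : ℝ) ≤ (⌈2 * (L / h)⌉₊ : ℝ) := by linarith
    exact_mod_cast this
  obtain ⟨n, hn⟩ : ∃ n, ⌈2 * (L / h)⌉₊ = n + 2 := ⟨_, (Nat.sub_add_cancel hN3).symm⟩
  rw [hn] at hN1 hN2
  push_cast at hN1 hN2
  set N : ℝ := (n : ℝ) + 2 with hNdef
  have hN0 : 0 < N := by positivity
  set l := 2 * L / N with hl
  have hNl : N * l = 2 * L := by rw [hl]; field_simp
  have hl0 : 0 < l := by positivity
  have eLh : (L / h) * h = L := by field_simp
  have hlh : l ≤ h := by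
    rw [hl, div_le_iff₀ hN0]; nlinarith
  have hhl : h ≤ 2 * l := by
    have : h * N ≤ 2 * l * N := by nlinarith
    exact le_of_mul_le_mul_right this hN0
  let x : ℕ → ℝ := fun k => -L + k * l
  have hx : ∀ k, x (k + 1) = x k + l := by intro k; simp only [x]; push_cast; ring
  have hx2 : ∀ k, x k + 2 * l = x (k + 1 + 1) := by intro k; rw [hx, hx]; ring
  have hx0 : x 0 = -L := by simp [x]
  have hxN : x (n + 2) = L := by
    have : x (n + 2) = -L + N * l := by simp [x, hNdef]
    rw [this, hNl]; ring
  have hle : ∀ k, x k ≤ x (k + 1) := by intro k; rw [hx]; linarith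
  have hcd : -(h / 2) ≤ h / 2 := by linarith
  choose b hb using fun k : ℕ => hk u1 u2 h1 h2 (x k) (2 * l) (-(h / 2)) h hh hhl (by linarith)
  have q : -(h / 2) + h = h / 2 := by ring
  simp only [q, hx2] at hb
  refine ⟨b 0, ?_⟩
  have T := telescope (fun k β => II (fun z => (d1 u2 z - β) ^ 2) (x k) (x (k + 1)) (-(h / 2)) (h / 2))
    (fun k => II (EE u1 u2) (x k) (x (k + 1)) (-(h / 2)) (h / 2)) b (l * h) C n (by positivity) hC.le
    (fun k => II_nonneg (hle k) hcd (EE_nonneg _ _))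
    (fun k β => II_nonneg (hle k) hcd (fun z => sq_nonneg _))
    (by
      intro k β γ
      have e : l * h * (β - γ) ^ 2
          = II (fun _ => (β - γ) ^ 2) (x k) (x (k + 1)) (-(h / 2)) (h / 2) := by
        rw [II_const, hx]; ring
      rw [e, ← II_mul, ← II_mul, ← II_add (by fun_prop) (by fun_prop)]
      apply II_mono (by fun_prop) (by fun_prop) (hle k) hcd
      intro s _ t _
      nlinarith [sq_nonneg ((d1 u2 (s, t) - β) - (β - γ))])
    (by
      intro k β γ
      have e : l * h * (β - γ) ^ 2
          = II (fun _ => (β - γ) ^ 2) (x k) (x (k + 1)) (-(h / 2)) (h / 2) := by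
        rw [II_const, hx]; ring
      rw [e, ← II_mul, ← II_mul, ← II_add (by fun_prop) (by fun_prop)]
      apply II_mono (by fun_prop) (by fun_prop) (hle k) hcd
      intro s _ t _
      nlinarith [sq_nonneg ((d1 u2 (s, t) - β) + (d1 u2 (s, t) - γ))])
    (by
      intro k _
      rw [II_adj1 (by fun_prop), II_adj1 cE]
      exact hb k)
  rw [II_cells (F := fun z => (d1 u2 z - b 0) ^ 2) (by fun_prop), II_cells cE, hx0, hxN] at T
  refine T.trans ?_
  apply mul_le_mul_of_nonneg_right _ (II_nonneg (by linarith) hcd (EE_nonneg _ _))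
  have : N ^ 2 ≤ 9 * (L / h) ^ 2 := by nlinarith
  nlinarith

lemma II_eq_set {F : ℝ × ℝ → ℝ} (hF : Continuous F) {a b c d : ℝ} (hab : a ≤ b) (hcd : c ≤ d) :
    ∫ z in Ioo a b ×ˢ Ioo c d, F z = II F a b c d := by
  have hi : IntegrableOn F (Ioo a b ×ˢ Ioo c d) (volume.prod volume) := by
    have h : IntegrableOn F (Icc a b ×ˢ Icc c d) (volume.prod volume) :=
      (hF.continuousOn).integrableOn_compact (isCompact_Icc.prod isCompact_Icc)
    exact h.mono_set (prod_mono Ioo_subset_Icc_self Ioo_subset_Icc_self)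
  rw [Measure.volume_eq_prod, setIntegral_prod _ hi]
  unfold II
  rw [intervalIntegral.integral_of_le hab, integral_Ioc_eq_integral_Ioo]
  congr 1; ext x
  rw [intervalIntegral.integral_of_le hcd, integral_Ioc_eq_integral_Ioo]

lemma omega_int {F : ℝ × ℝ → ℝ} (hF : Continuous F) {L h : ℝ} (hL : 0 ≤ L) (hh : 0 ≤ h) :
    ∫ x in OmegaThin L h, F (x 0, x 1) = II F (-L) L (-(h / 2)) (h / 2) := by
  rw [← II_eq_set hF (by linarith) (by linarith)]
  have hp := MeasureTheory.volume_preserving_finTwoArrow ℝ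
  rw [← hp.setIntegral_preimage_emb (MeasurableEquiv.measurableEmbedding _)]
  congr 1

lemma gradM_eq {u : (Fin 2 → ℝ) → Fin 2 → ℝ} (hu : ContDiff ℝ 1 u) (x : Fin 2 → ℝ) (i : Fin 2) :
    gradM u x i 0 = d1 (fun z : ℝ × ℝ => u ![z.1, z.2] i) (x 0, x 1)
    ∧ gradM u x i 1 = d2 (fun z : ℝ × ℝ => u ![z.1, z.2] i) (x 0, x 1) := by
  have hui : ContDiff ℝ 1 (fun y => u y i) := by fun_prop
  have hg : ContDiff ℝ 1 (fun z : ℝ × ℝ => (![z.1, z.2] : Fin 2 → ℝ)) := by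
    rw [contDiff_pi]
    intro j; fin_cases j
    · exact contDiff_fst
    · exact contDiff_snd
  have hv : ContDiff ℝ 1 (fun z : ℝ × ℝ => u ![z.1, z.2] i) := hui.comp hg
  have hx : ![x 0, x 1] = x := by ext j; fin_cases j <;> rfl
  have hd : HasFDerivAt (fun y => u y i) (fderiv ℝ (fun y => u y i) x) ![x 0, x 1] := by
    rw [hx]
    exact (hui.differentiable (by norm_num) x).hasFDerivAt
  constructor
  · symm
    apply d1_eq hv
    have : HasDerivAt (fun s : ℝ => (![s, x 1] : Fin 2 → ℝ)) (Pi.single 0 1) (x 0) := by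
      rw [hasDerivAt_pi]
      intro j; fin_cases j
      · simpa using hasDerivAt_id' (x 0)
      · simpa using hasDerivAt_const (x 0) (x 1)
    exact hd.comp_hasDerivAt (x 0) this
  · symm
    apply d2_eq hv
    have : HasDerivAt (fun s : ℝ => (![x 0, s] : Fin 2 → ℝ)) (Pi.single 1 1) (x 1) := by
      rw [hasDerivAt_pi]
      intro j; fin_cases j
      · simpa using hasDerivAt_const (x 1) (x 0)
      · simpa using hasDerivAt_id' (x 1)
    exact hd.comp_hasDerivAt (x 1) this

lemma cd_comp {u : (Fin 2 → ℝ) → Fin 2 → ℝ} (hu : ContDiff ℝ 1 u) (i : Fin 2) :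
    ContDiff ℝ 1 (fun z : ℝ × ℝ => u ![z.1, z.2] i) := by
  have hui : ContDiff ℝ 1 (fun y => u y i) := by fun_prop
  have hg : ContDiff ℝ 1 (fun z : ℝ × ℝ => (![z.1, z.2] : Fin 2 → ℝ)) := by
    rw [contDiff_pi]
    intro j; fin_cases j
    · exact contDiff_fst
    · exact contDiff_snd
  exact hui.comp hg

end KornThin

theorem stmt8 (L : ℝ) (hL : 0 < L) :
    ∃ C > (0 : ℝ), ∀ h : ℝ, 0 < h → h ≤ L →
      ∀ u : (Fin 2 → ℝ) → Fin 2 → ℝ, ContDiff ℝ 1 u →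
        ∃ A₀ : Matrix (Fin 2) (Fin 2) ℝ, A₀ᵀ = -A₀ ∧
          (∫ x in OmegaThin L h, ∑ i, ∑ j, (gradM u x i j - A₀ i j) ^ 2)
            ≤ C / h ^ 2 *
              ∫ x in OmegaThin L h, ∑ i, ∑ j,
                ((gradM u x i j + gradM u x j i) / 2) ^ 2 := by
  obtain ⟨C, hC, hk⟩ := KornThin.korn_strip
  refine ⟨(6 * C + 4) * L ^ 2, by positivity, fun h hh hhL u hu => ?_⟩
  have h1 := KornThin.cd_comp hu 0
  have h2 := KornThin.cd_comp hu 1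
  obtain ⟨β, hβ⟩ := hk L h hh hhL _ _ h1 h2
  refine ⟨!![0, -β; β, 0], ?_, ?_⟩
  · ext i j; fin_cases i <;> fin_cases j <;> simp
  simp only [Fin.sum_univ_two, (KornThin.gradM_eq hu _ _).1, (KornThin.gradM_eq hu _ _).2]
  generalize (fun z : ℝ × ℝ => u ![z.1, z.2] 0) = u1 at *
  generalize (fun z : ℝ × ℝ => u ![z.1, z.2] 1) = u2 at *
  have c11 := KornThin.cont_d1 h1
  have c21 := KornThin.cont_d2 h1
  have c12 := KornThin.cont_d1 h2
  have c22 := KornThin.cont_d2 h2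
  have cE := KornThin.cont_EE h1 h2
  have hab : -L ≤ L := by linarith
  have hcd : -(h / 2) ≤ h / 2 := by linarith
  have nE := KornThin.II_nonneg hab hcd (KornThin.EE_nonneg u1 u2)
  have hLh : 1 ≤ L / h := (one_le_div hh).2 hhL
  have l1 : ∫ x in OmegaThin L h,
        ((KornThin.d1 u1 (x 0, x 1) - (!![0, -β; β, 0] : Matrix (Fin 2) (Fin 2) ℝ) 0 0) ^ 2
          + (KornThin.d2 u1 (x 0, x 1) - (!![0, -β; β, 0] : Matrix (Fin 2) (Fin 2) ℝ) 0 1) ^ 2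
        + ((KornThin.d1 u2 (x 0, x 1) - (!![0, -β; β, 0] : Matrix (Fin 2) (Fin 2) ℝ) 1 0) ^ 2
          + (KornThin.d2 u2 (x 0, x 1) - (!![0, -β; β, 0] : Matrix (Fin 2) (Fin 2) ℝ) 1 1) ^ 2))
      ≤ 2 * KornThin.II (KornThin.EE u1 u2) (-L) L (-(h / 2)) (h / 2)
        + 3 * KornThin.II (fun z => (KornThin.d1 u2 z - β) ^ 2) (-L) L (-(h / 2)) (h / 2) := by
    have := KornThin.omega_int (F := fun z =>
        ((KornThin.d1 u1 z - (!![0, -β; β, 0] : Matrix (Fin 2) (Fin 2) ℝ) 0 0) ^ 2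
          + (KornThin.d2 u1 z - (!![0, -β; β, 0] : Matrix (Fin 2) (Fin 2) ℝ) 0 1) ^ 2
        + ((KornThin.d1 u2 z - (!![0, -β; β, 0] : Matrix (Fin 2) (Fin 2) ℝ) 1 0) ^ 2
          + (KornThin.d2 u2 z - (!![0, -β; β, 0] : Matrix (Fin 2) (Fin 2) ℝ) 1 1) ^ 2)))
        (by fun_prop) hL.le hh.le
    rw [this, ← KornThin.II_mul, ← KornThin.II_mul, ← KornThin.II_add (by fun_prop) (by fun_prop)]
    apply KornThin.II_mono (by fun_prop) (by fun_prop) hab hcd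
    intro x _ y _
    simp [KornThin.EE]
    generalize KornThin.d1 u1 _ = p
    generalize KornThin.d2 u2 _ = q
    generalize KornThin.d2 u1 _ = r
    generalize KornThin.d1 u2 _ = s
    nlinarith [sq_nonneg (r + s + (s - β)), sq_nonneg p, sq_nonneg q]
  have l2 : KornThin.II (KornThin.EE u1 u2) (-L) L (-(h / 2)) (h / 2)
      ≤ 2 * ∫ x in OmegaThin L h,
        (((KornThin.d1 u1 (x 0, x 1) + KornThin.d1 u1 (x 0, x 1)) / 2) ^ 2
          + ((KornThin.d2 u1 (x 0, x 1) + KornThin.d1 u2 (x 0, x 1)) / 2) ^ 2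
        + (((KornThin.d1 u2 (x 0, x 1) + KornThin.d2 u1 (x 0, x 1)) / 2) ^ 2
          + ((KornThin.d2 u2 (x 0, x 1) + KornThin.d2 u2 (x 0, x 1)) / 2) ^ 2)) := by
    have := KornThin.omega_int (F := fun z =>
        (((KornThin.d1 u1 z + KornThin.d1 u1 z) / 2) ^ 2
          + ((KornThin.d2 u1 z + KornThin.d1 u2 z) / 2) ^ 2
        + (((KornThin.d1 u2 z + KornThin.d2 u1 z) / 2) ^ 2
          + ((KornThin.d2 u2 z + KornThin.d2 u2 z) / 2) ^ 2)))
        (by fun_prop) hL.le hh.le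
    rw [this, ← KornThin.II_mul]
    apply KornThin.II_mono (by fun_prop) (by fun_prop) hab hcd
    intro x _ y _
    simp only [KornThin.EE]
    nlinarith [sq_nonneg (KornThin.d1 u1 (x, y)), sq_nonneg (KornThin.d2 u2 (x, y))]
  refine l1.trans ?_
  have hq : 1 ≤ (L / h) ^ 2 := by nlinarith
  have l3 : 2 * KornThin.II (KornThin.EE u1 u2) (-L) L (-(h / 2)) (h / 2)
        + 3 * KornThin.II (fun z => (KornThin.d1 u2 z - β) ^ 2) (-L) L (-(h / 2)) (h / 2)
      ≤ ((3 * C + 2) * (L / h) ^ 2) * KornThin.II (KornThin.EE u1 u2) (-L) L (-(h / 2)) (h / 2) := by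
    have := mul_le_mul_of_nonneg_right hq nE
    linarith
  refine l3.trans ((mul_le_mul_of_nonneg_left l2 (by positivity)).trans (le_of_eq ?_))
  rw [div_pow]
  ring
end
end

section
/- Let Ω = (-L,L)^{d-1} × (-1/2,1/2) with d = 2 or 3, and suppose u is periodic in tangential directions. In dimension d = 2, the mean of the skew part of the gradient is controlled by the symmetric part: | (1/|Ω_h|) ∫_{Ω_h} skew(∇u) dx |² |Ω_h| ≤ ∫_{Ω_h} |ε(u)|² dx. Consequently, combining with Korn modulo rotations, ‖∇u‖_{L²(Ω_h)} ≤ (C/h) ‖ε(u)‖_{L²(Ω_h)} for periodic u on the thin strip Ω_h = (-L,L) × (-h/2,h/2). -/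
/- STATEMENT 10: for u periodic in the tangential direction on the thin strip
Ω_h = (-L,L) × (-h/2,h/2) ⊂ ℝ² (d = 2): (a) the mean of the skew part of ∇u is
controlled by the symmetric part, |∫_{Ω_h} skew ∇u|² ≤ |Ω_h| ∫_{Ω_h} |ε(u)|²; and
(b) the Korn inequality ‖∇u‖²_{L²(Ω_h)} ≤ (C/h²) ‖ε(u)‖²_{L²(Ω_h)} holds. -/

open MeasureTheory Set
noncomputable section

/-- symmetric part ε(u). -/
def symM (u : (Fin 2 → ℝ) → Fin 2 → ℝ) (x : Fin 2 → ℝ) (i j : Fin 2) : ℝ :=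
  (gradM u x i j + gradM u x j i) / 2

/-- skew part of the gradient. -/
def skewM (u : (Fin 2 → ℝ) → Fin 2 → ℝ) (x : Fin 2 → ℝ) (i j : Fin 2) : ℝ :=
  (gradM u x i j - gradM u x j i) / 2

/-- periodicity in the tangential direction x₁, with period 2L. -/
def TangPeriodic2 (L : ℝ) (u : (Fin 2 → ℝ) → Fin 2 → ℝ) : Prop :=
  ∀ x : Fin 2 → ℝ, u (Function.update x 0 (x 0 + 2 * L)) = u x

/-- a function of two variables with continuous partial derivatives, periodic in the first. -/
structure Sm (L : ℝ) (p px py : ℝ → ℝ → ℝ) : Prop where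
  c : Continuous (fun z : ℝ × ℝ => p z.1 z.2)
  cx : Continuous (fun z : ℝ × ℝ => px z.1 z.2)
  cy : Continuous (fun z : ℝ × ℝ => py z.1 z.2)
  dx : ∀ x y, HasDerivAt (fun x => p x y) (px x y) x
  dy : ∀ x y, HasDerivAt (fun y => p x y) (py x y) y
  per : ∀ y, p L y = p (-L) y

lemma cont_par {F : ℝ → ℝ → ℝ} (hF : Continuous (fun z : ℝ × ℝ => F z.1 z.2)) (a b : ℝ) :
    Continuous (fun y => ∫ x in a..b, F x y) := by
  apply intervalIntegral.continuous_parametric_intervalIntegral_of_continuous'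
  exact hF.comp continuous_swap

lemma cont_1 {F : ℝ → ℝ → ℝ} (hF : Continuous (fun z : ℝ × ℝ => F z.1 z.2)) (y : ℝ) :
    Continuous (fun x => F x y) :=
  hF.comp (by fun_prop : Continuous (fun x : ℝ => (x, y)))

lemma cont_2 {F : ℝ → ℝ → ℝ} (hF : Continuous (fun z : ℝ × ℝ => F z.1 z.2)) (x : ℝ) :
    Continuous (fun y => F x y) :=
  hF.comp (by fun_prop : Continuous (fun y : ℝ => (x, y)))

/-- Cauchy–Schwarz in one variable. -/
lemma cs1 {f : ℝ → ℝ} (hf : Continuous f) {a b : ℝ} (hab : a ≤ b) :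
    (∫ x in a..b, f x) ^ 2 ≤ (b - a) * ∫ x in a..b, f x ^ 2 := by
  rcases hab.eq_or_lt with rfl | hab'
  · simp
  set m := (∫ x in a..b, f x) / (b - a) with hm
  have hpos : 0 < b - a := by linarith
  have h0 : 0 ≤ ∫ x in a..b, (f x - m) ^ 2 :=
    intervalIntegral.integral_nonneg hab (fun x _ => sq_nonneg _)
  have h1 : ∫ x in a..b, (f x - m) ^ 2
      = (∫ x in a..b, f x ^ 2) - 2 * m * (∫ x in a..b, f x) + m ^ 2 * (b - a) := by
    have : (fun x => (f x - m) ^ 2) = fun x => (f x ^ 2 - 2 * m * f x) + m ^ 2 := by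
      ext x; ring
    rw [this, intervalIntegral.integral_add, intervalIntegral.integral_sub,
      intervalIntegral.integral_const_mul, intervalIntegral.integral_const]
    · simp; ring
    all_goals exact Continuous.intervalIntegrable (by fun_prop) _ _
  have h2 : (∫ x in a..b, f x) = m * (b - a) := by rw [hm]; field_simp
  rw [h1, h2] at h0
  rw [h2]
  nlinarith

lemma slope_int {L : ℝ} {p px py : ℝ → ℝ → ℝ} (hp : Sm L p px py) (x y z : ℝ) :
    p x z - p x y = (z - y) * ∫ t in (0:ℝ)..1, py x (y + t * (z - y)) := by
  have h : ∀ t ∈ uIcc (0:ℝ) 1,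
      HasDerivAt (fun t => p x (y + t * (z - y))) (py x (y + t * (z - y)) * (z - y)) t := by
    intro t _
    have h1 : HasDerivAt (fun t : ℝ => y + t * (z - y)) (z - y) t := by
      simpa using ((hasDerivAt_id t).mul_const (z - y)).const_add y
    exact (hp.dy x (y + t * (z - y))).comp t h1
  have hc := cont_2 hp.cy x
  have := intervalIntegral.integral_eq_sub_of_hasDerivAt h
    (Continuous.intervalIntegrable (by fun_prop) _ _)
  rw [intervalIntegral.integral_mul_const] at this
  rw [mul_comm, this]; simp

lemma slope_cont {L : ℝ} {p px py : ℝ → ℝ → ℝ} (hp : Sm L p px py) (y : ℝ) :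
    Continuous (fun w : ℝ × ℝ => ∫ t in (0:ℝ)..1, py w.1 (y + t * (w.2 - y))) := by
  apply intervalIntegral.continuous_parametric_intervalIntegral_of_continuous'
  exact hp.cy.comp (by fun_prop :
    Continuous (fun v : (ℝ × ℝ) × ℝ => (v.1.1, y + v.2 * (v.1.2 - y))))

lemma G_deriv {L : ℝ} {p px py q qx qy : ℝ → ℝ → ℝ} (hp : Sm L p px py) (hq : Sm L q qx qy)
    (y : ℝ) :
    HasDerivAt (fun y => ∫ x in (-L)..L, p x y * qx x y)
      (∫ x in (-L)..L, (py x y * qx x y - px x y * qy x y)) y := by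
  set S := fun (x z : ℝ) => ∫ t in (0:ℝ)..1, py x (y + t * (z - y)) with hS
  set R := fun (x z : ℝ) => ∫ t in (0:ℝ)..1, qy x (y + t * (z - y)) with hR
  have cS : Continuous (fun w : ℝ × ℝ => S w.1 w.2) := slope_cont hp y
  have cR : Continuous (fun w : ℝ × ℝ => R w.1 w.2) := slope_cont hq y
  set M := fun z => ∫ x in (-L)..L, (S x z * qx x z - px x y * R x z) with hM
  have cM : Continuous M := by
    apply cont_par (F := fun x z => S x z * qx x z - px x y * R x z)
    have h1 := hq.cx
    have h2 : Continuous (fun w : ℝ × ℝ => px w.1 y) := (cont_1 hp.cx y).comp continuous_fst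
    exact (cS.mul h1).sub (h2.mul cR)
  have hMy : M y = ∫ x in (-L)..L, (py x y * qx x y - px x y * qy x y) := by
    simp [hM, hS, hR]
  have hG : ∀ z, (∫ x in (-L)..L, p x z * qx x z)
      = (∫ x in (-L)..L, p x y * qx x y) + (z - y) * M z := by
    intro z
    have a1 := cont_1 hp.c y
    have a2 := cont_1 hp.c z
    have a3 := cont_1 hq.cx y
    have a4 := cont_1 hq.cx z
    have a5 := cont_1 hp.cx y
    have a6 := cont_1 hq.c y
    have a7 := cont_1 hq.c z
    have ibp := intervalIntegral.integral_mul_deriv_eq_deriv_mul (a := -L) (b := L)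
      (u := fun x => p x y) (u' := fun x => px x y)
      (v := fun x => q x z - q x y) (v' := fun x => qx x z - qx x y)
      (fun x _ => hp.dx x y) (fun x _ => (hq.dx x z).sub (hq.dx x y))
      (a5.intervalIntegrable _ _) ((a4.sub a3).intervalIntegrable _ _)
    rw [hp.per, hq.per, hq.per, sub_self, zero_sub] at ibp
    have e1 : (z - y) * M z = ∫ x in (-L)..L,
        ((p x z - p x y) * qx x z - px x y * (q x z - q x y)) := by
      rw [hM, ← intervalIntegral.integral_const_mul]
      congr 1; ext x
      rw [slope_int hp x y z, slope_int hq x y z]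
      simp only [hS, hR]; ring
    rw [e1, intervalIntegral.integral_sub, sub_eq_add_neg, ← ibp,
      ← intervalIntegral.integral_add, ← intervalIntegral.integral_add]
    · congr 1; ext x; ring
    all_goals exact Continuous.intervalIntegrable (by fun_prop) _ _
  rw [← hMy]
  rw [hasDerivAt_iff_tendsto_slope]
  have : Filter.Tendsto M (nhdsWithin y {y}ᶜ) (nhds (M y)) :=
    cM.continuousAt.tendsto.mono_left nhdsWithin_le_nhds
  refine this.congr' ?_
  filter_upwards [self_mem_nhdsWithin] with z hz
  have hz' : z - y ≠ 0 := sub_ne_zero.mpr hz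
  rw [slope_def_field, hG z]
  field_simp
  ring

lemma poinc {L : ℝ} (hL : 0 < L) {p px py : ℝ → ℝ → ℝ} (hp : Sm L p px py) (y : ℝ) {x : ℝ}
    (hx : x ∈ Icc (-L) L) :
    (p x y - p (-L) y) ^ 2 ≤ 2 * L * ∫ x in (-L)..L, px x y ^ 2 := by
  have a := cont_1 hp.cx y
  have h1 : ∫ t in (-L)..x, px t y = p x y - p (-L) y :=
    intervalIntegral.integral_eq_sub_of_hasDerivAt (f := fun x => p x y)
      (fun t _ => hp.dx t y) (a.intervalIntegrable _ _)
  rw [← h1]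
  refine (cs1 a hx.1).trans ?_
  have h2 : ∫ t in (-L)..x, px t y ^ 2 ≤ ∫ t in (-L)..L, px t y ^ 2 := by
    apply intervalIntegral.integral_mono_interval le_rfl hx.1 hx.2
    · exact Filter.Eventually.of_forall (fun _ => sq_nonneg _)
    · exact (a.pow 2).intervalIntegrable _ _
  have h3 : 0 ≤ ∫ t in (-L)..x, px t y ^ 2 :=
    intervalIntegral.integral_nonneg hx.1 (fun x _ => sq_nonneg _)
  have := hx.2
  apply mul_le_mul _ h2 h3 (by linarith)
  linarith

/-- energy density integrated in x -/
def NN (L : ℝ) (px py qx qy : ℝ → ℝ → ℝ) (y : ℝ) : ℝ :=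
  ∫ x in (-L)..L, (px x y ^ 2 + qy x y ^ 2 + (py x y + qx x y) ^ 2)

def DD (L : ℝ) (py qx : ℝ → ℝ → ℝ) (y : ℝ) : ℝ :=
  ∫ x in (-L)..L, (py x y ^ 2 + qx x y ^ 2)

lemma DD_cont {L : ℝ} {p px py q qx qy : ℝ → ℝ → ℝ} (hp : Sm L p px py) (hq : Sm L q qx qy) :
    Continuous (DD L py qx) := by
  have h1 := hp.cy
  have h2 := hq.cx
  exact cont_par (F := fun x y => py x y ^ 2 + qx x y ^ 2) (by fun_prop) _ _

lemma NN_cont {L : ℝ} {p px py q qx qy : ℝ → ℝ → ℝ} (hp : Sm L p px py) (hq : Sm L q qx qy) :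
    Continuous (NN L px py qx qy) := by
  have h1 := hp.cy
  have h2 := hq.cx
  have h3 := hp.cx
  have h4 := hq.cy
  exact cont_par (F := fun x y => px x y ^ 2 + qy x y ^ 2 + (py x y + qx x y) ^ 2)
    (by fun_prop) _ _

lemma key_pt {L : ℝ} (hL : 0 < L) {p px py q qx qy : ℝ → ℝ → ℝ} (hp : Sm L p px py)
    (hq : Sm L q qx qy) {T w : ℝ} (hT : 0 < T) (hw0 : 0 ≤ w) (hw1 : w ≤ 1) (y : ℝ) :
    1 / 2 * (w ^ 2 * DD L py qx y) ≤ (1 + 32 * L ^ 2 / T ^ 2) * NN L px py qx qy y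
      - 2 * (w ^ 2 * (∫ x in (-L)..L, (py x y * qx x y - px x y * qy x y))
          - 2 / T * w * ∫ x in (-L)..L, p x y * qx x y) := by
  have a1 := cont_1 hp.c y
  have a2 := cont_1 hp.cx y
  have a3 := cont_1 hp.cy y
  have a4 := cont_1 hq.cx y
  have a5 := cont_1 hq.cy y
  have a6 := cont_1 hq.c y
  have hLL : -L ≤ L := by linarith
  -- G with constant subtracted
  have hG : ∫ x in (-L)..L, p x y * qx x y = ∫ x in (-L)..L, (p x y - p (-L) y) * qx x y := by
    have h0 : ∫ x in (-L)..L, qx x y = 0 := by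
      rw [intervalIntegral.integral_eq_sub_of_hasDerivAt (f := fun x => q x y)
        (fun t _ => hq.dx t y) (a4.intervalIntegrable _ _), hq.per, sub_self]
    simp_rw [sub_mul]
    rw [intervalIntegral.integral_sub, intervalIntegral.integral_const_mul, h0]
    · ring
    all_goals exact Continuous.intervalIntegrable (by fun_prop) _ _
  set A := ∫ x in (-L)..L, px x y ^ 2 with hA
  have hAN : A ≤ NN L px py qx qy y := by
    apply intervalIntegral.integral_mono_on hLL
    · exact Continuous.intervalIntegrable (by fun_prop) _ _
    · exact Continuous.intervalIntegrable (by fun_prop) _ _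
    · intro x _
      nlinarith [sq_nonneg (qy x y), sq_nonneg (py x y + qx x y)]
  have main : ∫ x in (-L)..L, (1 / 2 * w ^ 2 * (py x y ^ 2 + qx x y ^ 2)
        + 2 * w ^ 2 * (py x y * qx x y - px x y * qy x y)
        + (- (4 / T * w)) * ((p x y - p (-L) y) * qx x y))
      ≤ ∫ x in (-L)..L, ((px x y ^ 2 + qy x y ^ 2 + (py x y + qx x y) ^ 2)
        + 8 / T ^ 2 * (2 * L * A)) := by
    apply intervalIntegral.integral_mono_on hLL
    · exact Continuous.intervalIntegrable (by fun_prop) _ _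
    · exact Continuous.intervalIntegrable (by fun_prop) _ _
    · intro x hx
      have hpo := poinc hL hp y hx
      have h8 : 8 / T ^ 2 * (p x y - p (-L) y) ^ 2 ≤ 8 / T ^ 2 * (2 * L * A) :=
        mul_le_mul_of_nonneg_left hpo (by positivity)
      have h9 : (- (4 / T * w)) * ((p x y - p (-L) y) * qx x y)
          ≤ 1 / 2 * w ^ 2 * qx x y ^ 2 + 8 / T ^ 2 * (p x y - p (-L) y) ^ 2 := by
        have : 0 ≤ 1 / 2 * (w * qx x y + 4 / T * (p x y - p (-L) y)) ^ 2 := by positivity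
        have e : 1 / 2 * (w * qx x y + 4 / T * (p x y - p (-L) y)) ^ 2
          = 1 / 2 * w ^ 2 * qx x y ^ 2 + 8 / T ^ 2 * (p x y - p (-L) y) ^ 2
            + (4 / T * w) * ((p x y - p (-L) y) * qx x y) := by
          field_simp; ring
        linarith
      have hw2 : w ^ 2 ≤ 1 := by nlinarith
      have hw3 : 0 ≤ w ^ 2 := sq_nonneg w
      have h10 : w ^ 2 * ((px x y + qy x y) ^ 2) ≥ 0 := by positivity
      have h11 : w ^ 2 * (px x y ^ 2 + qy x y ^ 2 + (py x y + qx x y) ^ 2)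
          ≤ px x y ^ 2 + qy x y ^ 2 + (py x y + qx x y) ^ 2 := by
        have : 0 ≤ px x y ^ 2 + qy x y ^ 2 + (py x y + qx x y) ^ 2 := by positivity
        nlinarith
      have h12 : w ^ 2 * (py x y) ^ 2 ≥ 0 := by positivity
      nlinarith
  rw [intervalIntegral.integral_add, intervalIntegral.integral_add,
    intervalIntegral.integral_add, intervalIntegral.integral_const_mul,
    intervalIntegral.integral_const_mul, intervalIntegral.integral_const_mul,
    intervalIntegral.integral_const, ← hG] at main
  · change 1 / 2 * w ^ 2 * DD L py qx y + _ + _ ≤ NN L px py qx qy y + _ at main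
    have h13 : (L - -L) • (8 / T ^ 2 * (2 * L * A)) = 32 * L ^ 2 / T ^ 2 * A := by
      simp only [smul_eq_mul]; ring
    rw [h13] at main
    have h14 : 32 * L ^ 2 / T ^ 2 * A ≤ 32 * L ^ 2 / T ^ 2 * NN L px py qx qy y :=
      mul_le_mul_of_nonneg_left hAN (by positivity)
    have h15 : 4 / T * w = 2 * (2 / T * w) := by ring
    rw [h15] at main
    nlinarith
  all_goals exact Continuous.intervalIntegrable (by fun_prop) _ _

lemma key {L : ℝ} (hL : 0 < L) {p px py q qx qy : ℝ → ℝ → ℝ} (hp : Sm L p px py)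
    (hq : Sm L q qx qy) {T : ℝ} (hT : 0 < T) :
    1 / 2 * ∫ y in (0:ℝ)..T, ((1 - y / T) ^ 2 * DD L py qx y)
      ≤ (1 + 32 * L ^ 2 / T ^ 2) * (∫ y in (0:ℝ)..T, NN L px py qx qy y)
        + 2 * ∫ x in (-L)..L, p x 0 * qx x 0 := by
  have cD := DD_cont hp hq
  have cN := NN_cont hp hq
  have b1 := hp.c
  have b2 := hp.cx
  have b3 := hp.cy
  have b4 := hq.cx
  have b5 := hq.cy
  set G := fun y => ∫ x in (-L)..L, p x y * qx x y with hG
  set J := fun y => ∫ x in (-L)..L, (py x y * qx x y - px x y * qy x y) with hJ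
  have cG : Continuous G := cont_par (F := fun x y => p x y * qx x y) (by fun_prop) _ _
  have cJ : Continuous J :=
    cont_par (F := fun x y => py x y * qx x y - px x y * qy x y) (by fun_prop) _ _
  have ftc : ∫ y in (0:ℝ)..T, ((1 - y / T) ^ 2 * J y - 2 / T * (1 - y / T) * G y) = - G 0 := by
    have := intervalIntegral.integral_eq_sub_of_hasDerivAt (a := 0) (b := T)
      (f := fun y => (1 - y / T) ^ 2 * G y)
      (f' := fun y => ((1 - y / T) ^ 2 * J y - 2 / T * (1 - y / T) * G y)) ?_
      (Continuous.intervalIntegrable (by fun_prop) _ _)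
    · rw [this]; simp [hT.ne']
    · intro y _
      have h1 : HasDerivAt (fun y : ℝ => (1 - y / T) ^ 2) (2 * (1 - y / T) * (-(1 / T))) y := by
        have := (((hasDerivAt_id y).div_const T).const_sub 1).pow 2
        exact this.congr_deriv (by simp)
      have h2 := h1.mul (G_deriv hp hq y)
      exact h2.congr_deriv (by simp only [hJ, hG]; ring)
  have main : ∫ y in (0:ℝ)..T, 1 / 2 * ((1 - y / T) ^ 2 * DD L py qx y)
      ≤ ∫ y in (0:ℝ)..T, ((1 + 32 * L ^ 2 / T ^ 2) * NN L px py qx qy y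
        - 2 * ((1 - y / T) ^ 2 * J y - 2 / T * (1 - y / T) * G y)) := by
    apply intervalIntegral.integral_mono_on hT.le
    · exact Continuous.intervalIntegrable (by fun_prop) _ _
    · exact Continuous.intervalIntegrable (by fun_prop) _ _
    · intro y hy
      have h1 : y / T ≤ 1 := (div_le_one hT).mpr hy.2
      have h0 : 0 ≤ y / T := div_nonneg hy.1 hT.le
      exact key_pt hL hp hq hT (by linarith) (by linarith) y
  rw [intervalIntegral.integral_sub, intervalIntegral.integral_const_mul,
    intervalIntegral.integral_const_mul, intervalIntegral.integral_const_mul, ftc] at main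
  · linarith
  all_goals exact Continuous.intervalIntegrable (by fun_prop) _ _

lemma Sm.comb {L : ℝ} {p px py : ℝ → ℝ → ℝ} (hp : Sm L p px py) (k l : ℝ) :
    Sm L (fun x t => k * p x t + l * p x (2 * t)) (fun x t => k * px x t + l * px x (2 * t))
      (fun x t => k * py x t + 2 * l * py x (2 * t)) := by
  have d : Continuous (fun z : ℝ × ℝ => (z.1, 2 * z.2)) := by fun_prop
  refine ⟨?_, ?_, ?_, ?_, ?_, ?_⟩
  · exact (hp.c.const_mul k).add ((hp.c.comp d).const_mul l)
  · exact (hp.cx.const_mul k).add ((hp.cx.comp d).const_mul l)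
  · exact (hp.cy.const_mul k).add ((hp.cy.comp d).const_mul (2 * l))
  · intro x y
    exact ((hp.dx x y).const_mul k).add ((hp.dx x (2 * y)).const_mul l)
  · intro x y
    have h1 : HasDerivAt (fun t : ℝ => 2 * t) 2 y := by
      simpa using (hasDerivAt_id y).const_mul (2:ℝ)
    have h2 : HasDerivAt (fun t => p x (2 * t)) (py x (2 * y) * 2) y := (hp.dy x (2 * y)).comp y h1
    exact (((hp.dy x y).const_mul k).add (h2.const_mul l)).congr_deriv (by ring)
  · intro y
    simp only [hp.per]

lemma Sm.aff {L : ℝ} {p px py : ℝ → ℝ → ℝ} (hp : Sm L p px py) (k m c : ℝ) :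
    Sm L (fun x t => k * p x (m + c * t)) (fun x t => k * px x (m + c * t))
      (fun x t => k * c * py x (m + c * t)) := by
  have d : Continuous (fun z : ℝ × ℝ => (z.1, m + c * z.2)) := by fun_prop
  refine ⟨?_, ?_, ?_, ?_, ?_, ?_⟩
  · exact (hp.c.comp d).const_mul k
  · exact (hp.cx.comp d).const_mul k
  · exact (hp.cy.comp d).const_mul (k * c)
  · intro x y
    exact (hp.dx x (m + c * y)).const_mul k
  · intro x y
    have h1 : HasDerivAt (fun t : ℝ => m + c * t) c y := by
      simpa using ((hasDerivAt_id y).const_mul c).const_add m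
    have h2 : HasDerivAt (fun t => p x (m + c * t)) (py x (m + c * y) * c) y :=
      (hp.dy x (m + c * y)).comp y h1
    exact (h2.const_mul k).congr_deriv (by ring)
  · intro y
    simp only [hp.per]

lemma half {L : ℝ} (hL : 0 < L) {p px py q qx qy : ℝ → ℝ → ℝ} (hp : Sm L p px py)
    (hq : Sm L q qx qy) {h : ℝ} (hh : 0 < h) (hhL : h ≤ L) :
    ∫ y in (0:ℝ)..h, ((1 - y / h) ^ 2 * DD L py qx y)
      ≤ 50000 * L ^ 2 / h ^ 2 * (∫ y in (0:ℝ)..h, NN L px py qx qy y) := by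
  have hP := hp.comb 3 (-2)
  have hQ := hq.comb 3 (-4)
  have k1 := key hL hp hq hh
  have k2 := key hL hP hQ (half_pos hh)
  have cN := NN_cont hp hq
  have cN' := NN_cont hP hQ
  set N' := NN L (fun x t => 3 * px x t + (-2) * px x (2 * t))
      (fun x t => 3 * py x t + 2 * (-2) * py x (2 * t))
      (fun x t => 3 * qx x t + (-4) * qx x (2 * t))
      (fun x t => 3 * qy x t + 2 * (-4) * qy x (2 * t)) with hN'
  have hLL : -L ≤ L := by linarith
  have Nnn : ∀ y, 0 ≤ NN L px py qx qy y := fun y =>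
    intervalIntegral.integral_nonneg hLL (fun x _ => by positivity)
  have hNN : ∀ t, N' t ≤ 128 * (NN L px py qx qy t + NN L px py qx qy (2 * t)) := by
    intro t
    have a2 := cont_1 hp.cx t
    have a3 := cont_1 hp.cy t
    have a4 := cont_1 hq.cx t
    have a5 := cont_1 hq.cy t
    have b2 := cont_1 hp.cx (2 * t)
    have b3 := cont_1 hp.cy (2 * t)
    have b4 := cont_1 hq.cx (2 * t)
    have b5 := cont_1 hq.cy (2 * t)
    simp only [hN', NN]
    rw [← intervalIntegral.integral_add, ← intervalIntegral.integral_const_mul]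
    · apply intervalIntegral.integral_mono_on hLL
      · exact Continuous.intervalIntegrable (by fun_prop) _ _
      · exact Continuous.intervalIntegrable (by fun_prop) _ _
      · intro x _
        have e1 : (3 * px x t + -2 * px x (2 * t)) ^ 2
            ≤ 128 * (px x t ^ 2 + px x (2 * t) ^ 2) := by
          nlinarith [sq_nonneg (3 * px x t + 2 * px x (2 * t)), sq_nonneg (px x t),
            sq_nonneg (px x (2 * t))]
        have e2 : (3 * qy x t + 2 * -4 * qy x (2 * t)) ^ 2
            ≤ 128 * (qy x t ^ 2 + qy x (2 * t) ^ 2) := by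
          nlinarith [sq_nonneg (3 * qy x t + 8 * qy x (2 * t)), sq_nonneg (qy x t),
            sq_nonneg (qy x (2 * t))]
        have e3 : ∀ a b : ℝ, (3 * a - 4 * b) ^ 2 ≤ 128 * (a ^ 2 + b ^ 2) := by
          intro a b
          nlinarith [sq_nonneg (3 * a + 4 * b), sq_nonneg a, sq_nonneg b]
        have e4 := e3 (py x t + qx x t) (py x (2 * t) + qx x (2 * t))
        have e5 : 3 * py x t + 2 * -2 * py x (2 * t) + (3 * qx x t + -4 * qx x (2 * t))
          = 3 * (py x t + qx x t) - 4 * (py x (2 * t) + qx x (2 * t)) := by ring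
        rw [e5]
        linarith
    all_goals exact Continuous.intervalIntegrable (by fun_prop) _ _
  set I := ∫ y in (0:ℝ)..h, NN L px py qx qy y with hI
  have I0 : 0 ≤ I := intervalIntegral.integral_nonneg hh.le (fun x _ => Nnn x)
  have hI' : ∫ y in (0:ℝ)..(h/2), N' y ≤ 192 * I := by
    have s1 : ∫ y in (0:ℝ)..(h/2), N' y
        ≤ ∫ t in (0:ℝ)..(h/2), 128 * (NN L px py qx qy t + NN L px py qx qy (2 * t)) := by
      apply intervalIntegral.integral_mono_on (half_pos hh).le
      · exact Continuous.intervalIntegrable (by fun_prop) _ _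
      · exact Continuous.intervalIntegrable (by fun_prop) _ _
      · intro x _; exact hNN x
    rw [intervalIntegral.integral_const_mul, intervalIntegral.integral_add,
      intervalIntegral.integral_comp_mul_left (fun t => NN L px py qx qy t) two_ne_zero] at s1
    · have s2 : ∫ t in (0:ℝ)..(h/2), NN L px py qx qy t ≤ I := by
        apply intervalIntegral.integral_mono_interval le_rfl (half_pos hh).le (by linarith)
        · exact Filter.Eventually.of_forall Nnn
        · exact cN.intervalIntegrable _ _
      have s3 : (2:ℝ) * (h / 2) = h := by ring
      rw [s3, mul_zero, ← hI, smul_eq_mul] at s1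
      linarith
    all_goals exact Continuous.intervalIntegrable (by fun_prop) _ _
  have hD' : 0 ≤ ∫ y in (0:ℝ)..(h/2), ((1 - y / (h/2)) ^ 2 *
      DD L (fun x t => 3 * py x t + 2 * (-2) * py x (2 * t))
      (fun x t => 3 * qx x t + (-4) * qx x (2 * t)) y) :=
    intervalIntegral.integral_nonneg (half_pos hh).le (fun x _ => mul_nonneg (sq_nonneg _)
      (intervalIntegral.integral_nonneg hLL (fun x _ => by positivity)))
  have hG : ∫ x in (-L)..L, (3 * p x 0 + -2 * p x (2 * 0)) * (3 * qx x 0 + -4 * qx x (2 * 0))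
      = - ∫ x in (-L)..L, p x 0 * qx x 0 := by
    rw [← intervalIntegral.integral_neg]
    congr 1; ext x
    rw [mul_zero]; ring
  rw [hG] at k2
  have r1 : 1 ≤ L ^ 2 / h ^ 2 := by
    rw [le_div_iff₀ (by positivity)]; nlinarith
  set r := L ^ 2 / h ^ 2 with hr
  have r2 : 32 * L ^ 2 / (h / 2) ^ 2 = 128 * r := by rw [hr]; field_simp; ring
  have r3 : 32 * L ^ 2 / h ^ 2 = 32 * r := by rw [hr]; ring
  have r4 : 50000 * L ^ 2 / h ^ 2 = 50000 * r := by rw [hr]; ring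
  rw [r2] at k2
  rw [r3] at k1
  rw [r4]
  have k3 : (1 + 128 * r) * (∫ y in (0:ℝ)..(h/2), N' y) ≤ (1 + 128 * r) * (192 * I) :=
    mul_le_mul_of_nonneg_left hI' (by linarith)
  have k4 : I ≤ r * I := by nlinarith
  nlinarith

lemma korn {L : ℝ} (hL : 0 < L) {p px py q qx qy : ℝ → ℝ → ℝ} (hp : Sm L p px py)
    (hq : Sm L q qx qy) {h : ℝ} (hh : 0 < h) (hhL : h ≤ L) :
    ∫ y in (-(h/2))..(h/2), DD L py qx y
      ≤ 200000 * L ^ 2 / h ^ 2 * (∫ y in (-(h/2))..(h/2), NN L px py qx qy y) := by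
  have cD := DD_cont hp hq
  have hLL : -L ≤ L := by linarith
  have k1 := half hL (hp.aff 1 (-(h/2)) 1) (hq.aff 1 (-(h/2)) 1) hh hhL
  have k2 := half hL (hp.aff 1 (h/2) (-1)) (hq.aff (-1) (h/2) (-1)) hh hhL
  have d1 : ∀ y, DD L (fun x t => 1 * 1 * py x (-(h/2) + 1 * t))
      (fun x t => 1 * qx x (-(h/2) + 1 * t)) y = DD L py qx (-(h/2) + y) := by
    intro y; simp [DD]
  have n1 : ∀ y, NN L (fun x t => 1 * px x (-(h/2) + 1 * t))
      (fun x t => 1 * 1 * py x (-(h/2) + 1 * t))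
      (fun x t => 1 * qx x (-(h/2) + 1 * t))
      (fun x t => 1 * 1 * qy x (-(h/2) + 1 * t)) y = NN L px py qx qy (-(h/2) + y) := by
    intro y; simp [NN]
  have d2 : ∀ y, DD L (fun x t => 1 * (-1) * py x (h/2 + (-1) * t))
      (fun x t => (-1) * qx x (h/2 + (-1) * t)) y = DD L py qx (h/2 - y) := by
    intro y; simp [DD, sub_eq_add_neg]
  have n2 : ∀ y, NN L (fun x t => 1 * px x (h/2 + (-1) * t))
      (fun x t => 1 * (-1) * py x (h/2 + (-1) * t))
      (fun x t => (-1) * qx x (h/2 + (-1) * t))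
      (fun x t => (-1) * (-1) * qy x (h/2 + (-1) * t)) y = NN L px py qx qy (h/2 - y) := by
    intro y
    simp only [NN]
    congr 1; ext x
    rw [show h / 2 + -1 * y = h / 2 - y by ring]; ring
  simp only [d1, n1] at k1
  simp only [d2, n2] at k2
  have f1 : ∫ y in (0:ℝ)..h, (1 - y / h) ^ 2 * DD L py qx (-(h/2) + y)
      = ∫ y in (-(h/2))..(h/2), (1 / 2 - y / h) ^ 2 * DD L py qx y := by
    have := intervalIntegral.integral_comp_add_left (a := 0) (b := h)
      (fun y => (1 / 2 - y / h) ^ 2 * DD L py qx y) (-(h/2))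
    rw [show -(h / 2) + 0 = -(h / 2) by ring, show -(h / 2) + h = h / 2 by ring] at this
    rw [← this]
    congr 1; ext y
    congr 2
    field_simp; ring
  have f2 : ∫ y in (0:ℝ)..h, (1 - y / h) ^ 2 * DD L py qx (h/2 - y)
      = ∫ y in (-(h/2))..(h/2), (1 / 2 + y / h) ^ 2 * DD L py qx y := by
    have := intervalIntegral.integral_comp_sub_left (a := 0) (b := h)
      (fun y => (1 / 2 + y / h) ^ 2 * DD L py qx y) (h/2)
    rw [show h / 2 - 0 = h / 2 by ring, show h / 2 - h = -(h / 2) by ring] at this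
    rw [← this]
    congr 1; ext y
    congr 2
    field_simp; ring
  have g1 : ∫ y in (0:ℝ)..h, NN L px py qx qy (-(h/2) + y)
      = ∫ y in (-(h/2))..(h/2), NN L px py qx qy y := by
    have := intervalIntegral.integral_comp_add_left (a := 0) (b := h)
      (fun y => NN L px py qx qy y) (-(h/2))
    rwa [show -(h / 2) + 0 = -(h / 2) by ring, show -(h / 2) + h = h / 2 by ring] at this
  have g2 : ∫ y in (0:ℝ)..h, NN L px py qx qy (h/2 - y)
      = ∫ y in (-(h/2))..(h/2), NN L px py qx qy y := by
    have := intervalIntegral.integral_comp_sub_left (a := 0) (b := h)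
      (fun y => NN L px py qx qy y) (h/2)
    rwa [show h / 2 - 0 = h / 2 by ring, show h / 2 - h = -(h / 2) by ring] at this
  rw [f1, g1] at k1
  rw [f2, g2] at k2
  have s : ∫ y in (-(h/2))..(h/2), 1 / 2 * DD L py qx y
      ≤ ∫ y in (-(h/2))..(h/2), ((1 / 2 - y / h) ^ 2 * DD L py qx y
        + (1 / 2 + y / h) ^ 2 * DD L py qx y) := by
    apply intervalIntegral.integral_mono_on (by linarith)
    · exact Continuous.intervalIntegrable (by fun_prop) _ _
    · exact Continuous.intervalIntegrable (by fun_prop) _ _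
    · intro y _
      have : 0 ≤ DD L py qx y :=
        intervalIntegral.integral_nonneg hLL (fun x _ => by positivity)
      nlinarith [mul_nonneg (sq_nonneg (y / h)) this]
  rw [intervalIntegral.integral_add, intervalIntegral.integral_const_mul] at s
  · have : 200000 * L ^ 2 / h ^ 2 = 4 * (50000 * L ^ 2 / h ^ 2) := by ring
    rw [this]
    linarith
  all_goals exact Continuous.intervalIntegrable (by fun_prop) _ _

lemma Omega_eq (L h : ℝ) : OmegaThin L h =
    (MeasurableEquiv.finTwoArrow (α := ℝ)) ⁻¹' (Ioo (-L) L ×ˢ Ioo (-(h/2)) (h/2)) := by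
  ext x; simp [OmegaThin, MeasurableEquiv.finTwoArrow]

lemma int_Omega {L h : ℝ} (hL : 0 < L) (hh : 0 < h) {F : (Fin 2 → ℝ) → ℝ} (hF : Continuous F) :
    ∫ x in OmegaThin L h, F x = ∫ y in (-(h/2))..(h/2), ∫ x in (-L)..L, F ![x, y] := by
  have hF2 : Continuous (fun z : ℝ × ℝ => F ![z.1, z.2]) := by
    apply hF.comp
    fun_prop
  have mp := volume_preserving_finTwoArrow ℝ
  have h1 := mp.setIntegral_preimage_emb (MeasurableEquiv.finTwoArrow (α := ℝ)).measurableEmbedding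
    (fun z : ℝ × ℝ => F ![z.1, z.2]) (Ioo (-L) L ×ˢ Ioo (-(h/2)) (h/2))
  rw [Omega_eq]
  have h2 : ∀ x : Fin 2 → ℝ, F ![(MeasurableEquiv.finTwoArrow x).1,
      (MeasurableEquiv.finTwoArrow x).2] = F x := by
    intro x; congr 1; ext i; fin_cases i <;> rfl
  simp only [h2] at h1
  rw [h1, Measure.volume_eq_prod, ← Measure.prod_restrict, integral_prod_symm]
  · rw [intervalIntegral.integral_of_le (by linarith), integral_Ioc_eq_integral_Ioo]
    congr 1; ext y
    rw [intervalIntegral.integral_of_le (by linarith), integral_Ioc_eq_integral_Ioo]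
  · rw [Measure.prod_restrict, ← Measure.volume_eq_prod]
    apply (hF2.continuousOn.integrableOn_compact (isCompact_Icc.prod isCompact_Icc)).mono_set
    exact prod_mono Ioo_subset_Icc_self Ioo_subset_Icc_self

lemma vol_Omega {L h : ℝ} (hL : 0 < L) (hh : 0 < h) :
    (volume (OmegaThin L h)).toReal = 2 * L * h := by
  have := int_Omega hL hh (F := fun _ => 1) continuous_const
  simp [Measure.real] at this
  rw [this]; ring

lemma grad_cont {u : (Fin 2 → ℝ) → Fin 2 → ℝ} (hu : ContDiff ℝ 1 u) (i j : Fin 2) :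
    Continuous (fun x => gradM u x i j) := by
  have h1 : ContDiff ℝ 1 (fun y => u y i) := contDiff_pi.mp hu i
  exact (h1.continuous_fderiv (by norm_num)).clm_apply continuous_const

lemma sm_u {L : ℝ} {u : (Fin 2 → ℝ) → Fin 2 → ℝ} (hu : ContDiff ℝ 1 u)
    (hper : TangPeriodic2 L u) (i : Fin 2) :
    Sm L (fun x y => u ![x, y] i) (fun x y => gradM u ![x, y] i 0)
      (fun x y => gradM u ![x, y] i 1) := by
  have h1 : ContDiff ℝ 1 (fun y => u y i) := contDiff_pi.mp hu i
  have hv : Continuous (fun z : ℝ × ℝ => ![z.1, z.2]) := by fun_prop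
  have hd : ∀ z, HasFDerivAt (fun y => u y i) (fderiv ℝ (fun y => u y i) z) z := fun z =>
    ((h1.differentiable (by norm_num)) z).hasFDerivAt
  refine ⟨h1.continuous.comp hv, (grad_cont hu i 0).comp hv, (grad_cont hu i 1).comp hv, ?_, ?_, ?_⟩
  · intro x y
    have : HasDerivAt (fun x : ℝ => ![x, y]) (Pi.single 0 1) x := by
      rw [hasDerivAt_pi]
      intro k
      fin_cases k
      · simpa using hasDerivAt_id' x
      · simpa using hasDerivAt_const x y
    exact (hd ![x, y]).comp_hasDerivAt x this
  · intro x y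
    have : HasDerivAt (fun y : ℝ => ![x, y]) (Pi.single 1 1) y := by
      rw [hasDerivAt_pi]
      intro k
      fin_cases k
      · simpa using hasDerivAt_const y x
      · simpa using hasDerivAt_id' y
    exact (hd ![x, y]).comp_hasDerivAt y this
  · intro y
    have := hper ![-L, y]
    have e : Function.update ![-L, y] 0 (![-L, y] 0 + 2 * L) = ![L, y] := by
      ext k; fin_cases k
      · simp; ring
      · simp
    rw [e] at this
    rw [this]

theorem stmt10 (L : ℝ) (hL : 0 < L) :
    ∃ C > (0 : ℝ), ∀ h : ℝ, 0 < h → h ≤ L →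
      ∀ u : (Fin 2 → ℝ) → Fin 2 → ℝ, ContDiff ℝ 1 u → TangPeriodic2 L u →
        (∑ i, ∑ j, (∫ x in OmegaThin L h, skewM u x i j) ^ 2
            ≤ (volume (OmegaThin L h)).toReal *
                ∫ x in OmegaThin L h, ∑ i, ∑ j, (symM u x i j) ^ 2) ∧
        (∫ x in OmegaThin L h, ∑ i, ∑ j, (gradM u x i j) ^ 2)
          ≤ C / h ^ 2 * ∫ x in OmegaThin L h, ∑ i, ∑ j, (symM u x i j) ^ 2 := by
  refine ⟨1000000 * L ^ 2, by positivity, ?_⟩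
  intro h hh hhL u hu hper
  have hp := sm_u hu hper 0
  have hq := sm_u hu hper 1
  have c00 := grad_cont hu 0 0
  have c01 := grad_cont hu 0 1
  have c10 := grad_cont hu 1 0
  have c11 := grad_cont hu 1 1
  have hv : Continuous (fun z : ℝ × ℝ => ![z.1, z.2]) := by fun_prop
  have hLL : -L ≤ L := by linarith
  have hh2 : -(h/2) ≤ h/2 := by linarith
  have cN := NN_cont hp hq
  have cD := DD_cont hp hq
  set N := NN L (fun x y => gradM u ![x, y] 0 0) (fun x y => gradM u ![x, y] 0 1)
    (fun x y => gradM u ![x, y] 1 0) (fun x y => gradM u ![x, y] 1 1) with hN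
  set D := DD L (fun x y => gradM u ![x, y] 0 1) (fun x y => gradM u ![x, y] 1 0) with hD
  -- the strain energy
  have hE : ∀ x, ∑ i, ∑ j, (symM u x i j) ^ 2 = gradM u x 0 0 ^ 2 + gradM u x 1 1 ^ 2
      + 1 / 2 * (gradM u x 0 1 + gradM u x 1 0) ^ 2 := by
    intro x; simp only [Fin.sum_univ_two, symM]; ring
  have hgr : ∀ x, ∑ i, ∑ j, (gradM u x i j) ^ 2 = (gradM u x 0 0 ^ 2 + gradM u x 1 1 ^ 2)
      + (gradM u x 0 1 ^ 2 + gradM u x 1 0 ^ 2) := by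
    intro x; simp only [Fin.sum_univ_two]; ring
  simp only [hE, hgr]
  have cE : Continuous (fun x => gradM u x 0 0 ^ 2 + gradM u x 1 1 ^ 2
      + 1 / 2 * (gradM u x 0 1 + gradM u x 1 0) ^ 2) := by fun_prop
  have mono2 : ∀ F F' : (Fin 2 → ℝ) → ℝ, Continuous F → Continuous F' → (∀ x, F x ≤ F' x) →
      ∫ x in OmegaThin L h, F x ≤ ∫ x in OmegaThin L h, F' x := by
    intro F F' cF cF' hle
    rw [int_Omega hL hh cF, int_Omega hL hh cF']
    apply intervalIntegral.integral_mono_on hh2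
    · exact (cont_par (F := fun x y => F ![x, y]) (cF.comp hv) _ _).intervalIntegrable _ _
    · exact (cont_par (F := fun x y => F' ![x, y]) (cF'.comp hv) _ _).intervalIntegrable _ _
    · intro y _
      apply intervalIntegral.integral_mono_on hLL
      · exact (cont_1 (F := fun x y => F ![x, y]) (cF.comp hv) _).intervalIntegrable _ _
      · exact (cont_1 (F := fun x y => F' ![x, y]) (cF'.comp hv) _).intervalIntegrable _ _
      · intro x _; exact hle _
  set E := ∫ x in OmegaThin L h, (gradM u x 0 0 ^ 2 + gradM u x 1 1 ^ 2
      + 1 / 2 * (gradM u x 0 1 + gradM u x 1 0) ^ 2) with hEd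
  constructor
  · -- part (a)
    set f := fun x => 1 / 2 * (gradM u x 0 1 + gradM u x 1 0) with hf
    have cf : Continuous f := by fun_prop
    have z0 : ∀ i, ∫ x in OmegaThin L h, skewM u x i i = 0 := by
      intro i; simp [skewM]
    have z1 : ∫ x in OmegaThin L h, skewM u x 1 0 = - ∫ x in OmegaThin L h, skewM u x 0 1 := by
      rw [← integral_neg]; congr 1; ext x; simp only [skewM]; ring
    have z2 : ∫ x in OmegaThin L h, skewM u x 0 1 = ∫ x in OmegaThin L h, f x := by
      have cs : Continuous (fun x => skewM u x 0 1) := by unfold skewM; fun_prop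
      rw [int_Omega hL hh cs, int_Omega hL hh cf]
      congr 1; ext y
      have i2 : IntervalIntegrable (fun x => gradM u ![x, y] 1 0) volume (-L) L :=
        (cont_1 (F := fun x y => gradM u ![x, y] 1 0) hq.cx y).intervalIntegrable _ _
      have hq0 : ∫ x in (-L)..L, gradM u ![x, y] 1 0 = 0 := by
        rw [intervalIntegral.integral_eq_sub_of_hasDerivAt (f := fun x => u ![x, y] 1)
          (fun t _ => hq.dx t y) (i2)]
        have := hq.per y
        rw [this, sub_self]
      have i1 : IntervalIntegrable (fun x => f ![x, y]) volume (-L) L :=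
        (cont_1 (F := fun x y => f ![x, y]) (cf.comp hv) y).intervalIntegrable _ _
      have := intervalIntegral.integral_sub i1 i2
      rw [hq0, sub_zero] at this
      rw [← this]
      congr 1; ext x; simp only [skewM, hf]; ring
    have lhs : ∑ i, ∑ j, (∫ x in OmegaThin L h, skewM u x i j) ^ 2
        = 2 * (∫ x in OmegaThin L h, f x) ^ 2 := by
      simp only [Fin.sum_univ_two, z0, z1, z2]; ring
    rw [lhs, vol_Omega hL hh]
    have cg : Continuous (fun y => ∫ x in (-L)..L, f ![x, y]) :=
      cont_par (F := fun x y => f ![x, y]) (cf.comp hv) _ _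
    have cg2 : Continuous (fun y => ∫ x in (-L)..L, f ![x, y] ^ 2) :=
      cont_par (F := fun x y => f ![x, y] ^ 2) ((cf.comp hv).pow 2) _ _
    have s1 := cs1 cg hh2
    have s2 : ∫ y in (-(h/2))..(h/2), (∫ x in (-L)..L, f ![x, y]) ^ 2
        ≤ ∫ y in (-(h/2))..(h/2), (L - -L) * ∫ x in (-L)..L, f ![x, y] ^ 2 := by
      apply intervalIntegral.integral_mono_on hh2
      · exact (cg.pow 2).intervalIntegrable _ _
      · exact (cg2.const_mul _).intervalIntegrable _ _
      · intro y _
        exact cs1 (cont_1 (F := fun x y => f ![x, y]) (cf.comp hv) y) hLL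
    rw [intervalIntegral.integral_const_mul, ← int_Omega hL hh (F := fun x => f x ^ 2) (cf.pow 2)] at s2
    rw [← int_Omega hL hh cf] at s1
    have s3 : ∫ x in OmegaThin L h, 2 * f x ^ 2 ≤ E := by
      apply mono2 _ _ (by fun_prop) cE
      intro x
      simp only [hf]
      nlinarith [sq_nonneg (gradM u x 0 0), sq_nonneg (gradM u x 1 1)]
    rw [integral_const_mul] at s3
    have s4 : (h / 2 - -(h/2)) * ∫ y in (-(h/2))..(h/2), (∫ x in (-L)..L, f ![x, y]) ^ 2
        ≤ h * ((L - -L) * ∫ x in OmegaThin L h, f x ^ 2) := by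
      rw [show h / 2 - -(h/2) = h by ring]
      exact mul_le_mul_of_nonneg_left s2 hh.le
    have s5 : 2 * L * h * (2 * ∫ x in OmegaThin L h, f x ^ 2) ≤ 2 * L * h * E :=
      mul_le_mul_of_nonneg_left s3 (by positivity)
    nlinarith
  · -- part (b)
    have k := korn hL hp hq hh hhL
    have eN : ∫ y in (-(h/2))..(h/2), N y = ∫ x in OmegaThin L h,
        (gradM u x 0 0 ^ 2 + gradM u x 1 1 ^ 2 + (gradM u x 0 1 + gradM u x 1 0) ^ 2) := by
      rw [int_Omega hL hh (by fun_prop)]; rfl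
    have hNE : ∫ y in (-(h/2))..(h/2), N y ≤ 2 * E := by
      rw [eN, hEd, ← integral_const_mul]
      apply mono2 _ _ (by fun_prop) (by fun_prop)
      intro x
      nlinarith [sq_nonneg (gradM u x 0 0), sq_nonneg (gradM u x 1 1)]
    have hND : ∫ x in OmegaThin L h, ((gradM u x 0 0 ^ 2 + gradM u x 1 1 ^ 2)
        + (gradM u x 0 1 ^ 2 + gradM u x 1 0 ^ 2))
        ≤ (∫ y in (-(h/2))..(h/2), N y) + ∫ y in (-(h/2))..(h/2), D y := by
      rw [int_Omega hL hh (by fun_prop), ← intervalIntegral.integral_add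
        (cN.intervalIntegrable _ _) (cD.intervalIntegrable _ _)]
      apply intervalIntegral.integral_mono_on hh2
      · exact (cont_par (F := fun x y => (gradM u ![x, y] 0 0 ^ 2 + gradM u ![x, y] 1 1 ^ 2)
          + (gradM u ![x, y] 0 1 ^ 2 + gradM u ![x, y] 1 0 ^ 2))
          (by fun_prop) _ _).intervalIntegrable _ _
      · exact (cN.add cD).intervalIntegrable _ _
      · intro y _
        simp only [hN, hD, NN, DD]
        rw [← intervalIntegral.integral_add]
        · apply intervalIntegral.integral_mono_on hLL
          · exact Continuous.intervalIntegrable (by fun_prop) _ _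
          · exact Continuous.intervalIntegrable (by fun_prop) _ _
          · intro x _
            nlinarith [sq_nonneg (gradM u ![x, y] 0 1 + gradM u ![x, y] 1 0)]
        all_goals exact Continuous.intervalIntegrable (by fun_prop) _ _
    have E0 : 0 ≤ E := integral_nonneg (fun x => by positivity)
    have r1 : 1 ≤ L ^ 2 / h ^ 2 := by
      rw [le_div_iff₀ (by positivity)]; nlinarith
    set r := L ^ 2 / h ^ 2 with hr
    have r3 : 200000 * L ^ 2 / h ^ 2 = 200000 * r := by rw [hr]; ring
    have r4 : 1000000 * L ^ 2 / h ^ 2 = 1000000 * r := by rw [hr]; ring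
    rw [r3] at k
    rw [r4]
    have k2 : 200000 * r * (∫ y in (-(h/2))..(h/2), N y) ≤ 200000 * r * (2 * E) :=
      mul_le_mul_of_nonneg_left hNE (by linarith)
    have k4 : E ≤ r * E := by nlinarith
    change ∫ y in (-(h/2))..(h/2), D y ≤ 200000 * r * ∫ y in (-(h/2))..(h/2), N y at k
    linarith
end
end
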